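/- Given θ ∈ (0,1], there exist constants N = N(n,θ) ≥ 1 and ρ = ρ(n,θ) ∈ (0,1], depending only on the dimension n and on θ, such that the following holds: if u is a C^{2,1} function on B_4 × [0, 1/R^2] satisfying |Δu + ∂_t u| ≤ R^2|u| + R|∇u|, ‖u‖_{L^∞(B_4 × [0,1/R^2])} ≤ 1, ‖∇u‖_{L^∞(B_4 × [0,1/R^2])} ≤ R, and ‖u(·,0)‖_{L^2(B_ρ)} ≥ θ R^{-n/2}, then ‖u(·,0) e^{-R^2|x|^2/ε}‖_{L^2(B_4)} ≥ e^{-N R^2 log(1/ε)} whenever 0 < ε ≤ 1/(3N) and R ≥ N. -/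

import Mathlib

open MeasureTheory Real Set Metric

/-- The spatial Laplacian of `f : ℝⁿ → ℝ`. -/
noncomputable def slap {n : ℕ} (f : EuclideanSpace ℝ (Fin n) → ℝ)
    (x : EuclideanSpace ℝ (Fin n)) : ℝ :=
  ∑ i : Fin n, fderiv ℝ (fun y => fderiv ℝ f y (EuclideanSpace.single i 1)) x
    (EuclideanSpace.single i 1)

/-- Euclidean space `ℝⁿ`. -/
abbrev Eu (n : ℕ) := EuclideanSpace ℝ (Fin n)

/-- The `i`-th coordinate vector. -/
noncomputable abbrev ev {n : ℕ} (i : Fin n) : Eu n := EuclideanSpace.single i 1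

/-- The unnormalised heat kernel `s^{-n/2} e^{-‖x‖²/(4s)}`. -/
noncomputable def gk (n : ℕ) (s : ℝ) (x : Eu n) : ℝ :=
  Real.exp (-((n : ℝ) / 2) * Real.log s - ‖x‖ ^ 2 / (4 * s))

/-- The total mass of `gk n s`. -/
noncomputable def gc (n : ℕ) : ℝ := (4 * π) ^ ((n : ℝ) / 2)

theorem gc_pos (n : ℕ) : 0 < gc n := by unfold gc; positivity

theorem gk_pos (n : ℕ) (s : ℝ) (x : Eu n) : 0 < gk n s x := Real.exp_pos _

theorem gk_eq {n : ℕ} {s : ℝ} (x : Eu n) :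
    gk n s x = Real.exp (-((n : ℝ) / 2) * Real.log s) * Real.exp (-(1 / (4 * s)) * ‖x‖ ^ 2) := by
  rw [gk, ← Real.exp_add]; congr 1; ring

theorem gk_integral {n : ℕ} {s : ℝ} (hs : 0 < s) : ∫ x, gk n s x = gc n := by
  simp_rw [gk_eq]
  rw [integral_const_mul, GaussianFourier.integral_rexp_neg_mul_sq_norm (by positivity)]
  rw [show π / (1 / (4 * s)) = (4 * π) * s by field_simp, Real.mul_rpow (by positivity) hs.le,
    Real.rpow_def_of_pos hs, gc, finrank_euclideanSpace_fin, mul_left_comm, ← Real.exp_add]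
  rw [show -((n : ℝ) / 2) * Real.log s + Real.log s * (n / 2) = 0 by ring]
  simp

theorem gk_integrable {n : ℕ} {s : ℝ} (hs : 0 < s) : Integrable (gk n s) := by
  by_contra h
  have := integral_undef h
  rw [gk_integral hs] at this
  exact (gc_pos n).ne' this

theorem gk_continuousOn (n : ℕ) :
    ContinuousOn (fun p : ℝ × Eu n => gk n p.1 p.2) (Ioi 0 ×ˢ univ) := by
  unfold gk
  intro p hp
  have h : p.1 ≠ 0 := (hp.1 : 0 < p.1).ne'
  have h4 : 4 * p.1 ≠ 0 := by positivity
  exact ContinuousAt.continuousWithinAt (by fun_prop (disch := assumption))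

theorem gk_continuous {n : ℕ} {s : ℝ} : Continuous (gk n s) := by
  unfold gk; fun_prop

theorem gk_hasDerivAt_time {n : ℕ} {s : ℝ} (hs : 0 < s) (x : Eu n) :
    HasDerivAt (fun r => gk n r x) ((-(n : ℝ) / (2 * s) + ‖x‖ ^ 2 / (4 * s ^ 2)) * gk n s x) s := by
  unfold gk
  have h1 := ((Real.hasDerivAt_log hs.ne').const_mul (-((n : ℝ) / 2)))
  have h2 : HasDerivAt (fun r : ℝ => ‖x‖ ^ 2 / (4 * r)) (-(‖x‖ ^ 2 / (4 * s ^ 2))) s := by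
    refine ((((hasDerivAt_id s).const_mul 4).inv (by simpa using hs.ne')).const_mul
      (‖x‖ ^ 2)).congr_deriv ?_
    simp only [id]
    field_simp
  refine (h1.sub h2).exp.congr_deriv ?_
  rw [mul_comm]; simp only [Pi.sub_apply]; congr 1; field_simp; ring

theorem norm_sq_line {n : ℕ} (x : Eu n) (i : Fin n) (r : ℝ) :
    ‖x + r • ev i‖ ^ 2 = ‖x‖ ^ 2 + 2 * r * x i + r ^ 2 := by
  rw [norm_add_sq_real, norm_smul, inner_smul_right]
  simp [EuclideanSpace.inner_single_right, ev]
  ring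

theorem hasDerivAt_norm_sq_line {n : ℕ} (x : Eu n) (i : Fin n) (r : ℝ) :
    HasDerivAt (fun r : ℝ => ‖x + r • ev i‖ ^ 2) (2 * (x + r • ev i) i) r := by
  simp_rw [norm_sq_line]
  have h1 : HasDerivAt (fun r : ℝ => 2 * r * x i) (2 * x i) r := by
    simpa using ((hasDerivAt_id r).const_mul 2).mul_const (x i)
  refine ((h1.const_add (‖x‖ ^ 2)).add (hasDerivAt_pow 2 r)).congr_deriv ?_
  simp [ev]; ring

theorem hasDerivAt_coord_line {n : ℕ} (x : Eu n) (i : Fin n) (r : ℝ) :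
    HasDerivAt (fun r : ℝ => (x + r • ev i) i) 1 r := by
  simp only [PiLp.add_apply, PiLp.smul_apply, ev, PiLp.single_apply, if_true, smul_eq_mul,
    mul_one]
  exact (hasDerivAt_id r).const_add (x i)

theorem gk_hasDerivAt_line {n : ℕ} {s : ℝ} (x : Eu n) (i : Fin n) (r : ℝ) :
    HasDerivAt (fun r : ℝ => gk n s (x + r • ev i))
      (-((x + r • ev i) i / (2 * s)) * gk n s (x + r • ev i)) r := by
  unfold gk
  have h := (((hasDerivAt_norm_sq_line x i r).div_const (4 * s)).const_sub
    (-((n : ℝ) / 2) * Real.log s)).exp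
  refine h.congr_deriv ?_
  rw [mul_comm]; congr 1; ring

theorem gk_hasDerivAt_line2 {n : ℕ} {s : ℝ} (x : Eu n) (i : Fin n) (r : ℝ) :
    HasDerivAt (fun r : ℝ => -((x + r • ev i) i / (2 * s)) * gk n s (x + r • ev i))
      ((-(1 / (2 * s)) + ((x + r • ev i) i) ^ 2 / (4 * s ^ 2)) * gk n s (x + r • ev i)) r := by
  have h := (((hasDerivAt_coord_line x i r).div_const (2 * s)).neg).mul
    (gk_hasDerivAt_line (s := s) x i r)
  refine h.congr_deriv ?_
  simp only [Pi.neg_apply]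
  ring

theorem gk_two {n : ℕ} {s : ℝ} (hs : 0 < s) (x : Eu n) :
    gk n s x = Real.exp ((n : ℝ) / 2 * Real.log 2) * Real.exp (-(‖x‖ ^ 2 / (8 * s))) *
      gk n (2 * s) x := by
  unfold gk
  rw [← Real.exp_add, ← Real.exp_add, Real.log_mul two_ne_zero hs.ne']
  congr 1
  field_simp
  ring

theorem norm_mul_gk_le {n : ℕ} {s : ℝ} (hs : 0 < s) (x : Eu n) :
    ‖x‖ * gk n s x ≤ 2 * √s * Real.exp ((n : ℝ) / 2 * Real.log 2) * gk n (2 * s) x := by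
  have hq : ‖x‖ ≤ 2 * √s * Real.exp (‖x‖ ^ 2 / (8 * s)) := by
    have h1 := Real.add_one_le_exp (‖x‖ ^ 2 / (8 * s))
    have h2 : 0 < √s := Real.sqrt_pos.2 hs
    have h3 : √s ^ 2 = s := Real.sq_sqrt hs.le
    have h4 : ‖x‖ ≤ 2 * √s * (‖x‖ ^ 2 / (8 * s) + 1) := by
      have : 2 * √s * (‖x‖ ^ 2 / (8 * √s ^ 2) + 1) - ‖x‖ = (‖x‖ - 2 * √s) ^ 2 / (4 * √s) + √s := by
        field_simp; ring
      have : 0 ≤ (‖x‖ - 2 * √s) ^ 2 / (4 * √s) := by positivity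
      rw [h3] at *
      linarith
    refine h4.trans ?_
    gcongr
  have h5 : Real.exp (‖x‖ ^ 2 / (8 * s)) * Real.exp (-(‖x‖ ^ 2 / (8 * s))) = 1 := by
    rw [← Real.exp_add]; simp
  have hp := gk_pos n (2 * s) x
  rw [gk_two hs]
  calc _ ≤ (2 * √s * Real.exp (‖x‖ ^ 2 / (8 * s))) * _ := by
        gcongr
    _ = 2 * √s * Real.exp ((n : ℝ) / 2 * Real.log 2) * gk n (2 * s) x *
        (Real.exp (‖x‖ ^ 2 / (8 * s)) * Real.exp (-(‖x‖ ^ 2 / (8 * s)))) := by ring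
    _ = _ := by rw [h5, mul_one]

theorem gk_translate_le {n : ℕ} {s l : ℝ} (hs : 0 < s) (hl : 0 < l) (y : Eu n) :
    ∫ x, |gk n s (x + y) - gk n s x| ≤ gc n * (l * ‖y‖ ^ 2 / (16 * s) + 2 / l) := by
  have hi := gk_integrable (n := n) hs
  have hiy : Integrable (fun x => gk n s (x + y)) := hi.comp_add_right y
  have hih : Integrable (fun x => gk n s (x + (1 / 2 : ℝ) • y)) := hi.comp_add_right _
  have hab : ∀ x, |gk n s (x + y) - gk n s x| ≤ (l / 2 + 1 / l) * (gk n s (x + y) + gk n s x)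
      - l * Real.exp (-(‖y‖ ^ 2 / (16 * s))) * gk n s (x + (1 / 2 : ℝ) • y) := by
    intro x
    set a := Real.exp (1 / 2 * (-((n : ℝ) / 2) * Real.log s - ‖x + y‖ ^ 2 / (4 * s)))
    set b := Real.exp (1 / 2 * (-((n : ℝ) / 2) * Real.log s - ‖x‖ ^ 2 / (4 * s)))
    have ha : gk n s (x + y) = a ^ 2 := by
      rw [gk, ← Real.exp_nat_mul]; congr 1; push_cast; ring
    have hb : gk n s x = b ^ 2 := by
      rw [gk, ← Real.exp_nat_mul]; congr 1; push_cast; ring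
    have hc : Real.exp (-(‖y‖ ^ 2 / (16 * s))) * gk n s (x + (1 / 2 : ℝ) • y) = a * b := by
      rw [gk, ← Real.exp_add, ← Real.exp_add]; congr 1
      rw [norm_add_sq_real, norm_add_sq_real, norm_smul, inner_smul_right]
      norm_num
      field_simp
      ring
    rw [mul_assoc, hc, ha, hb]
    have hinv : l * (1 / l) = 1 := by field_simp
    have hl' : 0 < 1 / l := by positivity
    set k := 1 / l
    rw [abs_le]
    have e1 : 0 ≤ k * (l * (a - b) + (a + b)) ^ 2 := by positivity
    have e2 : 0 ≤ k * (l * (a - b) - (a + b)) ^ 2 := by positivity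
    have e3 : k * (l * (a - b) + (a + b)) ^ 2 =
        l * (a - b) ^ 2 + 2 * (a ^ 2 - b ^ 2) + k * (a + b) ^ 2 := by
      linear_combination (l * (a - b) ^ 2 + 2 * (a ^ 2 - b ^ 2)) * hinv
    have e4 : k * (l * (a - b) - (a + b)) ^ 2 =
        l * (a - b) ^ 2 - 2 * (a ^ 2 - b ^ 2) + k * (a + b) ^ 2 := by
      linear_combination (l * (a - b) ^ 2 - 2 * (a ^ 2 - b ^ 2)) * hinv
    have e5 : 0 ≤ k * (a - b) ^ 2 := by positivity
    constructor <;> nlinarith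
  refine (integral_mono_of_nonneg (Filter.Eventually.of_forall fun _ => abs_nonneg _) ?_
    (Filter.Eventually.of_forall hab)).trans ?_
  · exact ((hiy.add hi).const_mul _).sub (hih.const_mul _)
  · have hadd : Integrable (fun x => (l / 2 + 1 / l) * (gk n s (x + y) + gk n s x)) :=
      (hiy.add hi).const_mul _
    rw [integral_sub hadd (hih.const_mul _), integral_const_mul, integral_const_mul, integral_add hiy hi, integral_add_right_eq_self (gk n s),
      integral_add_right_eq_self (gk n s), gk_integral hs]
    have := Real.add_one_le_exp (-(‖y‖ ^ 2 / (16 * s)))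
    have h2 : l * (1 - ‖y‖ ^ 2 / (16 * s)) ≤ l * Real.exp (-(‖y‖ ^ 2 / (16 * s))) := by
      gcongr; linarith
    have h3 := mul_le_mul_of_nonneg_right h2 (gc_pos n).le
    have h4 : (l / 2 + 1 / l) * (gc n + gc n) - l * (1 - ‖y‖ ^ 2 / (16 * s)) * gc n =
      gc n * (l * ‖y‖ ^ 2 / (16 * s) + 2 / l) := by ring
    linarith

/-- Differentiation under the integral sign for compactly supported integrands. -/
theorem hasDerivAt_integral_of_compact {E : Type*} [TopologicalSpace E] [MeasurableSpace E]
    [OpensMeasurableSpace E] [T2Space E] [SecondCountableTopology E] {μ : Measure E}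
    [IsFiniteMeasureOnCompacts μ] {K : Set E} (hK : IsCompact K)
    {k k' : ℝ → E → ℝ} {U : Set ℝ} (hU : IsOpen U) {s : ℝ} (hs : s ∈ U)
    (hk : ∀ r ∈ U, Continuous (k r)) (hd : ∀ r ∈ U, ∀ y, HasDerivAt (fun r => k r y) (k' r y) r)
    (hc : ContinuousOn (fun p : ℝ × E => k' p.1 p.2) (U ×ˢ univ))
    (h0 : ∀ r ∈ U, ∀ y ∉ K, k r y = 0) :
    HasDerivAt (fun r => ∫ y, k r y ∂μ) (∫ y, k' s y ∂μ) s := by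
  obtain ⟨e, he, hes⟩ := Metric.isOpen_iff.1 hU s hs
  have hsub : closedBall s (e / 2) ⊆ U :=
    (closedBall_subset_ball (by linarith)).trans hes
  have h0' : ∀ r ∈ U, ∀ y ∉ K, k' r y = 0 := by
    intro r hr y hy
    have h1 := hd r hr y
    have h2 : HasDerivAt (fun r => k r y) 0 r :=
      (hasDerivAt_const r (0 : ℝ)).congr_of_eventuallyEq
        (Filter.eventuallyEq_of_mem (hU.mem_nhds hr) fun r hr => h0 r hr y hy)
    exact h1.unique h2
  obtain ⟨C, hC⟩ := ((isCompact_closedBall s (e / 2)).prod hK).exists_bound_of_continuousOn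
    (hc.mono (prod_mono hsub (subset_univ _)))
  have hk' : ∀ r ∈ U, Continuous (k' r) := fun r hr =>
    hc.comp_continuous (by fun_prop : Continuous fun y : E => (r, y)) fun y => ⟨hr, mem_univ _⟩
  have hintg : ∀ g : E → ℝ, Continuous g → (∀ y ∉ K, g y = 0) → Integrable g μ := fun g hg hg0 =>
    hg.integrable_of_hasCompactSupport (HasCompactSupport.intro hK hg0)
  refine (hasDerivAt_integral_of_dominated_loc_of_deriv_le (bound := K.indicator fun _ => C)
    (closedBall_mem_nhds s (by linarith : 0 < e / 2)) ?_ (hintg _ (hk s hs) (h0 s hs))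
    (hk' s hs).aestronglyMeasurable ?_ ?_ ?_).2
  · exact Filter.eventually_of_mem (hU.mem_nhds hs) fun r hr => (hk r hr).aestronglyMeasurable
  · refine Filter.Eventually.of_forall fun y r hr => ?_
    by_cases hy : y ∈ K
    · simpa [hy] using hC (r, y) ⟨hr, hy⟩
    · simp [hy, h0' r (hsub hr) y hy]
  · exact (integrable_indicator_iff hK.measurableSet).2
      (integrableOn_const hK.measure_lt_top.ne)
  · exact Filter.Eventually.of_forall fun y r hr => hd r (hsub hr) y

/-- The heat semigroup. -/
noncomputable def hp (n : ℕ) (s : ℝ) (f : Eu n → ℝ) (x : Eu n) : ℝ :=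
  (gc n)⁻¹ * ∫ y, gk n s (x - y) * f y

theorem hp_abs_le {n : ℕ} {s M : ℝ} (hs : 0 < s) {f : Eu n → ℝ} (hM : ∀ x, |f x| ≤ M) (x : Eu n) :
    |hp n s f x| ≤ M := by
  have hc := gc_pos n
  rw [hp, abs_mul, abs_of_pos (inv_pos.2 hc), inv_mul_le_iff₀ hc]
  have hi : Integrable fun y => gk n s (x - y) := (gk_integrable hs).comp_sub_left x
  calc |∫ y, gk n s (x - y) * f y| ≤ ∫ y, gk n s (x - y) * M := by
        rw [← Real.norm_eq_abs]
        refine norm_integral_le_of_norm_le (hi.mul_const M) (Filter.Eventually.of_forall fun y => ?_)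
        rw [norm_mul, Real.norm_eq_abs, Real.norm_eq_abs, abs_of_pos (gk_pos _ _ _)]
        exact mul_le_mul_of_nonneg_left (hM y) (gk_pos _ _ _).le
    _ = gc n * M := by
        rw [integral_mul_const, integral_sub_left_eq_self (gk n s), gk_integral hs]

theorem gk_mul_integrable {n : ℕ} {s M : ℝ} (hs : 0 < s) {f : Eu n → ℝ} (hf : Continuous f)
    (hM : ∀ x, |f x| ≤ M) (x : Eu n) : Integrable fun y => gk n s (x - y) * f y := by
  have hi : Integrable fun y => gk n s (x - y) := (gk_integrable hs).comp_sub_left x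
  exact hi.mul_bdd (c := M) hf.aestronglyMeasurable (Filter.Eventually.of_forall hM)

theorem hp_sub_le {n : ℕ} {s M L : ℝ} (hs : 0 < s) {f : Eu n → ℝ} (hf : Continuous f)
    (hM : ∀ x, |f x| ≤ M) (hL : 0 ≤ L) (hLip : ∀ x y, |f x - f y| ≤ L * ‖x - y‖) (x : Eu n) :
    |hp n s f x - f x| ≤ L * (2 * √s * Real.exp ((n : ℝ) / 2 * Real.log 2)) := by
  have hc := gc_pos n
  have hi : Integrable fun y => gk n s (x - y) := (gk_integrable hs).comp_sub_left x
  have hi2 : Integrable fun y => gk n (2 * s) (x - y) :=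
    (gk_integrable (by positivity)).comp_sub_left x
  have h1 : hp n s f x - f x = (gc n)⁻¹ * ∫ y, gk n s (x - y) * (f y - f x) := by
    simp_rw [mul_sub]
    rw [integral_sub (gk_mul_integrable hs hf hM x) (hi.mul_const _), integral_mul_const,
      integral_sub_left_eq_self (gk n s), gk_integral hs, hp]
    field_simp
  rw [h1, abs_mul, abs_of_pos (inv_pos.2 hc), inv_mul_le_iff₀ hc]
  set q := 2 * √s * Real.exp ((n : ℝ) / 2 * Real.log 2)
  calc |∫ y, gk n s (x - y) * (f y - f x)| ≤ ∫ y, (L * q) * gk n (2 * s) (x - y) := by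
        rw [← Real.norm_eq_abs]
        refine norm_integral_le_of_norm_le (hi2.const_mul _) (Filter.Eventually.of_forall fun y => ?_)
        rw [norm_mul, Real.norm_eq_abs, Real.norm_eq_abs, abs_of_pos (gk_pos _ _ _)]
        have h2 := hLip y x
        rw [norm_sub_rev] at h2
        have h3 := norm_mul_gk_le hs (x - y)
        calc _ ≤ gk n s (x - y) * (L * ‖x - y‖) :=
              mul_le_mul_of_nonneg_left h2 (gk_pos _ _ _).le
          _ = L * (‖x - y‖ * gk n s (x - y)) := by ring
          _ ≤ L * (q * gk n (2 * s) (x - y)) := by gcongr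
          _ = _ := by ring
    _ = gc n * (L * q) := by
        rw [integral_const_mul, integral_sub_left_eq_self (gk n (2 * s)), gk_integral (by positivity)]
        ring

section caloric
variable {n : ℕ} {f : Eu n → ℝ} {r : ℝ}

theorem hp_continuousOn (hf : Continuous f) (h0 : ∀ x ∉ closedBall (0 : Eu n) r, f x = 0) :
    ContinuousOn (fun p : ℝ × Eu n => hp n p.1 f p.2) (Ioi 0 ×ˢ univ) := by
  unfold hp
  refine continuousOn_const.mul ?_
  refine continuousOn_integral_of_compact_support (isCompact_closedBall (0 : Eu n) r) ?_ ?_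
  · refine ContinuousOn.mul ?_ (by fun_prop)
    exact (gk_continuousOn n).comp (f := fun q : (ℝ × Eu n) × Eu n => (q.1.1, q.1.2 - q.2))
      (by fun_prop) fun q hq => ⟨hq.1.1, mem_univ _⟩
  · intro p y _ hy
    simp [h0 y hy]

theorem hp_hasDerivAt_time (hf : Continuous f) (h0 : ∀ x ∉ closedBall (0 : Eu n) r, f x = 0)
    {s : ℝ} (hs : 0 < s) (x : Eu n) :
    HasDerivAt (fun s => hp n s f x) ((gc n)⁻¹ * ∫ y,
      (-(n : ℝ) / (2 * s) + ‖x - y‖ ^ 2 / (4 * s ^ 2)) * gk n s (x - y) * f y) s := by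
  unfold hp
  refine HasDerivAt.const_mul _ ?_
  refine hasDerivAt_integral_of_compact (U := Ioi 0)
    (k' := fun s y => (-(n : ℝ) / (2 * s) + ‖x - y‖ ^ 2 / (4 * s ^ 2)) * gk n s (x - y) * f y)
    (isCompact_closedBall (0 : Eu n) r) isOpen_Ioi hs
    (fun r _ => (gk_continuous.comp (by fun_prop)).mul hf)
    (fun r hr y => (gk_hasDerivAt_time hr _).mul_const _) ?_ (fun r _ y hy => by simp [h0 y hy])
  refine ContinuousOn.mul (ContinuousOn.mul ?_ ?_) (by fun_prop)
  · intro p hp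
    have h : p.1 ≠ 0 := (hp.1 : 0 < p.1).ne'
    have h4 : 2 * p.1 ≠ 0 := by positivity
    have h5 : 4 * p.1 ^ 2 ≠ 0 := by positivity
    exact ContinuousAt.continuousWithinAt (by fun_prop (disch := assumption))
  · exact (gk_continuousOn n).comp (f := fun q : ℝ × Eu n => (q.1, x - q.2))
      (by fun_prop) fun q hq => ⟨hq.1, mem_univ _⟩

theorem hp_hasDerivAt_line (hf : Continuous f) (h0 : ∀ x ∉ closedBall (0 : Eu n) r, f x = 0)
    {s : ℝ} (x : Eu n) (i : Fin n) (t : ℝ) :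
    HasDerivAt (fun t : ℝ => hp n s f (x + t • ev i)) ((gc n)⁻¹ * ∫ y,
      (-((x - y + t • ev i) i / (2 * s)) * gk n s (x - y + t • ev i)) * f y) t := by
  unfold hp
  simp_rw [add_sub_right_comm]
  refine HasDerivAt.const_mul _ ?_
  refine hasDerivAt_integral_of_compact (U := univ)
    (k' := fun t y => (-((x - y + t • ev i) i / (2 * s)) * gk n s (x - y + t • ev i)) * f y)
    (isCompact_closedBall (0 : Eu n) r) isOpen_univ (mem_univ _)
    (fun r _ => (gk_continuous.comp (by fun_prop)).mul hf)
    (fun r hr y => (gk_hasDerivAt_line _ i _).mul_const _) ?_ (fun r _ y hy => by simp [h0 y hy])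
  refine Continuous.continuousOn (Continuous.mul (Continuous.mul ?_ ?_) (by fun_prop))
  · simp only [PiLp.add_apply, PiLp.sub_apply, PiLp.smul_apply]
    fun_prop
  · exact gk_continuous.comp (by fun_prop)

theorem hp_hasDerivAt_line2 (hf : Continuous f) (h0 : ∀ x ∉ closedBall (0 : Eu n) r, f x = 0)
    {s : ℝ} (x : Eu n) (i : Fin n) (t : ℝ) :
    HasDerivAt (fun t : ℝ => (gc n)⁻¹ * ∫ y,
        (-((x - y + t • ev i) i / (2 * s)) * gk n s (x - y + t • ev i)) * f y)
      ((gc n)⁻¹ * ∫ y, ((-(1 / (2 * s)) + ((x - y + t • ev i) i) ^ 2 / (4 * s ^ 2)) *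
        gk n s (x - y + t • ev i)) * f y) t := by
  refine HasDerivAt.const_mul _ ?_
  refine hasDerivAt_integral_of_compact (U := univ)
    (k' := fun t y => ((-(1 / (2 * s)) + ((x - y + t • ev i) i) ^ 2 / (4 * s ^ 2)) *
        gk n s (x - y + t • ev i)) * f y)
    (isCompact_closedBall (0 : Eu n) r) isOpen_univ (mem_univ _)
    (fun r _ => Continuous.mul (Continuous.mul ?_ (gk_continuous.comp (by fun_prop))) hf)
    (fun r hr y => (gk_hasDerivAt_line2 _ i _).mul_const _) ?_ (fun r _ y hy => by simp [h0 y hy])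
  · simp only [PiLp.add_apply, PiLp.sub_apply, PiLp.smul_apply]
    fun_prop
  refine Continuous.continuousOn (Continuous.mul (Continuous.mul ?_ ?_) (by fun_prop))
  · simp only [PiLp.add_apply, PiLp.sub_apply, PiLp.smul_apply]
    fun_prop
  · exact gk_continuous.comp (by fun_prop)

theorem hp_caloric (hf : Continuous f) (h0 : ∀ x ∉ closedBall (0 : Eu n) r, f x = 0)
    {s : ℝ} (x : Eu n) :
    ∑ i : Fin n, ((gc n)⁻¹ * ∫ y, ((-(1 / (2 * s)) + ((x - y + (0 : ℝ) • ev i) i) ^ 2 / (4 * s ^ 2)) *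
        gk n s (x - y + (0 : ℝ) • ev i)) * f y) = (gc n)⁻¹ * ∫ y,
      (-(n : ℝ) / (2 * s) + ‖x - y‖ ^ 2 / (4 * s ^ 2)) * gk n s (x - y) * f y := by
  rw [← Finset.mul_sum]
  congr 1
  simp only [zero_smul, add_zero]
  rw [← integral_finsetSum]
  · congr 1; ext y
    rw [← Finset.sum_mul, ← Finset.sum_mul, Finset.sum_add_distrib, ← Finset.sum_div,
      EuclideanSpace.real_norm_sq_eq]
    simp
    left; left; ring
  · intro i _
    refine Continuous.integrable_of_hasCompactSupport ?_
      (HasCompactSupport.intro (isCompact_closedBall (0 : Eu n) r) fun y hy => by simp [h0 y hy])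
    refine Continuous.mul (Continuous.mul ?_ (gk_continuous.comp (by fun_prop))) hf
    simp only [PiLp.sub_apply]
    fun_prop

end caloric

theorem second_deriv_nonpos_of_isLocalMax {g g' : ℝ → ℝ} {g2 : ℝ} (hg : ∀ r, HasDerivAt g (g' r) r)
    (hg' : HasDerivAt g' g2 0) (hm : IsLocalMax g 0) : g2 ≤ 0 := by
  by_contra! h
  have hd : deriv g = g' := funext fun r => (hg r).deriv
  have h0 : g' 0 = 0 := hm.hasDerivAt_eq_zero (hg 0)
  have hmin : IsLocalMin g 0 := isLocalMin_of_deriv_deriv_pos (by rw [hd, hg'.deriv]; exact h)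
    (by rw [hd, h0]) (hg 0).continuousAt
  have hconst : g =ᶠ[nhds 0] fun _ => g 0 := by
    filter_upwards [hm, hmin] with r h1 h2 using le_antisymm h1 h2
  have h1 : g' =ᶠ[nhds 0] fun _ => 0 := by
    filter_upwards [hconst.eventuallyEq_nhds] with r hr
    have := (hasDerivAt_const r (g 0)).congr_of_eventuallyEq hr
    exact (hg r).unique this
  have h2 := (hasDerivAt_const (0 : ℝ) (0 : ℝ)).congr_of_eventuallyEq h1
  exact h.ne' (hg'.unique h2)

theorem hasDerivWithinAt_nonpos_of_max {g : ℝ → ℝ} {g' t t1 : ℝ} (ht : t < t1)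
    (hg : HasDerivWithinAt g g' (Icc t t1) t) (hm : ∀ s ∈ Icc t t1, g s ≤ g t) : g' ≤ 0 := by
  have h1 : HasDerivWithinAt g g' (Ioi t) t :=
    (hg.mono Ioo_subset_Icc_self).mono_of_mem_nhdsWithin (Ioo_mem_nhdsGT ht)
  rw [hasDerivWithinAt_iff_tendsto_slope' self_notMem_Ioi] at h1
  refine le_of_tendsto h1 ?_
  filter_upwards [Ioo_mem_nhdsGT ht] with s hs
  rw [slope_def_field]
  exact div_nonpos_of_nonpos_of_nonneg (by linarith [hm s (Ioo_subset_Icc_self hs)])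
    (by linarith [hs.1])

theorem heat_comparison {n : ℕ} {z zt : Eu n → ℝ → ℝ} {z2 : Fin n → Eu n → ℝ → ℝ}
    {t0 t1 A c M L r : ℝ} (h01 : t0 < t1) (hc : 0 ≤ c) (hL : 0 ≤ L)
    (hcont : ContinuousOn (fun p : Eu n × ℝ => z p.1 p.2) (univ ×ˢ Icc t0 t1))
    (hM : ∀ x, ∀ t ∈ Icc t0 t1, |z x t| ≤ M)
    (hLip : ∀ x y, |z x t1 - z y t1| ≤ L * ‖x - y‖)
    (h0 : ∀ x ∉ closedBall (0 : Eu n) r, z x t1 = 0)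
    (hx : ∀ t ∈ Ico t0 t1, ∀ x i, ∃ g' : ℝ → ℝ,
      (∀ r, HasDerivAt (fun r : ℝ => z (x + r • ev i) t) (g' r) r) ∧ HasDerivAt g' (z2 i x t) 0)
    (ht : ∀ t ∈ Ico t0 t1, ∀ x, HasDerivWithinAt (z x) (zt x t) (Icc t0 t1) t)
    (x0 : Eu n)
    (hz : ∀ t ∈ Ico t0 t1, ∀ x, ∑ i, z2 i x t + zt x t ≤ A + c * ‖x - x0‖ ^ 2) :
    hp n (t1 - t0) (fun y => z y t1) x0 - z x0 t0 ≤ (t1 - t0) * A + c * n * (t1 - t0) ^ 2 := by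
  set f : Eu n → ℝ := fun y => z y t1 with hf
  have hfc : Continuous f :=
    hcont.comp_continuous (by fun_prop : Continuous fun y : Eu n => (y, t1))
      fun y => ⟨mem_univ _, right_mem_Icc.2 h01.le⟩
  have hfM : ∀ x, |f x| ≤ M := fun x => hM x t1 (right_mem_Icc.2 h01.le)
  set K := Real.exp ((n : ℝ) / 2 * Real.log 2)
  have key : ∀ δ > 0, hp n (t1 - t0 + δ) f x0 - z x0 t0 ≤ (t1 - t0) * A + c * n * (t1 - t0) ^ 2
      + (δ * (2 * n + 1) * (t1 - t0) + L * (2 * √δ * K)) := by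
    intro δ hδ
    set Z : Eu n → ℝ → ℝ := fun x t => hp n (t1 - t + δ) f x - z x t - A * (t1 - t)
      - c * (‖x - x0‖ ^ 2 * (t1 - t) + n * (t1 - t) ^ 2)
      - δ * (‖x - x0‖ ^ 2 + (2 * n + 1) * (t1 - t)) - L * (2 * √δ * K) with hZ
    suffices h : Z x0 t0 ≤ 0 by
      simp only [hZ, sub_self, norm_zero] at h
      linarith
    by_contra! hpos
    have hKpos : 0 < K := Real.exp_pos _
    set Q := 2 * M + |A| * (t1 - t0) with hQ
    have hM0 : 0 ≤ M := (abs_nonneg _).trans (hfM x0)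
    have hQ0 : 0 ≤ Q := by have := sub_pos.2 h01; positivity
    have hfar : ∀ x, ∀ t ∈ Icc t0 t1, Z x t ≤ Q - δ * ‖x - x0‖ ^ 2 := by
      intro x t ht
      have e1 := (abs_le.1 (hp_abs_le (n := n) (by linarith [ht.2] : 0 < t1 - t + δ) hfM x)).2
      have e2 := (abs_le.1 (hM x t ht)).1
      have e3 : -A * (t1 - t) ≤ |A| * (t1 - t0) := by
        have := sub_nonneg.2 ht.2
        calc -A * (t1 - t) ≤ |A| * (t1 - t) := by gcongr; exact neg_le_abs A
          _ ≤ _ := by gcongr; exact ht.1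
      have e4 : 0 ≤ c * (‖x - x0‖ ^ 2 * (t1 - t) + n * (t1 - t) ^ 2) := by
        have := sub_nonneg.2 ht.2
        positivity
      have e5 : 0 ≤ δ * ((2 * n + 1) * (t1 - t)) := by
        have := sub_nonneg.2 ht.2
        positivity
      have e6 : 0 ≤ L * (2 * √δ * K) := by positivity
      simp only [hZ]
      linarith
    set ϱ := Q / δ + 1 with hϱ
    have hϱ1 : 1 ≤ ϱ := by rw [hϱ]; linarith [div_nonneg hQ0 hδ.le]
    have hϱ2 : ∀ x, ∀ t ∈ Icc t0 t1, 0 < Z x t → ‖x - x0‖ < ϱ := by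
      intro x t ht hxt
      by_contra! h
      have h1 := hfar x t ht
      have h2 : ϱ ≤ ‖x - x0‖ ^ 2 := by nlinarith
      have h3 : δ * ϱ ≤ δ * ‖x - x0‖ ^ 2 := by gcongr
      have h4 : δ * ϱ = Q + δ := by rw [hϱ]; field_simp
      linarith
    have hZc : ContinuousOn (fun p : Eu n × ℝ => Z p.1 p.2) (univ ×ˢ Icc t0 t1) := by
      have hV : ContinuousOn (fun p : Eu n × ℝ => hp n (t1 - p.2 + δ) f p.1)
          (univ ×ˢ Icc t0 t1) :=
        (hp_continuousOn hfc h0).comp (f := fun p : Eu n × ℝ => (t1 - p.2 + δ, p.1))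
          (by fun_prop) fun p hp => ⟨by
            have := hp.2.2
            simp only [mem_Ioi]; linarith, mem_univ _⟩
      simp only [hZ]
      fun_prop
    obtain ⟨⟨x, t⟩, ⟨-, htI⟩, hmax⟩ :=
      ((isCompact_closedBall x0 ϱ).prod (isCompact_Icc (a := t0) (b := t1))).exists_isMaxOn
        ⟨(x0, t0), mem_closedBall_self (by linarith), left_mem_Icc.2 h01.le⟩
        (hZc.mono (prod_mono (subset_univ _) subset_rfl))
    simp only at htI
    have hmax' : ∀ y, ∀ s ∈ Icc t0 t1, ‖y - x0‖ ≤ ϱ → Z y s ≤ Z x t := fun y s hs hy =>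
      hmax (a := (y, s)) ⟨by simpa [dist_eq_norm] using hy, hs⟩
    have hxt : 0 < Z x t :=
      hpos.trans_le (hmax' x0 t0 (left_mem_Icc.2 h01.le) (by simp; linarith))
    have hxϱ := hϱ2 x t htI hxt
    have htlt : t < t1 := by
      refine lt_of_le_of_ne htI.2 fun h => ?_
      subst h
      have h1 := hp_sub_le hδ hfc hfM hL hLip x
      have h2 := (abs_le.1 h1).2
      have h3 : 0 ≤ δ * ‖x - x0‖ ^ 2 := by positivity
      simp only [hZ, sub_self, zero_add] at hxt
      simp only [hf] at h2 hxt
      linarith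
    have htI' : t ∈ Ico t0 t1 := ⟨htI.1, htlt⟩
    have hs : 0 < t1 - t + δ := by linarith
    have hsp : ∀ i, (gc n)⁻¹ * (∫ y, ((-(1 / (2 * (t1 - t + δ))) +
        ((x - y + (0 : ℝ) • ev i) i) ^ 2 / (4 * (t1 - t + δ) ^ 2)) *
        gk n (t1 - t + δ) (x - y + (0 : ℝ) • ev i)) * f y) - z2 i x t - c * (2 * (t1 - t)) - δ * 2
        ≤ 0 := by
      intro i
      obtain ⟨g', hg1, hg2⟩ := hx t htI' x i
      have hl1 := fun r => hp_hasDerivAt_line hfc h0 (s := t1 - t + δ) x i r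
      have hl2 := hp_hasDerivAt_line2 hfc h0 (s := t1 - t + δ) x i 0
      have hn1 : ∀ r : ℝ, HasDerivAt (fun r : ℝ => ‖x + r • ev i - x0‖ ^ 2)
          (2 * (x - x0 + r • ev i) i) r := by
        intro r
        simp_rw [add_sub_right_comm]
        exact hasDerivAt_norm_sq_line (x - x0) i r
      have hn2 := hasDerivAt_coord_line (x - x0) i 0
      refine second_deriv_nonpos_of_isLocalMax (g := fun r => Z (x + r • ev i) t)
        (fun r => ((((((hl1 r).sub (hg1 r)).sub_const _).sub
          ((((hn1 r).mul_const (t1 - t)).add_const _).const_mul c))).sub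
          (((hn1 r).add_const _).const_mul δ)).sub_const _)
        ((((hl2.sub hg2).sub (((hn2.const_mul 2).mul_const (t1 - t)).const_mul c)).sub
          ((hn2.const_mul 2).const_mul δ)).congr_deriv ?_) ?_
      · ring
      · have hev : ∀ᶠ r : ℝ in nhds 0, ‖x + r • ev i - x0‖ < ϱ := by
          have : Continuous fun r : ℝ => ‖x + r • ev i - x0‖ := by fun_prop
          exact this.continuousAt.eventually_lt continuousAt_const (by simpa using hxϱ)
        filter_upwards [hev] with r hr
        simpa using hmax' _ t htI hr.le
    have htm : -((gc n)⁻¹ * (∫ y, (-(n : ℝ) / (2 * (t1 - t + δ)) +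
        ‖x - y‖ ^ 2 / (4 * (t1 - t + δ) ^ 2)) * gk n (t1 - t + δ) (x - y) * f y)) - zt x t + A
        + c * (‖x - x0‖ ^ 2 + 2 * n * (t1 - t)) + δ * (2 * n + 1) ≤ 0 := by
      refine hasDerivWithinAt_nonpos_of_max (g := Z x) htlt ?_ fun s hs =>
        hmax' x s ⟨htI.1.trans hs.1, hs.2⟩ hxϱ.le
      have hlin : HasDerivAt (fun t => t1 - t) (-1) t := by
        simpa using (hasDerivAt_id t).const_sub t1
      have hV : HasDerivAt (fun t => hp n (t1 - t + δ) f x) _ t :=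
        HasDerivAt.comp t (h₂ := fun s => hp n s f x) (h := fun t => t1 - t + δ)
          (hp_hasDerivAt_time hfc h0 hs x) (hlin.add_const δ)
      have hzt := (ht t htI' x).mono (Icc_subset_Icc_left htI.1)
      have hr1 := (hlin.const_mul (‖x - x0‖ ^ 2)).add ((hlin.pow 2).const_mul (n : ℝ))
      have hr2 := (hlin.const_mul (2 * (n : ℝ) + 1)).const_add (‖x - x0‖ ^ 2)
      refine (((((hV.hasDerivWithinAt.sub hzt).sub (hlin.const_mul A).hasDerivWithinAt).sub
        (hr1.const_mul c).hasDerivWithinAt).sub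
        (hr2.const_mul δ).hasDerivWithinAt).sub_const (L * (2 * √δ * K))).congr_deriv ?_
      simp
      ring
    have hsum := Finset.sum_nonpos fun i (_ : i ∈ Finset.univ) => hsp i
    rw [Finset.sum_sub_distrib, Finset.sum_sub_distrib, Finset.sum_sub_distrib,
      hp_caloric hfc h0 x] at hsum
    simp only [Finset.sum_const, Finset.card_univ, Fintype.card_fin, nsmul_eq_mul] at hsum
    have := hz t htI' x
    nlinarith
  have hlim1 : Filter.Tendsto (fun δ => hp n (t1 - t0 + δ) f x0 - z x0 t0)
      (nhdsWithin 0 (Ioi 0)) (nhds (hp n (t1 - t0) f x0 - z x0 t0)) := by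
    have h1 := (hp_hasDerivAt_time hfc h0 (sub_pos.2 h01) x0).continuousAt
    have h2 : ContinuousAt (fun δ => hp n (t1 - t0 + δ) f x0 - z x0 t0) 0 :=
      ContinuousAt.sub (ContinuousAt.comp (g := fun s => hp n s f x0) (x := (0 : ℝ)) (f := fun δ => t1 - t0 + δ) (by simpa using h1)
        (by fun_prop)) continuousAt_const
    have := h2.tendsto.mono_left (nhdsWithin_le_nhds (s := Ioi 0))
    simpa using this
  have hlim2 : Filter.Tendsto (fun δ => (t1 - t0) * A + c * n * (t1 - t0) ^ 2
      + (δ * (2 * n + 1) * (t1 - t0) + L * (2 * √δ * K)))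
      (nhdsWithin 0 (Ioi 0)) (nhds ((t1 - t0) * A + c * n * (t1 - t0) ^ 2)) := by
    have : Continuous (fun δ => (t1 - t0) * A + c * n * (t1 - t0) ^ 2
      + (δ * (2 * n + 1) * (t1 - t0) + L * (2 * √δ * K))) := by fun_prop
    have := (this.tendsto 0).mono_left (nhdsWithin_le_nhds (s := Ioi 0))
    simpa using this
  exact le_of_tendsto_of_tendsto hlim1 hlim2 (eventually_nhdsWithin_of_forall key)

/-- Almost caloric functions with bounded spatial gradient, compactly supported in space. -/
structure IsSol (n : ℕ) (T L R C : ℝ) (ζ : Eu n → ℝ) (v : Eu n → ℝ → ℝ)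
    (v1 v2 : Fin n → Eu n → ℝ → ℝ) (vt : Eu n → ℝ → ℝ) : Prop where
  R0 : 0 ≤ R
  L0 : 0 ≤ L
  bdd : ∀ t ∈ Icc 0 T, ∀ x, |v x t| ≤ 1
  supp : ∀ t ∈ Icc 0 T, ∀ x ∉ closedBall (0 : Eu n) 3, v x t = 0
  lip : ∀ t ∈ Icc 0 T, ∀ x y, |v x t - v y t| ≤ L * ‖x - y‖
  d1 : ∀ t ∈ Icc 0 T, ∀ x i, HasDerivAt (fun r : ℝ => v (x + r • ev i) t) (v1 i x t) 0
  d2 : ∀ t ∈ Icc 0 T, ∀ x i, HasDerivAt (fun r : ℝ => v1 i (x + r • ev i) t) (v2 i x t) 0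
  dt : ∀ t ∈ Icc 0 T, ∀ x, HasDerivWithinAt (v x) (vt x t) (Icc 0 T) t
  eq : ∀ t ∈ Icc 0 T, ∀ x, |∑ i, v2 i x t + vt x t| ≤
    R ^ 2 * |v x t| + R * ‖WithLp.toLp 2 fun i => v1 i x t‖ + R * ζ x
  zcont : Continuous ζ
  zbdd : ∀ x, ζ x ∈ Icc 0 C
  zsupp : ∀ x ∉ closedBall (0 : Eu n) 3, ζ x = 0

theorem norm_ev {n : ℕ} (i : Fin n) : ‖ev i‖ = 1 := by simp

namespace IsSol
variable {n : ℕ} {T L R C : ℝ} {ζ : Eu n → ℝ} {v : Eu n → ℝ → ℝ}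
    {v1 v2 : Fin n → Eu n → ℝ → ℝ} {vt : Eu n → ℝ → ℝ}

theorem deriv_line (hs : IsSol n T L R C ζ v v1 v2 vt) {t : ℝ} (ht : t ∈ Icc 0 T)
    (x : Eu n) (i : Fin n) (r : ℝ) :
    HasDerivAt (fun r : ℝ => v (x + r • ev i) t) (v1 i (x + r • ev i) t) r := by
  have h := hs.d1 t ht (x + r • ev i) i
  have h2 : HasDerivAt (fun r' : ℝ => v (x + r • ev i + (r' - r) • ev i) t)
      (v1 i (x + r • ev i) t) r :=
    HasDerivAt.comp_sub_const (f := fun r' : ℝ => v (x + r • ev i + r' • ev i) t) r r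
      (by simpa using h)
  refine h2.congr_of_eventuallyEq (Filter.Eventually.of_forall fun r' => ?_)
  simp only
  congr 1
  module

theorem abs_v1_le (hs : IsSol n T L R C ζ v v1 v2 vt) {t : ℝ} (ht : t ∈ Icc 0 T)
    (x : Eu n) (i : Fin n) : |v1 i x t| ≤ L := by
  refine (hs.d1 t ht x i).le_of_lip' hs.L0 (Filter.Eventually.of_forall fun r => ?_)
  have := hs.lip t ht (x + r • ev i) (x + (0 : ℝ) • ev i)
  simpa [norm_smul] using this

theorem v1_supp (hs : IsSol n T L R C ζ v v1 v2 vt) {t : ℝ} (ht : t ∈ Icc 0 T)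
    {x : Eu n} (hx : x ∉ closedBall (0 : Eu n) 3) (i : Fin n) : v1 i x t = 0 := by
  have h : (fun r : ℝ => v (x + r • ev i) t) =ᶠ[nhds 0] fun _ => 0 := by
    have h1 : ∀ᶠ y in nhds x, v y t = 0 := by
      filter_upwards [isClosed_closedBall.isOpen_compl.mem_nhds hx] with y hy using hs.supp t ht y hy
    have h2 : Filter.Tendsto (fun r : ℝ => x + r • ev i) (nhds 0) (nhds x) := by
      have : Continuous fun r : ℝ => x + r • ev i := by fun_prop
      simpa using this.tendsto 0
    exact h2.eventually h1
  exact (hs.d1 t ht x i).unique ((hasDerivAt_const _ _).congr_of_eventuallyEq h)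

theorem cont (hs : IsSol n T L R C ζ v v1 v2 vt) :
    ContinuousOn (fun p : Eu n × ℝ => v p.1 p.2) (univ ×ˢ Icc 0 T) := by
  refine continuousOn_prod_of_continuousOn_lipschitzOnWith _ L.toNNReal
    (fun x _ t ht => (hs.dt t ht x).continuousWithinAt) fun t ht => ?_
  refine LipschitzOnWith.of_dist_le_mul fun x _ y _ => ?_
  rw [Real.coe_toNNReal _ hs.L0, dist_eq_norm, dist_eq_norm]
  exact hs.lip t ht x y

theorem psi_le (hs : IsSol n T L R C ζ v v1 v2 vt) {t : ℝ} (ht : t ∈ Icc 0 T) (x : Eu n) :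
    R ^ 2 * |v x t| + R * ‖WithLp.toLp 2 fun i => v1 i x t‖ + R * ζ x ≤
      R ^ 2 + R * √(n * L ^ 2) + R * C := by
  have h1 := hs.bdd t ht x
  have h2 := (hs.zbdd x).2
  have h3 : ‖WithLp.toLp 2 fun i => v1 i x t‖ ≤ √(n * L ^ 2) := by
    rw [EuclideanSpace.norm_eq]
    refine Real.sqrt_le_sqrt ?_
    calc _ ≤ ∑ i : Fin n, L ^ 2 := by
          refine Finset.sum_le_sum fun i _ => ?_
          have := hs.abs_v1_le ht x i
          exact pow_le_pow_left₀ (abs_nonneg _) this 2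
      _ = _ := by simp
  have hR := hs.R0
  gcongr
  nlinarith [sq_nonneg R]

theorem compare (hs : IsSol n T L R C ζ v v1 v2 vt) {t0 t1 A c : ℝ} (h0 : 0 ≤ t0) (h01 : t0 < t1)
    (h1 : t1 ≤ T) (hc : 0 ≤ c) (x0 : Eu n)
    (hP : ∀ t ∈ Ico t0 t1, ∀ x, R ^ 2 * |v x t| + R * ‖WithLp.toLp 2 fun i => v1 i x t‖ + R * ζ x
      ≤ A + c * ‖x - x0‖ ^ 2) :
    |hp n (t1 - t0) (fun y => v y t1) x0 - v x0 t0| ≤ (t1 - t0) * A + c * n * (t1 - t0) ^ 2 := by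
  have hsub : Icc t0 t1 ⊆ Icc 0 T := Icc_subset_Icc h0 h1
  have hsub' : Ico t0 t1 ⊆ Icc 0 T := Ico_subset_Icc_self.trans hsub
  have ht1 : t1 ∈ Icc 0 T := ⟨h0.trans h01.le, h1⟩
  rw [abs_le']
  constructor
  · exact heat_comparison (z := v) (zt := vt) (z2 := v2) (M := 1) (L := L) (r := 3) h01 hc hs.L0
      (hs.cont.mono (prod_mono subset_rfl hsub)) (fun x t ht => hs.bdd t (hsub ht) x)
      (hs.lip t1 ht1) (hs.supp t1 ht1)
      (fun t ht x i => ⟨_, hs.deriv_line (hsub' ht) x i, hs.d2 t (hsub' ht) x i⟩)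
      (fun t ht x => (hs.dt t (hsub' ht) x).mono hsub) x0
      fun t ht x => ((le_abs_self _).trans (hs.eq t (hsub' ht) x)).trans (hP t ht x)
  · have := heat_comparison (z := fun x t => -v x t) (zt := fun x t => -vt x t)
      (z2 := fun i x t => -v2 i x t) (M := 1) (L := L) (r := 3) h01 hc hs.L0
      (hs.cont.mono (prod_mono subset_rfl hsub)).neg
      (fun x t ht => by rw [abs_neg]; exact hs.bdd t (hsub ht) x)
      (fun x y => by rw [← neg_sub', abs_neg]; exact hs.lip t1 ht1 x y)
      (fun x hx => by simp [hs.supp t1 ht1 x hx])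
      (fun t ht x i => ⟨_, fun r => (hs.deriv_line (hsub' ht) x i r).neg, (hs.d2 t (hsub' ht) x i).neg⟩)
      (fun t ht x => ((hs.dt t (hsub' ht) x).mono hsub).neg) x0
      fun t ht x => by
        have := ((neg_abs_le _).trans' (neg_le_neg (hs.eq t (hsub' ht) x)))
        have h2 := hP t ht x
        rw [Finset.sum_neg_distrib]
        linarith
    have h3 : hp n (t1 - t0) (fun y => -v y t1) x0 = - hp n (t1 - t0) (fun y => v y t1) x0 := by
      simp [hp, integral_neg]
    rw [h3] at this
    linarith

end IsSol

theorem hp_second_diff {n : ℕ} {f : Eu n → ℝ} {L h l M : ℝ} (hf : Continuous f) (hM : ∀ x, |f x| ≤ M)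
    (hh : 0 < h) (hl : 0 < l) (hLip : ∀ x y, |f x - f y| ≤ L * ‖x - y‖) (x y : Eu n) :
    |hp n h f (x + y + y) - hp n h f (x + y) - (hp n h f (x + y) - hp n h f x)| ≤
      L * ‖y‖ * (l * ‖y‖ ^ 2 / (16 * h) + 2 / l) := by
  have hc := gc_pos n
  have hfy : Continuous fun z => f (z + y) := by fun_prop
  have hdiff : ∀ x, hp n h f (x + y) - hp n h f x =
      (gc n)⁻¹ * ∫ z, gk n h (x - z) * (f (z + y) - f z) := by
    intro x
    have e1 : ∫ z, gk n h (x + y - z) * f z = ∫ z, gk n h (x - z) * f (z + y) := by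
      rw [← integral_add_right_eq_self (fun z => gk n h (x + y - z) * f z) y]
      simp only [add_sub_add_right_eq_sub]
    simp_rw [mul_sub]
    rw [integral_sub (gk_mul_integrable hh hfy (fun z => hM _) x) (gk_mul_integrable hh hf hM x),
      hp, hp, e1]
    ring
  have hg : ∀ z, |f (z + y) - f z| ≤ L * ‖y‖ := fun z => by simpa using hLip (z + y) z
  have hgc : Continuous fun z => f (z + y) - f z := by fun_prop
  have hi : ∀ x, Integrable fun y => gk n h (x - y) := fun x => (gk_integrable hh).comp_sub_left x
  rw [hdiff, hdiff, ← mul_sub, ← integral_sub (gk_mul_integrable hh hgc hg _)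
    (gk_mul_integrable hh hgc hg _), abs_mul, abs_of_pos (inv_pos.2 hc), inv_mul_le_iff₀ hc]
  calc |∫ z, gk n h (x + y - z) * (f (z + y) - f z) - gk n h (x - z) * (f (z + y) - f z)|
      ≤ ∫ z, |gk n h (x + y - z) - gk n h (x - z)| * (L * ‖y‖) := by
        rw [← Real.norm_eq_abs]
        refine norm_integral_le_of_norm_le (((hi _).sub (hi _)).abs.mul_const _)
          (Filter.Eventually.of_forall fun z => ?_)
        rw [← sub_mul, norm_mul]
        exact mul_le_mul_of_nonneg_left (hg z) (norm_nonneg _)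
    _ = (L * ‖y‖) * ∫ z, |gk n h (z + y) - gk n h z| := by
        rw [integral_mul_const, mul_comm,
          ← integral_sub_left_eq_self (fun z => |gk n h (z + y) - gk n h z|) volume x]
        simp only [add_sub_right_comm]
    _ ≤ (L * ‖y‖) * (gc n * (l * ‖y‖ ^ 2 / (16 * h) + 2 / l)) :=
        mul_le_mul_of_nonneg_left (gk_translate_le hh hl y) ((abs_nonneg _).trans (hg 0))
    _ = _ := by ring

namespace IsSol
variable {n : ℕ} {T L R C : ℝ} {ζ : Eu n → ℝ} {v : Eu n → ℝ → ℝ}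
    {v1 v2 : Fin n → Eu n → ℝ → ℝ} {vt : Eu n → ℝ → ℝ}

theorem cont_x (hs : IsSol n T L R C ζ v v1 v2 vt) {t : ℝ} (ht : t ∈ Icc 0 T) :
    Continuous fun x => v x t :=
  hs.cont.comp_continuous (by fun_prop : Continuous fun y : Eu n => (y, t))
      fun _ => ⟨mem_univ _, ht⟩

theorem second_diff_le (hs : IsSol n T L R C ζ v v1 v2 vt) {T' m t : ℝ}
    (hm : 0 < m) (hm1 : m ≤ 1) (hmT : m ^ 6 ≤ T - T') (ht : t ∈ Icc 0 T') {x y : Eu n}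
    (hy : ‖y‖ = m ^ 4) :
    |v (x + y + y) t - v (x + y) t - (v (x + y) t - v x t)| ≤
      (4 * (R ^ 2 + R * √(n * L ^ 2) + R * C) + 3 * L) * m ^ 5 := by
  set K := R ^ 2 + R * √(n * L ^ 2) + R * C with hK
  have hm6 : 0 < m ^ 6 := by positivity
  have htT : t ∈ Icc 0 T := ⟨ht.1, by linarith [ht.2]⟩
  have htT' : t + m ^ 6 ∈ Icc 0 T := ⟨by linarith [ht.1], by linarith [ht.2]⟩
  have hK0 : 0 ≤ K := by
    have := (hs.zbdd x).1.trans (hs.zbdd x).2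
    have := hs.R0
    positivity
  have hcmp : ∀ z, |hp n (m ^ 6) (fun y => v y (t + m ^ 6)) z - v z t| ≤ m ^ 6 * K := by
    intro z
    have := hs.compare (t0 := t) (t1 := t + m ^ 6) (A := K) (c := 0) ht.1 (by linarith) htT'.2 le_rfl z
      fun s hs' x => by
        have := hs.psi_le (t := s) ⟨ht.1.trans hs'.1, hs'.2.le.trans htT'.2⟩ x
        linarith
    simpa using this
  have h2 := hp_second_diff (hs.cont_x htT') (hs.bdd _ htT') hm6 (inv_pos.2 hm) (hs.lip _ htT') x y
  have h3 : L * ‖y‖ * (m⁻¹ * ‖y‖ ^ 2 / (16 * m ^ 6) + 2 / m⁻¹) ≤ 3 * L * m ^ 5 := by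
    rw [hy]
    have : m⁻¹ * (m ^ 4) ^ 2 / (16 * m ^ 6) + 2 / m⁻¹ = 33 / 16 * m := by field_simp; norm_num
    rw [this]
    have := hs.L0
    have : 0 ≤ L * m ^ 5 := by positivity
    nlinarith
  have a1 := abs_le.1 (hcmp (x + y + y))
  have a2 := abs_le.1 (hcmp (x + y))
  have a3 := abs_le.1 (hcmp x)
  have a4 := abs_le.1 (h2.trans h3)
  have h5 : m ^ 6 * K ≤ m ^ 5 * K := by
    refine mul_le_mul_of_nonneg_right (pow_le_pow_of_le_one hm.le hm1 (by norm_num)) hK0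
  rw [abs_le]
  constructor <;> nlinarith

theorem quot_sub_v1_le (hs : IsSol n T L R C ζ v v1 v2 vt) {T' : ℝ} :
    ∃ K, 0 ≤ K ∧ ∀ m, 0 < m → m ≤ 1 → m ^ 6 ≤ T - T' → ∀ t ∈ Icc 0 T', ∀ x i,
      |(v (x + m ^ 4 • ev i) t - v x t) / m ^ 4 - v1 i x t| ≤ K * m := by
  set K := (4 * (R ^ 2 + R * √(n * L ^ 2) + R * C) + 3 * L) with hK
  have hK0 : 0 ≤ K := by
    have := (hs.zbdd 0).1.trans (hs.zbdd 0).2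
    have := hs.R0
    have := hs.L0
    positivity
  set r : ℝ := √√(1 / 2) with hr
  have hr0 : 0 < r := by positivity
  have hr4 : r ^ 4 = 1 / 2 := by
    rw [show r ^ 4 = (r ^ 2) ^ 2 by ring, hr, Real.sq_sqrt (by positivity),
      Real.sq_sqrt (by positivity)]
  have hr1 : r < 1 := by
    by_contra! h
    have := one_le_pow₀ h (n := 4)
    linarith
  have h1r : 0 < 1 - r := by linarith
  refine ⟨K / (1 - r), by positivity, fun m hm hm1 hmT t ht x i => ?_⟩
  set q : ℕ → ℝ := fun k => (v (x + (m * r ^ k) ^ 4 • ev i) t - v x t) / (m * r ^ k) ^ 4 with hq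
  have hstep : ∀ k, dist (q k) (q (k + 1)) ≤ K * m * r ^ k := by
    intro k
    set a := m * r ^ k with ha
    have ha0 : 0 < a := by positivity
    have ham : a ≤ m := mul_le_of_le_one_right hm.le (pow_le_one₀ hr0.le hr1.le)
    have har : m * r ^ (k + 1) = a * r := by rw [ha]; ring
    have ha1 : a * r ≤ m := (mul_le_of_le_one_right ha0.le hr1.le).trans ham
    have hy : ‖(a * r) ^ 4 • ev i‖ = (a * r) ^ 4 := by
      rw [norm_smul, norm_ev, mul_one, Real.norm_eq_abs, abs_of_pos (by positivity)]
    have h := hs.second_diff_le (T' := T') (m := a * r) (x := x) (by positivity)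
      (ha1.trans hm1) ((pow_le_pow_left₀ (by positivity) ha1 6).trans hmT) ht hy
    have h2 : x + (a * r) ^ 4 • ev i + (a * r) ^ 4 • ev i = x + a ^ 4 • ev i := by
      rw [mul_pow, hr4]; module
    rw [h2] at h
    simp only [hq, har]
    rw [Real.dist_eq, ← ha]
    have h3 : (v (x + a ^ 4 • ev i) t - v x t) / a ^ 4 -
        (v (x + (a * r) ^ 4 • ev i) t - v x t) / (a * r) ^ 4 =
        (v (x + a ^ 4 • ev i) t - v (x + (a * r) ^ 4 • ev i) t
          - (v (x + (a * r) ^ 4 • ev i) t - v x t)) / a ^ 4 := by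
      rw [mul_pow a r 4, hr4]; field_simp; ring
    rw [h3, abs_div, abs_of_pos (by positivity : 0 < a ^ 4), div_le_iff₀ (by positivity)]
    refine h.trans ?_
    rw [mul_pow, ← hK, show K * m * r ^ k * a ^ 4 = K * (a ^ 5 * 1) by rw [ha]; ring]
    gcongr
    exact pow_le_one₀ hr0.le hr1.le
  have hlim : Filter.Tendsto q Filter.atTop (nhds (v1 i x t)) := by
    have hd := hs.d1 t ⟨ht.1, by linarith [ht.2, pow_pos hm 6]⟩ x i
    rw [hasDerivAt_iff_tendsto_slope_zero] at hd
    have hseq : Filter.Tendsto (fun k : ℕ => (m * r ^ k) ^ 4) Filter.atTop (nhdsWithin 0 {0}ᶜ) := by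
      refine tendsto_nhdsWithin_iff.2 ⟨?_, Filter.Eventually.of_forall fun k => ?_⟩
      · have := ((tendsto_pow_atTop_nhds_zero_of_lt_one hr0.le hr1).const_mul m).pow 4
        simpa using this
      · have : 0 < (m * r ^ k) ^ 4 := by positivity
        exact this.ne'
    have := hd.comp hseq
    refine this.congr fun k => ?_
    simp [hq, div_eq_inv_mul]
  have := dist_le_of_le_geometric_of_tendsto₀ r (K * m) hr1 hstep hlim
  rw [Real.dist_eq] at this
  simp only [hq, pow_zero, mul_one] at this
  refine this.trans (le_of_eq ?_)
  ring

theorem v1_cont (hs : IsSol n T L R C ζ v v1 v2 vt) {T' : ℝ} (hT : T' < T) (i : Fin n) :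
    ContinuousOn (fun p : Eu n × ℝ => v1 i p.1 p.2) (univ ×ˢ Icc 0 T') := by
  obtain ⟨K, hK, h⟩ := hs.quot_sub_v1_le (T' := T')
  refine continuousOn_of_uniform_approx_of_continuousOn fun U hU => ?_
  obtain ⟨e, he, heU⟩ := Metric.mem_uniformity_dist.1 hU
  set m := min 1 (min (T - T') (e / (K + 1))) with hm
  have hT0 : 0 < T - T' := by linarith
  have hm0 : 0 < m := by positivity
  have hm1 : m ≤ 1 := min_le_left _ _
  have hmT : m ^ 6 ≤ T - T' := (pow_le_of_le_one hm0.le hm1 (by norm_num)).trans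
    ((min_le_right _ _).trans (min_le_left _ _))
  have hme : K * m < e := by
    have : m ≤ e / (K + 1) := (min_le_right _ _).trans (min_le_right _ _)
    rw [le_div_iff₀ (by positivity)] at this
    linarith
  refine ⟨fun p => (v (p.1 + m ^ 4 • ev i) p.2 - v p.1 p.2) / m ^ 4, ?_, fun p hp => heU ?_⟩
  · have h1 : ContinuousOn (fun p : Eu n × ℝ => v p.1 p.2) (univ ×ˢ Icc 0 T') :=
      hs.cont.mono (prod_mono subset_rfl (Icc_subset_Icc_right hT.le))
    exact ((h1.comp (f := fun p : Eu n × ℝ => (p.1 + m ^ 4 • ev i, p.2)) (by fun_prop)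
      fun p hp => ⟨mem_univ _, hp.2⟩).sub h1).div_const _
  · rw [dist_comm, Real.dist_eq]
    exact (h m hm0 hm1 hmT p.2 hp.2 p.1 i).trans_lt hme

end IsSol

/-- Spatial partial derivative of a function on space-time. -/
noncomputable def Dx {n : ℕ} (i : Fin n) (w : Eu n × ℝ → ℝ) (p : Eu n × ℝ) : ℝ :=
  fderiv ℝ w p (ev i, 0)

/-- Time derivative of a function on space-time. -/
noncomputable def Dt {n : ℕ} (w : Eu n × ℝ → ℝ) (p : Eu n × ℝ) : ℝ :=
  fderiv ℝ w p (0, 1)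

/-- The backward heat operator. -/
noncomputable def Lh {n : ℕ} (w : Eu n × ℝ → ℝ) (p : Eu n × ℝ) : ℝ :=
  ∑ i, Dx i (Dx i w) p + Dt w p

section smooth
variable {n : ℕ} {w : Eu n × ℝ → ℝ}

theorem Dx_contDiff (hw : ContDiff ℝ (⊤ : ℕ∞) w) (i : Fin n) : ContDiff ℝ (⊤ : ℕ∞) (Dx i w) :=
  (hw.fderiv_right (m := (⊤ : ℕ∞)) (by simp)).clm_apply contDiff_const

theorem Dt_contDiff (hw : ContDiff ℝ (⊤ : ℕ∞) w) : ContDiff ℝ (⊤ : ℕ∞) (Dt w) :=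
  (hw.fderiv_right (m := (⊤ : ℕ∞)) (by simp)).clm_apply contDiff_const

theorem Lh_continuous (hw : ContDiff ℝ (⊤ : ℕ∞) w) : Continuous (Lh w) := by
  unfold Lh
  exact (continuous_finsetSum _ fun i _ => (Dx_contDiff (Dx_contDiff hw i) i).continuous).add
    (Dt_contDiff hw).continuous

theorem Dx_line (hw : ContDiff ℝ (⊤ : ℕ∞) w) (x : Eu n) (t : ℝ) (i : Fin n) (r : ℝ) :
    HasDerivAt (fun r : ℝ => w (x + r • ev i, t)) (Dx i w (x + r • ev i, t)) r := by
  have h1 : HasFDerivAt w (fderiv ℝ w (x + r • ev i, t)) (x + r • ev i, t) :=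
    (hw.differentiable (by simp) _).hasFDerivAt
  have h2 : HasDerivAt (fun r : ℝ => (x + r • ev i, t)) (ev i, (0 : ℝ)) r := by
    refine HasDerivAt.prodMk ?_ (hasDerivAt_const _ _)
    simpa using ((hasDerivAt_id r).smul_const (ev i)).const_add x
  exact h1.comp_hasDerivAt r h2

theorem Dt_line (hw : ContDiff ℝ (⊤ : ℕ∞) w) (x : Eu n) (t : ℝ) :
    HasDerivAt (fun t : ℝ => w (x, t)) (Dt w (x, t)) t := by
  have h1 : HasFDerivAt w (fderiv ℝ w (x, t)) (x, t) :=
    (hw.differentiable (by simp) _).hasFDerivAt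
  have h2 : HasDerivAt (fun t : ℝ => (x, t)) ((0 : Eu n), (1 : ℝ)) t :=
    HasDerivAt.prodMk (hasDerivAt_const _ _) (hasDerivAt_id t)
  exact h1.comp_hasDerivAt t h2

/-- Vanishing outside a ball, uniformly in time. -/
def Van (r : ℝ) (w : Eu n × ℝ → ℝ) : Prop := ∀ p : Eu n × ℝ, p.1 ∉ closedBall (0 : Eu n) r → w p = 0

theorem Van.fderiv {r : ℝ} (hw : Van r w) {p : Eu n × ℝ} (hp : p.1 ∉ closedBall (0 : Eu n) r) :
    fderiv ℝ w p = 0 := by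
  have h : w =ᶠ[nhds p] fun _ => 0 := by
    filter_upwards [(isClosed_closedBall.isOpen_compl.preimage continuous_fst).mem_nhds hp] with q hq
      using hw q hq
  rw [h.fderiv_eq]; simp

theorem Van.Dx {r : ℝ} (hw : Van r w) (i : Fin n) : Van r (Dx i w) := fun p hp => by
  simp [_root_.Dx, hw.fderiv hp]

theorem Van.Dt {r : ℝ} (hw : Van r w) : Van r (Dt w) := fun p hp => by
  simp [_root_.Dt, hw.fderiv hp]

theorem Van.Lh {r : ℝ} (hw : Van r w) : Van r (Lh w) := fun p hp => by
  simp [_root_.Lh, (hw.Dx _).Dx _ p hp, hw.Dt p hp]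

theorem Van.neg {r : ℝ} (hw : Van r w) : Van r (fun p => -w p) := fun p hp => by
  simp [hw p hp]

theorem Lh_neg (p : Eu n × ℝ) : Lh (fun p => -w p) p = -Lh w p := by
  have h1 : ∀ (f : Eu n × ℝ → ℝ) i, Dx i (fun p => -f p) = fun p => -Dx i f p := by
    intro f i; ext p; simp [Dx, fderiv_fun_neg]
  simp only [Lh, h1, Dt, fderiv_fun_neg, Finset.sum_neg_distrib]
  simp
  ring

end smooth

theorem exists_uniform {n : ℕ} {g : Eu n × ℝ → ℝ} {a b r : ℝ}
    (hg : ContinuousOn g (univ ×ˢ Icc a b))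
    (h0 : ∀ x ∉ closedBall (0 : Eu n) r, ∀ t ∈ Icc a b, g (x, t) = 0) {η : ℝ} (hη : 0 < η) :
    ∃ d > 0, ∀ x y, ∀ s ∈ Icc a b, ∀ t ∈ Icc a b, ‖x - y‖ ≤ d → |s - t| ≤ d →
      |g (x, s) - g (y, t)| ≤ η := by
  have hK : IsCompact (closedBall (0 : Eu n) (r + 1) ×ˢ Icc a b) :=
    (isCompact_closedBall _ _).prod isCompact_Icc
  have hu := hK.uniformContinuousOn_of_continuous (hg.mono (prod_mono (subset_univ _) subset_rfl))
  obtain ⟨d, hd, h⟩ := Metric.uniformContinuousOn_iff_le.1 hu η hη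
  refine ⟨min d 1, by positivity, fun x y s hs t ht hxy hst => ?_⟩
  have hxy1 := hxy.trans (min_le_right _ _)
  by_cases hx : x ∈ closedBall (0 : Eu n) (r + 1) ∧ y ∈ closedBall (0 : Eu n) (r + 1)
  · refine h (x, s) ⟨hx.1, hs⟩ (y, t) ⟨hx.2, ht⟩ ?_
    rw [Prod.dist_eq, dist_eq_norm, Real.dist_eq]
    exact max_le (hxy.trans (min_le_left _ _)) (hst.trans (min_le_left _ _))
  · have h1 : x ∉ closedBall (0 : Eu n) r ∧ y ∉ closedBall (0 : Eu n) r := by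
      simp only [mem_closedBall_zero_iff, not_and_or, not_le] at hx ⊢
      have e1 := norm_sub_norm_le x y
      have e2 := norm_sub_norm_le y x
      rw [norm_sub_rev] at e2
      rcases hx with hx | hx <;> constructor <;> linarith
    rw [h0 x h1.1 s hs, h0 y h1.2 t ht]
    simpa using hη.le

theorem exists_abs_le {n : ℕ} {g : Eu n × ℝ → ℝ} {a b r : ℝ}
    (hg : ContinuousOn g (univ ×ˢ Icc a b))
    (h0 : ∀ x ∉ closedBall (0 : Eu n) r, ∀ t ∈ Icc a b, g (x, t) = 0) :
    ∃ M, 0 ≤ M ∧ ∀ x, ∀ t ∈ Icc a b, |g (x, t)| ≤ M := by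
  have hK : IsCompact (closedBall (0 : Eu n) r ×ˢ Icc a b) :=
    (isCompact_closedBall _ _).prod isCompact_Icc
  obtain ⟨M, hM⟩ := hK.exists_bound_of_continuousOn (hg.mono (prod_mono (subset_univ _) subset_rfl))
  refine ⟨max M 0, le_max_right _ _, fun x t ht => ?_⟩
  by_cases hx : x ∈ closedBall (0 : Eu n) r
  · exact (hM (x, t) ⟨hx, ht⟩).trans (le_max_left _ _)
  · rw [h0 x hx t ht]; simp

theorem exists_barrier {n : ℕ} {g : Eu n × ℝ → ℝ} {a b r : ℝ}
    (hg : ContinuousOn g (univ ×ˢ Icc a b))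
    (h0 : ∀ x ∉ closedBall (0 : Eu n) r, ∀ t ∈ Icc a b, g (x, t) = 0) {η : ℝ} (hη : 0 < η) :
    ∃ c, 0 ≤ c ∧ ∃ d > 0, ∀ x y, ∀ s ∈ Icc a b, ∀ t ∈ Icc a b, |s - t| ≤ d →
      |g (x, s) - g (y, t)| ≤ η + c * ‖x - y‖ ^ 2 := by
  obtain ⟨d, hd, h⟩ := exists_uniform hg h0 hη
  obtain ⟨M, hM0, hM⟩ := exists_abs_le hg h0
  refine ⟨2 * M / d ^ 2, by positivity, d, hd, fun x y s hs t ht hst => ?_⟩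
  by_cases hxy : ‖x - y‖ ≤ d
  · have := h x y s hs t ht hxy hst
    have : 0 ≤ 2 * M / d ^ 2 * ‖x - y‖ ^ 2 := by positivity
    linarith
  · push Not at hxy
    have h1 : 2 * M ≤ 2 * M / d ^ 2 * ‖x - y‖ ^ 2 := by
      rw [div_mul_eq_mul_div, le_div_iff₀ (by positivity)]
      gcongr
    have h2 := abs_sub (g (x, s)) (g (y, t))
    linarith [hM x s hs, hM y t ht]

theorem hp_neg {n : ℕ} {s : ℝ} {f : Eu n → ℝ} {x : Eu n} :
    hp n s (fun y => -f y) x = -hp n s f x := by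
  simp [hp, integral_neg]

theorem Lh_ge_of_hp {n : ℕ} {w : Eu n × ℝ → ℝ} (hw : ContDiff ℝ (⊤ : ℕ∞) w) {r : ℝ} (h0 : Van r w)
    {x0 : Eu n} {t0 B c d : ℝ} (hd : 0 < d)
    (h : ∀ s, 0 < s → s ≤ d → |hp n s (fun y => w (y, t0 + s)) x0 - w (x0, t0)| ≤ s * B + c * s ^ 2) :
    - B ≤ Lh w (x0, t0) := by
  by_contra! hlt
  set η := (-B - Lh w (x0, t0)) / 2 with hη
  have hη0 : 0 < η := by rw [hη]; linarith
  obtain ⟨c', hc', d', hd', hbar⟩ := exists_barrier (a := t0) (b := t0 + 1) (r := r)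
    (Lh_continuous hw).continuousOn (fun x hx t _ => h0.Lh (x, t) hx) hη0
  obtain ⟨M, hM0, hM⟩ := exists_abs_le (a := t0) (b := t0 + 1) (r := r)
    hw.continuous.continuousOn (fun x hx t _ => h0 (x, t) hx)
  have key : ∀ s, 0 < s → s ≤ min d (min d' 1) → η ≤ (c + c' * n) * s := by
    intro s hs hsd
    have hs1 : s ≤ d := hsd.trans (min_le_left _ _)
    have hs2 : s ≤ d' := hsd.trans ((min_le_right _ _).trans (min_le_left _ _))
    have hs3 : s ≤ 1 := hsd.trans ((min_le_right _ _).trans (min_le_right _ _))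
    have hsub : Icc t0 (t0 + s) ⊆ Icc t0 (t0 + 1) := Icc_subset_Icc_right (by linarith)
    obtain ⟨K, hK⟩ : ∃ K, LipschitzWith K fun y => w (y, t0 + s) := by
      refine ContDiff.lipschitzWith_of_hasCompactSupport (𝕂 := ℝ) (n := 1)
        (HasCompactSupport.intro (isCompact_closedBall (0 : Eu n) r) fun y hy => h0 _ hy)
        (ContDiff.comp (g := w) (hw.of_le (by simp)) (by fun_prop)) one_ne_zero
    have h1 := heat_comparison (z := fun x t => w (x, t)) (zt := fun x t => Dt w (x, t))
      (z2 := fun i x t => Dx i (Dx i w) (x, t)) (t0 := t0) (t1 := t0 + s) (M := M) (L := K) (r := r)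
      (A := Lh w (x0, t0) + η) (c := c') (by linarith) hc' K.2
      hw.continuous.continuousOn (fun x t ht => hM x t (hsub ht))
      (fun x y => by simpa [dist_eq_norm] using hK.dist_le_mul x y) (fun x hx => h0 _ hx)
      (fun t ht x i => ⟨_, Dx_line hw x t i, by simpa using Dx_line (Dx_contDiff hw i) x t i 0⟩)
      (fun t ht x => (Dt_line hw x t).hasDerivWithinAt) x0
      fun t ht x => by
        have := (abs_le.1 (hbar x x0 t (hsub (Ico_subset_Icc_self ht)) t0
          (left_mem_Icc.2 (by linarith)) (by
            rw [abs_of_nonneg] <;> linarith [ht.1, ht.2]))).2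
        simp only [Lh] at this ⊢
        linarith
    have h2 := (abs_le.1 (h s hs hs1)).1
    simp only [add_sub_cancel_left] at h1
    have h3 : s * η ≤ s * ((c + c' * n) * s) := by
      have : Lh w (x0, t0) = -B - 2 * η := by rw [hη]; ring
      rw [this] at h1
      nlinarith
    exact le_of_mul_le_mul_left h3 hs
  have hlim : Filter.Tendsto (fun s => (c + c' * n) * s) (nhdsWithin 0 (Ioi 0)) (nhds 0) := by
    have : Continuous fun s : ℝ => (c + c' * n) * s := by fun_prop
    simpa using (this.tendsto 0).mono_left (nhdsWithin_le_nhds (s := Ioi 0))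
  have : η ≤ 0 := by
    refine ge_of_tendsto hlim ?_
    filter_upwards [Ioc_mem_nhdsGT (show (0 : ℝ) < min d (min d' 1) by positivity)] with s hs
      using key s hs.1 hs.2
  linarith

theorem abs_Lh_le_of_hp {n : ℕ} {w : Eu n × ℝ → ℝ} (hw : ContDiff ℝ (⊤ : ℕ∞) w) {r : ℝ} (h0 : Van r w)
    {x0 : Eu n} {t0 B c d : ℝ} (hd : 0 < d)
    (h : ∀ s, 0 < s → s ≤ d → |hp n s (fun y => w (y, t0 + s)) x0 - w (x0, t0)| ≤ s * B + c * s ^ 2) :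
    |Lh w (x0, t0)| ≤ B := by
  refine abs_le.2 ⟨Lh_ge_of_hp hw h0 hd h, ?_⟩
  have := Lh_ge_of_hp (w := fun p => -w p) hw.neg h0.neg (x0 := x0) (t0 := t0) (B := B) hd
    fun s hs hsd => by
      rw [hp_neg, ← neg_sub', abs_neg]; exact h s hs hsd
  rw [Lh_neg] at this
  linarith

/-- A smooth averaging kernel on space-time concentrated on the ball of radius `δ`. -/
structure IsKer (n : ℕ) (δ : ℝ) (k : Eu n × ℝ → ℝ) : Prop where
  smooth : ContDiff ℝ (⊤ : ℕ∞) k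
  nonneg : ∀ p, 0 ≤ k p
  int : ∫ p, k p = 1
  supp : ∀ p ∉ closedBall (0 : Eu n × ℝ) δ, k p = 0

theorem exists_isKer (n : ℕ) {δ : ℝ} (hδ : 0 < δ) : ∃ k, IsKer n δ k := by
  let φ : ContDiffBump (0 : Eu n × ℝ) := ⟨δ / 2, δ, by positivity, by linarith⟩
  refine ⟨φ.normed volume, φ.contDiff_normed, fun p => φ.nonneg_normed _, φ.integral_normed, ?_⟩
  intro p hp
  have : p ∉ Function.support (φ.normed volume) := by
    rw [φ.support_normed_eq]
    exact fun h => hp (ball_subset_closedBall h)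
  simpa using this

/-- Mollification. -/
noncomputable def moll {n : ℕ} (k V : Eu n × ℝ → ℝ) (p : Eu n × ℝ) : ℝ := ∫ q, k q * V (p - q)

namespace IsKer
variable {n : ℕ} {δ : ℝ} {k : Eu n × ℝ → ℝ}

theorem cpt (hk : IsKer n δ k) : HasCompactSupport k :=
  HasCompactSupport.intro (isCompact_closedBall _ _) hk.supp

theorem integrable (hk : IsKer n δ k) : Integrable k :=
  hk.smooth.continuous.integrable_of_hasCompactSupport hk.cpt

theorem integrable_mul (hk : IsKer n δ k) {V : Eu n × ℝ → ℝ} (hV : Continuous V) :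
    Integrable fun q => k q * V q :=
  (hk.smooth.continuous.mul hV).integrable_of_hasCompactSupport hk.cpt.mul_right

theorem abs_integral_le (hk : IsKer n δ k) {F : Eu n × ℝ → ℝ} {e : ℝ}
    (hF : ∀ q ∈ closedBall (0 : Eu n × ℝ) δ, |F q| ≤ e) : |∫ q, k q * F q| ≤ e := by
  rw [← Real.norm_eq_abs]
  refine (norm_integral_le_of_norm_le (g := fun q => k q * e) (hk.integrable.mul_const e)
    (Filter.Eventually.of_forall fun q => ?_)).trans_eq (by rw [integral_mul_const, hk.int, one_mul])
  rw [norm_mul, Real.norm_eq_abs, abs_of_nonneg (hk.nonneg q)]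
  by_cases hq : q ∈ closedBall (0 : Eu n × ℝ) δ
  · exact mul_le_mul_of_nonneg_left (hF q hq) (hk.nonneg q)
  · simp [hk.supp q hq]

theorem abs_moll_sub_le (hk : IsKer n δ k) {V : Eu n × ℝ → ℝ} (hV : Continuous V) {e a : ℝ}
    {p : Eu n × ℝ} (hF : ∀ q ∈ closedBall (0 : Eu n × ℝ) δ, |V (p - q) - a| ≤ e) :
    |moll k V p - a| ≤ e := by
  have : moll k V p - a = ∫ q, k q * (V (p - q) - a) := by
    simp_rw [mul_sub]
    rw [integral_sub (hk.integrable_mul (by fun_prop)) (hk.integrable.mul_const a),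
      integral_mul_const, hk.int, one_mul, moll]
  rw [this]
  exact hk.abs_integral_le hF

theorem moll_contDiff (hk : IsKer n δ k) {V : Eu n × ℝ → ℝ} (hV : Continuous V) :
    ContDiff ℝ (⊤ : ℕ∞) (moll k V) := by
  have : (volume : Measure (Eu n × ℝ)).IsAddHaarMeasure := by
    rw [Measure.volume_eq_prod]; infer_instance
  have := hk.cpt.contDiff_convolution_left (ContinuousLinearMap.mul ℝ ℝ) (μ := volume) hk.smooth
    hV.locallyIntegrable
  exact this

theorem moll_line (hk : IsKer n δ k) {V V1 : Eu n × ℝ → ℝ} (hV : Continuous V)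
    (hV1 : Continuous V1) (i : Fin n) (hd : ∀ x t r, HasDerivAt (fun r : ℝ => V (x + r • ev i, t))
      (V1 (x + r • ev i, t)) r) (p : Eu n × ℝ) : Dx i (moll k V) p = moll k V1 p := by
  have h1 := Dx_line (hk.moll_contDiff hV) p.1 p.2 i 0
  have h2 : HasDerivAt (fun r : ℝ => moll k V (p.1 + r • ev i, p.2))
      (∫ q, k q * V1 ((p.1 + (0 : ℝ) • ev i, p.2) - q)) 0 := by
    refine hasDerivAt_integral_of_compact (U := univ) (isCompact_closedBall (0 : Eu n × ℝ) δ)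
      (k := fun r q => k q * V ((p.1 + r • ev i, p.2) - q))
      (k' := fun r q => k q * V1 ((p.1 + r • ev i, p.2) - q))
      isOpen_univ (mem_univ _) (fun r _ => hk.smooth.continuous.mul (by fun_prop))
      (fun r _ q => ?_) ?_ (fun r _ q hq => by simp [hk.supp q hq])
    · refine HasDerivAt.const_mul _ ?_
      have := hd (p.1 - q.1) (p.2 - q.2) r
      simp only [sub_add_eq_add_sub] at this
      exact this
    · refine Continuous.continuousOn (Continuous.mul ?_ (by fun_prop))
      exact hk.smooth.continuous.comp continuous_snd
  have := h1.unique h2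
  simpa [moll] using this

theorem hp_moll (hk : IsKer n δ k) {V : Eu n × ℝ → ℝ} (hV : Continuous V) {M : ℝ}
    (hM : ∀ p, |V p| ≤ M) {s : ℝ} (hs : 0 < s) (x : Eu n) (t : ℝ) :
    (Integrable fun q => k q * hp n s (fun y => V (y, t - q.2)) (x - q.1)) ∧
    hp n s (fun y => moll k V (y, t)) x =
      ∫ q, k q * hp n s (fun y => V (y, t - q.2)) (x - q.1) := by
  have hi : Integrable fun y => gk n s (x - y) := (gk_integrable hs).comp_sub_left x
  have hintg : Integrable (fun z : (Eu n × ℝ) × Eu n =>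
      (k z.1 * gk n s (x - z.2)) * V ((z.2, t) - z.1)) (volume.prod volume) := by
    refine (hk.integrable.mul_prod hi).mul_bdd (c := M) ?_ (Filter.Eventually.of_forall fun z => hM _)
    exact Continuous.aestronglyMeasurable (by fun_prop)
  have hinner : ∀ q : Eu n × ℝ, ∫ y, (k q * gk n s (x - y)) * V ((y, t) - q) =
      gc n * (k q * hp n s (fun y => V (y, t - q.2)) (x - q.1)) := by
    intro q
    rw [hp, ← integral_sub_right_eq_self (fun y => gk n s (x - q.1 - y) * V (y, t - q.2)) q.1]
    simp_rw [mul_assoc]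
    rw [integral_const_mul]
    have := (gc_pos n).ne'
    simp only [sub_sub_sub_cancel_right]
    field_simp
    rfl
  have h1 := hintg.integral_prod_left
  simp only [hinner] at h1
  refine ⟨(h1.const_mul (gc n)⁻¹).congr (Filter.Eventually.of_forall fun q => ?_), ?_⟩
  · simp only
    rw [inv_mul_cancel_left₀ (gc_pos n).ne']
  · have h2 := integral_integral_swap (f := fun (q : Eu n × ℝ) (y : Eu n) =>
      (k q * gk n s (x - y)) * V ((y, t) - q)) hintg
    simp only [hinner] at h2
    rw [integral_const_mul] at h2
    rw [hp, ← mul_right_inj' (gc_pos n).ne', mul_inv_cancel_left₀ (gc_pos n).ne', h2]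
    congr 1; ext y
    rw [moll, ← integral_const_mul]
    congr 1; ext q
    ring

end IsKer

theorem eventually_uniform {n : ℕ} {g : Eu n × ℝ → ℝ} {a b r : ℝ}
    (hg : ContinuousOn g (univ ×ˢ Icc a b))
    (h0 : ∀ x ∉ closedBall (0 : Eu n) r, ∀ t ∈ Icc a b, g (x, t) = 0) {η : ℝ} (hη : 0 < η) :
    ∀ᶠ δ in nhdsWithin (0 : ℝ) (Ioi 0), ∀ x y, ∀ s ∈ Icc a b, ∀ t ∈ Icc a b,
      ‖x - y‖ ≤ 2 * δ → |s - t| ≤ 2 * δ → |g (x, s) - g (y, t)| ≤ η := by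
  obtain ⟨d, hd, h⟩ := exists_uniform hg h0 hη
  filter_upwards [Ioc_mem_nhdsGT (show (0 : ℝ) < d / 2 by positivity)] with δ hδ x y s hs t ht h1 h2
  exact h x y s hs t ht (by linarith [hδ.2]) (by linarith [hδ.2])

/-- Almost caloric functions can be approximated by smooth almost caloric functions. -/
theorem IsSol.approx {n : ℕ} {T L R C : ℝ} {ζ : Eu n → ℝ} {v : Eu n → ℝ → ℝ}
    {v1 v2 : Fin n → Eu n → ℝ → ℝ} {vt : Eu n → ℝ → ℝ} (hs : IsSol n T L R C ζ v v1 v2 vt)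
    {T'' : ℝ} (hT0 : 0 ≤ T'') (hT : T'' < T) {e : ℝ} (he : 0 < e) :
    ∃ w : Eu n × ℝ → ℝ, ContDiff ℝ (⊤ : ℕ∞) w ∧ Van 4 w ∧ ∀ t ∈ Icc 0 T'', ∀ x,
      |w (x, t)| ≤ 1 ∧ |w (x, t) - v x t| ≤ e ∧ |Lh w (x, t)| ≤
        R ^ 2 * |w (x, t)| + R * ‖WithLp.toLp 2 fun i => Dx i w (x, t)‖ + R * ζ x + e := by
  have hR := hs.R0
  set T' := (T'' + T) / 2 with hT'
  have h1 : T'' < T' := by linarith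
  have h2 : T' < T := by linarith
  have hT'0 : 0 ≤ T' := by linarith
  have hsub : Icc 0 T' ⊆ Icc 0 T := Icc_subset_Icc_right h2.le
  set Ψ : Eu n × ℝ → ℝ := fun p => R ^ 2 * |v p.1 p.2| +
    R * ‖WithLp.toLp 2 fun i => v1 i p.1 p.2‖ + R * ζ p.1 with hΨ
  have hvc : ContinuousOn (fun p : Eu n × ℝ => v p.1 p.2) (univ ×ˢ Icc 0 T') :=
    hs.cont.mono (prod_mono subset_rfl hsub)
  have hv1c := hs.v1_cont h2
  have hΨc : ContinuousOn Ψ (univ ×ˢ Icc 0 T') := by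
    have e1 : ContinuousOn (fun p : Eu n × ℝ => WithLp.toLp 2 fun i => v1 i p.1 p.2)
        (univ ×ˢ Icc 0 T') :=
      (PiLp.continuous_toLp 2 _).comp_continuousOn (continuousOn_pi.2 hv1c)
    have e2 := hs.zcont
    exact (((hvc.abs).const_mul _).add (e1.norm.const_mul _)).add (by fun_prop)
  have hΨ0 : ∀ x ∉ closedBall (0 : Eu n) 3, ∀ t ∈ Icc 0 T', Ψ (x, t) = 0 := by
    intro x hx t ht
    simp only [hΨ, hs.supp t (hsub ht) x hx, hs.zsupp x hx, hs.v1_supp (hsub ht) hx]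
    have : (WithLp.toLp 2 fun _ : Fin n => (0 : ℝ)) = 0 := rfl
    simp [this]
  set η := e / (R ^ 2 + R * √n + 3) with hη
  have hη0 : 0 < η := by positivity
  have hηe : (R ^ 2 + R * √n + 3) * η = e := by rw [hη]; field_simp
  have hηle : η ≤ e := by
    rw [← hηe]
    have : 0 ≤ (R ^ 2 + R * √n) * η := by positivity
    linarith
  obtain ⟨c, hc, d0, hd0, hbar⟩ := exists_barrier hΨc hΨ0 hη0
  have hev1 := eventually_uniform hΨc hΨ0 hη0
  have hev2 := eventually_uniform hvc (fun x hx t ht => hs.supp t (hsub ht) x hx) hη0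
  have hev3 := Filter.eventually_all.2 fun i =>
    eventually_uniform (hv1c i) (fun x hx t ht => hs.v1_supp (hsub ht) hx i) hη0
  have hmem := Ioc_mem_nhdsGT (show (0 : ℝ) < min 1 ((T' - T'') / 4) by
    have : 0 < T' - T'' := by linarith
    positivity)
  obtain ⟨δ, hδ1, hδ2, hδ3, hδ0, hδ⟩ := (hev1.and (hev2.and (hev3.and hmem))).exists
  have hδone : δ ≤ 1 := hδ.trans (min_le_left _ _)
  have hδT : δ ≤ (T' - T'') / 4 := hδ.trans (min_le_right _ _)
  obtain ⟨k, hk⟩ := exists_isKer n hδ0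
  set τ : ℝ → ℝ := fun t => (projIcc 0 T' hT'0 (t + δ) : ℝ) with hτ
  have hτc : Continuous τ := continuous_subtype_val.comp (continuous_projIcc.comp (by fun_prop))
  have hτm : ∀ t, τ t ∈ Icc 0 T' := fun t => (projIcc 0 T' hT'0 (t + δ)).2
  have hτe : ∀ t, t + δ ∈ Icc 0 T' → τ t = t + δ := fun t ht => by
    simp only [hτ, projIcc_of_mem hT'0 ht]
  set V : Eu n × ℝ → ℝ := fun p => v p.1 (τ p.2) with hV
  set V1 : Fin n → Eu n × ℝ → ℝ := fun i p => v1 i p.1 (τ p.2) with hV1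
  have hVc : Continuous V := hvc.comp_continuous (f := fun p : Eu n × ℝ => (p.1, τ p.2))
    (by fun_prop) fun p => ⟨mem_univ _, hτm _⟩
  have hV1c : ∀ i, Continuous (V1 i) := fun i => (hv1c i).comp_continuous
    (f := fun p : Eu n × ℝ => (p.1, τ p.2)) (by fun_prop) fun p => ⟨mem_univ _, hτm _⟩
  have hVM : ∀ p, |V p| ≤ 1 := fun p => hs.bdd _ (hsub (hτm _)) _
  have hw := hk.moll_contDiff hVc
  have hw1 : ∀ i p, Dx i (moll k V) p = moll k (V1 i) p := fun i p =>
    hk.moll_line hVc (hV1c i) i (fun x t r => hs.deriv_line (hsub (hτm t)) x i r) p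
  have hq : ∀ q ∈ closedBall (0 : Eu n × ℝ) δ, ‖q.1‖ ≤ δ ∧ |q.2| ≤ δ := fun q hq => by
    rw [mem_closedBall_zero_iff] at hq
    exact ⟨(norm_fst_le q).trans hq, (norm_snd_le q).trans hq⟩
  have hq2 : ∀ q ∈ closedBall (0 : Eu n × ℝ) δ, ∀ t ∈ Icc 0 T'', t - q.2 + δ ∈ Icc 0 T' ∧
      τ (t - q.2) = t - q.2 + δ ∧ |t - q.2 + δ - t| ≤ 2 * δ ∧ t ∈ Icc 0 T' ∧ t - q.2 + δ ≤
        T' - (T' - T'') / 2 := by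
    intro q hqm t ht
    have h := abs_le.1 (hq q hqm).2
    have h3 : t - q.2 + δ ∈ Icc 0 T' := ⟨by linarith [ht.1], by linarith [ht.2]⟩
    refine ⟨h3, hτe _ h3, abs_le.2 ⟨by linarith, by linarith⟩, ⟨ht.1, by linarith [ht.2]⟩, ?_⟩
    linarith [ht.2]
  have hvan : Van 4 (moll k V) := by
    intro p hp
    have := hk.abs_moll_sub_le hVc (e := 0) (a := 0) (p := p) fun q hqm => by
      rw [sub_zero]
      refine le_of_eq (abs_eq_zero.2 (hs.supp _ (hsub (hτm _)) _ fun hmem => hp ?_))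
      rw [mem_closedBall_zero_iff] at hmem ⊢
      have e1 := norm_sub_norm_le p.1 q.1
      have e2 := (hq q hqm).1
      have e3 : ‖p.1 - q.1‖ ≤ 3 := hmem
      linarith
    simpa using this
  refine ⟨moll k V, hw, hvan, fun t ht x => ?_⟩
  have hwv : |moll k V (x, t) - v x t| ≤ η := hk.abs_moll_sub_le hVc fun q hqm => by
    obtain ⟨a1, a2, a3, a4, -⟩ := hq2 q hqm t ht
    have a5 : V ((x, t) - q) = v (x - q.1) (t - q.2 + δ) := by
      simp only [hV, Prod.fst_sub, Prod.snd_sub, a2]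
    rw [a5]
    refine hδ2 (x - q.1) x _ a1 t a4 ?_ a3
    have := (hq q hqm).1
    rw [sub_sub_cancel_left, norm_neg]
    linarith
  have hwv1 : ∀ i, |Dx i (moll k V) (x, t) - v1 i x t| ≤ η := fun i => by
    rw [hw1]
    refine hk.abs_moll_sub_le (hV1c i) fun q hqm => ?_
    obtain ⟨a1, a2, a3, a4, -⟩ := hq2 q hqm t ht
    have a5 : V1 i ((x, t) - q) = v1 i (x - q.1) (t - q.2 + δ) := by
      simp only [hV1, Prod.fst_sub, Prod.snd_sub, a2]
    rw [a5]
    refine hδ3 i (x - q.1) x _ a1 t a4 ?_ a3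
    have := (hq q hqm).1
    rw [sub_sub_cancel_left, norm_neg]
    linarith
  refine ⟨?_, hwv.trans hηle, ?_⟩
  · simpa using hk.abs_moll_sub_le hVc (e := 1) (a := 0) (p := (x, t)) fun q _ => by
      simpa using hVM _
  have hB : |Lh (moll k V) (x, t)| ≤ Ψ (x, t) + 2 * η := by
    refine abs_Lh_le_of_hp (c := c * n) hw hvan (d := min d0 ((T' - T'') / 2)) (lt_min hd0 (by linarith))
      fun s hs0 hsd => ?_
    obtain ⟨i1, i2⟩ := hk.hp_moll hVc hVM hs0 x (t + s)
    rw [i2, moll, ← integral_sub i1 (hk.integrable_mul (by fun_prop))]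
    simp_rw [← mul_sub]
    refine hk.abs_integral_le fun q hqm => ?_
    obtain ⟨a1, a2, a3, a4, a5⟩ := hq2 q hqm t ht
    have hs1 : s ≤ d0 := hsd.trans (min_le_left _ _)
    have hs2 : s ≤ (T' - T'') / 2 := hsd.trans (min_le_right _ _)
    have b1 : V ((x, t) - q) = v (x - q.1) (t - q.2 + δ) := by
      simp only [hV, Prod.fst_sub, Prod.snd_sub, a2]
    have b2 : (fun y => V (y, t + s - q.2)) = fun y => v y (t - q.2 + δ + s) := by
      ext y
      simp only [hV]
      rw [hτe]
      · congr 1; ring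
      · exact ⟨by linarith [a1.1], by linarith⟩
    rw [b1, b2]
    have b3 : |Ψ (x - q.1, t - q.2 + δ) - Ψ (x, t)| ≤ η := by
      refine hδ1 (x - q.1) x _ a1 t a4 ?_ a3
      have := (hq q hqm).1
      rw [sub_sub_cancel_left, norm_neg]
      linarith
    have b4 := hs.compare (t0 := t - q.2 + δ) (t1 := t - q.2 + δ + s) (A := Ψ (x, t) + 2 * η) (c := c)
      a1.1 (by linarith) (by linarith) hc (x - q.1) fun r hr y => by
        have := (abs_le.1 (hbar y (x - q.1) r ⟨a1.1.trans hr.1, by linarith [hr.2]⟩ _ a1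
          (by rw [abs_of_nonneg] <;> linarith [hr.1, hr.2]))).2
        have := (abs_le.1 b3).2
        simp only [hΨ] at *
        linarith
    simpa using b4
  have hgrad : ‖WithLp.toLp 2 fun i => v1 i x t‖ ≤
      ‖WithLp.toLp 2 fun i => Dx i (moll k V) (x, t)‖ + √n * η := by
    have e1 : ‖(WithLp.toLp 2 fun i => v1 i x t) - WithLp.toLp 2 fun i => Dx i (moll k V) (x, t)‖ ≤
        √n * η := by
      rw [EuclideanSpace.norm_eq]
      calc _ ≤ √(∑ _i : Fin n, η ^ 2) := by
            refine Real.sqrt_le_sqrt (Finset.sum_le_sum fun i _ => ?_)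
            have := hwv1 i
            rw [abs_sub_comm] at this
            exact pow_le_pow_left₀ (abs_nonneg _) this 2
        _ = √n * η := by
            simp [Real.sqrt_sq hη0.le]
    have := norm_sub_norm_le (WithLp.toLp 2 fun i => v1 i x t)
      (WithLp.toLp 2 fun i => Dx i (moll k V) (x, t))
    linarith
  have habs : |v x t| ≤ |moll k V (x, t)| + η := by
    have := abs_sub_abs_le_abs_sub (v x t) (moll k V (x, t))
    rw [abs_sub_comm] at this
    linarith
  refine hB.trans ?_
  simp only [hΨ]
  have f1 := mul_le_mul_of_nonneg_left hgrad hR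
  have f2 := mul_le_mul_of_nonneg_left habs (sq_nonneg R)
  rw [← hηe]
  nlinarith

/-- Gaussian integral of the time slice of `f`. -/
noncomputable def gE (n : ℕ) (s : ℝ) (f : Eu n × ℝ → ℝ) (t : ℝ) : ℝ := ∫ x, f (x, t) * gk n s x

/-- Gaussian drift. -/
noncomputable def Qd {n : ℕ} (s : ℝ) (f : Eu n × ℝ → ℝ) (p : Eu n × ℝ) : ℝ :=
  ∑ i, p.1 i / (2 * s) * Dx i f p

/-- The Ornstein-Uhlenbeck operator. -/
noncomputable def OU {n : ℕ} (s : ℝ) (f : Eu n × ℝ → ℝ) (p : Eu n × ℝ) : ℝ :=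
  ∑ i, Dx i (Dx i f) p - Qd s f p

section energy
variable {n : ℕ} {f g w : Eu n × ℝ → ℝ} {r s t : ℝ}

theorem Van.mul_left (hf : Van r f) : Van r fun p => f p * g p := fun p hp => by simp [hf p hp]

theorem Van.mul_right (hg : Van r g) : Van r fun p => f p * g p := fun p hp => by simp [hg p hp]

theorem Van.sum {ι : Type*} {S : Finset ι} {F : ι → Eu n × ℝ → ℝ} (h : ∀ i ∈ S, Van r (F i)) :
    Van r fun p => ∑ i ∈ S, F i p := fun p hp => Finset.sum_eq_zero fun i hi => h i hi p hp

theorem Van.add (hf : Van r f) (hg : Van r g) : Van r fun p => f p + g p :=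
  fun p hp => by simp [hf p hp, hg p hp]

theorem Van.sub (hf : Van r f) (hg : Van r g) : Van r fun p => f p - g p :=
  fun p hp => by simp [hf p hp, hg p hp]

theorem gE_integrable (hf : Continuous f) (h0 : Van r f) :
    Integrable fun x => f (x, t) * gk n s x := by
  refine Continuous.integrable_of_hasCompactSupport ?_
    (HasCompactSupport.intro (isCompact_closedBall (0 : Eu n) r) fun y hy => by simp [h0 (y, t) hy])
  exact (by fun_prop : Continuous fun x : Eu n => f (x, t)).mul gk_continuous

theorem gE_add (hf : Continuous f) (h0 : Van r f) (hg : Continuous g) (h0' : Van r g) :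
    gE n s (fun p => f p + g p) t = gE n s f t + gE n s g t := by
  simp only [gE, add_mul]
  exact integral_add (gE_integrable hf h0) (gE_integrable hg h0')

theorem gE_sub (hf : Continuous f) (h0 : Van r f) (hg : Continuous g) (h0' : Van r g) :
    gE n s (fun p => f p - g p) t = gE n s f t - gE n s g t := by
  simp only [gE, sub_mul]
  exact integral_sub (gE_integrable hf h0) (gE_integrable hg h0')

theorem gE_const_mul (c : ℝ) : gE n s (fun p => c * f p) t = c * gE n s f t := by
  simp only [gE, mul_assoc]
  exact integral_const_mul _ _

theorem gE_sum {ι : Type*} {S : Finset ι} {F : ι → Eu n × ℝ → ℝ} (hF : ∀ i ∈ S, Continuous (F i))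
    (h : ∀ i ∈ S, Van r (F i)) : gE n s (fun p => ∑ i ∈ S, F i p) t = ∑ i ∈ S, gE n s (F i) t := by
  simp only [gE, Finset.sum_mul]
  exact integral_finsetSum _ fun i hi => gE_integrable (hF i hi) (h i hi)

theorem gE_nonneg (h : ∀ x, 0 ≤ f (x, t)) : 0 ≤ gE n s f t :=
  integral_nonneg fun x => mul_nonneg (h x) (gk_pos _ _ _).le

theorem gE_cauchy_schwarz (hf : Continuous f) (h0 : Van r f) (hg : Continuous g) (h0' : Van r g) :
    gE n s (fun p => f p * g p) t ^ 2 ≤ gE n s (fun p => f p ^ 2) t * gE n s (fun p => g p ^ 2) t := by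
  have h2 : Van r fun p => f p ^ 2 := fun p hp => by simp [h0 p hp]
  have h2' : Van r fun p => g p ^ 2 := fun p hp => by simp [h0' p hp]
  have key : ∀ l : ℝ, 0 ≤ gE n s (fun p => f p ^ 2) t * (l * l) +
      2 * gE n s (fun p => f p * g p) t * l + gE n s (fun p => g p ^ 2) t := by
    intro l
    have e : gE n s (fun p => (l * f p + g p) ^ 2) t = gE n s (fun p => f p ^ 2) t * (l * l) +
      2 * gE n s (fun p => f p * g p) t * l + gE n s (fun p => g p ^ 2) t := by
      have : (fun p => (l * f p + g p) ^ 2) =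
          fun p => (l * l * f p ^ 2 + 2 * l * (f p * g p)) + g p ^ 2 := by ext p; ring
      rw [this, gE_add (r := r) (by fun_prop) ?_ (by fun_prop) h2', gE_add (r := r) (by fun_prop) ?_
        (by fun_prop) ?_, gE_const_mul, gE_const_mul]
      · ring
      · exact h2.mul_right
      · exact h0.mul_left.mul_right
      · exact h2.mul_right.add h0.mul_left.mul_right
    rw [← e]
    exact gE_nonneg fun x => sq_nonneg _
  have := discrim_le_zero key
  rw [discrim] at this
  linarith

theorem Dx_mul (hf : ContDiff ℝ (⊤ : ℕ∞) f) (hg : ContDiff ℝ (⊤ : ℕ∞) g) (i : Fin n) (p : Eu n × ℝ) :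
    Dx i (fun p => f p * g p) p = Dx i f p * g p + f p * Dx i g p := by
  simp only [Dx]
  rw [fderiv_fun_mul (hf.differentiable (by simp) _) (hg.differentiable (by simp) _)]
  simp
  ring

theorem Dt_mul (hf : ContDiff ℝ (⊤ : ℕ∞) f) (hg : ContDiff ℝ (⊤ : ℕ∞) g) (p : Eu n × ℝ) :
    Dt (fun p => f p * g p) p = Dt f p * g p + f p * Dt g p := by
  simp only [Dt]
  rw [fderiv_fun_mul (hf.differentiable (by simp) _) (hg.differentiable (by simp) _)]
  simp
  ring

theorem Dx_add (hf : ContDiff ℝ (⊤ : ℕ∞) f) (hg : ContDiff ℝ (⊤ : ℕ∞) g) (i : Fin n) (p : Eu n × ℝ) :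
    Dx i (fun p => f p + g p) p = Dx i f p + Dx i g p := by
  simp only [Dx]
  rw [fderiv_fun_add (hf.differentiable (by simp) _) (hg.differentiable (by simp) _)]
  simp

theorem Dx_sum {ι : Type*} {S : Finset ι} {F : ι → Eu n × ℝ → ℝ}
    (hF : ∀ i ∈ S, ContDiff ℝ (⊤ : ℕ∞) (F i)) (i : Fin n) (p : Eu n × ℝ) :
    Dx i (fun p => ∑ j ∈ S, F j p) p = ∑ j ∈ S, Dx i (F j) p := by
  simp only [Dx]
  rw [fderiv_fun_sum fun j hj => (hF j hj).differentiable (by simp) _]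
  simp

theorem Dt_sum {ι : Type*} {S : Finset ι} {F : ι → Eu n × ℝ → ℝ}
    (hF : ∀ i ∈ S, ContDiff ℝ (⊤ : ℕ∞) (F i)) (p : Eu n × ℝ) :
    Dt (fun p => ∑ j ∈ S, F j p) p = ∑ j ∈ S, Dt (F j) p := by
  simp only [Dt]
  rw [fderiv_fun_sum fun j hj => (hF j hj).differentiable (by simp) _]
  simp

theorem coord_contDiff (i : Fin n) (s : ℝ) :
    ContDiff ℝ (⊤ : ℕ∞) (fun p : Eu n × ℝ => p.1 i / (2 * s)) := by fun_prop

theorem Dx_coord (i j : Fin n) (p : Eu n × ℝ) :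
    Dx j (fun p => p.1 i / (2 * s)) p = if i = j then 1 / (2 * s) else 0 := by
  have h1 := Dx_line (coord_contDiff i s) p.1 p.2 j 0
  have h2 : HasDerivAt (fun r : ℝ => (p.1 + r • ev j) i / (2 * s)) ((ev j) i / (2 * s)) 0 := by
    simp only [PiLp.add_apply, PiLp.smul_apply, smul_eq_mul]
    simpa using (((hasDerivAt_id (0 : ℝ)).mul_const ((ev j) i)).const_add (p.1 i)).div_const (2 * s)
  have := h1.unique h2
  simp only [zero_smul, add_zero] at this
  rw [this, PiLp.single_apply]
  split_ifs <;> simp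

theorem fderiv_fderiv_symm (hf : ContDiff ℝ (⊤ : ℕ∞) f) (p a b : Eu n × ℝ) :
    fderiv ℝ (fun q => fderiv ℝ f q a) p b = fderiv ℝ (fun q => fderiv ℝ f q b) p a := by
  have hd : DifferentiableAt ℝ (fderiv ℝ f) p :=
    (hf.fderiv_right (m := 1) (by norm_cast)).differentiable one_ne_zero p
  have h : ∀ c, fderiv ℝ (fun q => fderiv ℝ f q c) p = (fderiv ℝ (fderiv ℝ f) p).flip c := by
    intro c
    rw [fderiv_clm_apply hd (differentiableAt_const c)]
    refine ContinuousLinearMap.ext fun b => ?_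
    simp
  rw [h, h]
  have hsym : IsSymmSndFDerivAt ℝ f p := hf.contDiffAt.isSymmSndFDerivAt (by
    simp only [minSmoothness_of_isRCLikeNormedField]; exact WithTop.coe_le_coe.2 le_top)
  exact hsym b a

theorem Dx_Dx_comm (hf : ContDiff ℝ (⊤ : ℕ∞) f) (i j : Fin n) (p : Eu n × ℝ) :
    Dx i (Dx j f) p = Dx j (Dx i f) p := fderiv_fderiv_symm hf p _ _

theorem Dt_Dx_comm (hf : ContDiff ℝ (⊤ : ℕ∞) f) (i : Fin n) (p : Eu n × ℝ) :
    Dt (Dx i f) p = Dx i (Dt f) p := fderiv_fderiv_symm hf p _ _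

theorem Qd_contDiff (hf : ContDiff ℝ (⊤ : ℕ∞) f) : ContDiff ℝ (⊤ : ℕ∞) (Qd s f) :=
  ContDiff.sum fun i _ => (coord_contDiff i s).mul (Dx_contDiff hf i)

theorem OU_contDiff (hf : ContDiff ℝ (⊤ : ℕ∞) f) : ContDiff ℝ (⊤ : ℕ∞) (OU s f) :=
  (ContDiff.sum fun i _ => Dx_contDiff (Dx_contDiff hf i) i).sub (Qd_contDiff hf)

theorem Van.Qd (h0 : Van r f) : Van r (Qd s f) := Van.sum fun i _ => (h0.Dx i).mul_right

theorem Van.OU (h0 : Van r f) : Van r (OU s f) :=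
  (Van.sum fun i _ => (h0.Dx i).Dx i).sub h0.Qd

theorem Qd_mul (hf : ContDiff ℝ (⊤ : ℕ∞) f) (hg : ContDiff ℝ (⊤ : ℕ∞) g) (p : Eu n × ℝ) :
    Qd s (fun p => f p * g p) p = Qd s f p * g p + f p * Qd s g p := by
  simp only [Qd, Dx_mul hf hg, mul_add, Finset.sum_add_distrib, Finset.sum_mul, Finset.mul_sum]
  congr 1 <;> refine Finset.sum_congr rfl fun i _ => by ring

theorem Dx_Qd (hf : ContDiff ℝ (⊤ : ℕ∞) f) (i : Fin n) (p : Eu n × ℝ) :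
    Dx i (Qd s f) p = 1 / (2 * s) * Dx i f p + Qd s (Dx i f) p := by
  have h1 : Dx i (Qd s f) p = ∑ j, Dx i (fun p => p.1 j / (2 * s) * Dx j f p) p :=
    Dx_sum (fun j _ => (coord_contDiff j s).mul (Dx_contDiff hf j)) i p
  simp only [h1, Dx_mul (coord_contDiff _ s) (Dx_contDiff hf _), Dx_coord, Finset.sum_add_distrib, Qd,
    ite_mul, zero_mul]
  congr 1
  · simp
  · exact Finset.sum_congr rfl fun j _ => by rw [Dx_Dx_comm hf]

/-- Gaussian integration by parts. -/
theorem gE_Dx (hf : ContDiff ℝ (⊤ : ℕ∞) f) (h0 : Van r f) (i : Fin n) :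
    gE n s (Dx i f) t = gE n s (fun p => p.1 i / (2 * s) * f p) t := by
  have hgdf : Differentiable ℝ (gk n s) := by
    unfold gk
    have h : Differentiable ℝ fun x : Eu n => ‖x‖ ^ 2 := differentiable_id.norm_sq ℝ
    have h2 : Differentiable ℝ fun x : Eu n => -((n : ℝ) / 2) * Real.log s - ‖x‖ ^ 2 / (4 * s) := by
      simp only [div_eq_mul_inv]
      exact (h.mul_const _).const_sub _
    exact h2.exp
  have hgd : ∀ x, fderiv ℝ (gk n s) x (ev i) = -(x i / (2 * s)) * gk n s x := by
    intro x
    have h1 := (hgdf x).hasFDerivAt.comp_hasDerivAt_of_eq (0 : ℝ)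
      (by simpa using ((hasDerivAt_id (0 : ℝ)).smul_const (ev i)).const_add x :
        HasDerivAt (fun r : ℝ => x + r • ev i) (ev i) 0) (by simp)
    simpa using h1.unique (gk_hasDerivAt_line x i 0)
  have hff : Differentiable ℝ fun x => f (x, t) :=
    (hf.differentiable (by simp)).comp (differentiable_id.prodMk (differentiable_const t))
  have hfd : ∀ x, fderiv ℝ (fun x => f (x, t)) x (ev i) = Dx i f (x, t) := by
    intro x
    have h1 := (hff x).hasFDerivAt.comp_hasDerivAt_of_eq (0 : ℝ)
      (by simpa using ((hasDerivAt_id (0 : ℝ)).smul_const (ev i)).const_add x :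
        HasDerivAt (fun r : ℝ => x + r • ev i) (ev i) 0) (by simp)
    simpa using h1.unique (Dx_line hf x t i 0)
  have hi : Integrable fun x => f (x, t) * (-(x i / (2 * s)) * gk n s x) := by
    refine (gE_integrable (f := fun p => p.1 i / (2 * s) * f p) (n := n) (s := s) (t := t)
      ((coord_contDiff i s).mul hf).continuous h0.mul_right).neg.congr ?_
    filter_upwards with x
    simp only [Pi.neg_apply]
    ring
  have := integral_mul_fderiv_eq_neg_fderiv_mul_of_integrable (μ := volume)
    (f := fun x => f (x, t)) (g := gk n s) (v := ev i)
    (by simpa only [hfd] using gE_integrable (Dx_contDiff hf i).continuous (h0.Dx i))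
    (by simpa only [hgd] using hi) (gE_integrable hf.continuous h0)
    (fun x _ => hff x) (fun x _ => hgdf x)
  simp only [hgd, hfd] at this
  simp only [gE]
  rw [← neg_eq_iff_eq_neg] at this
  rw [← this, ← integral_neg]
  congr 1; ext x; ring

theorem gE_green (hf : ContDiff ℝ (⊤ : ℕ∞) f) (h0 : Van r f) (hg : ContDiff ℝ (⊤ : ℕ∞) g) :
    ∑ i, gE n s (fun p => Dx i f p * Dx i g p) t = - gE n s (fun p => f p * OU s g p) t := by
  have h1 : ∀ i, gE n s (fun p => Dx i f p * Dx i g p) t =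
      gE n s (fun p => p.1 i / (2 * s) * (f p * Dx i g p)) t
      - gE n s (fun p => f p * Dx i (Dx i g) p) t := by
    intro i
    have e := gE_Dx (s := s) (t := t) (hf.mul (Dx_contDiff hg i)) h0.mul_left i
    rw [← e, eq_sub_iff_add_eq, ← gE_add (r := r)]
    · congr 1; ext p; rw [Dx_mul hf (Dx_contDiff hg i)]
    · exact ((Dx_contDiff hf i).mul (Dx_contDiff hg i)).continuous
    · exact (h0.Dx i).mul_left
    · exact (hf.mul (Dx_contDiff (Dx_contDiff hg i) i)).continuous
    · exact h0.mul_left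
  simp_rw [h1]
  have hc1 : ∀ i ∈ Finset.univ, Continuous fun p : Eu n × ℝ => p.1 i / (2 * s) * (f p * Dx i g p) :=
    fun i _ => ((coord_contDiff i s).mul (hf.mul (Dx_contDiff hg i))).continuous
  have hc2 : ∀ i ∈ Finset.univ, Continuous fun p : Eu n × ℝ => f p * Dx i (Dx i g) p :=
    fun i _ => (hf.mul (Dx_contDiff (Dx_contDiff hg i) i)).continuous
  rw [Finset.sum_sub_distrib, ← gE_sum (r := r) hc1 fun i _ => h0.mul_left.mul_right,
    ← gE_sum (r := r) hc2 fun i _ => h0.mul_left, ← gE_sub (r := r) (continuous_finsetSum _ hc1)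
    (Van.sum fun i _ => h0.mul_left.mul_right) (continuous_finsetSum _ hc2)
    (Van.sum fun i _ => h0.mul_left), ← neg_one_mul, ← gE_const_mul]
  congr 1; ext p
  simp only [OU, Qd, mul_sub, Finset.mul_sum]
  rw [← Finset.sum_sub_distrib, ← Finset.sum_sub_distrib]
  exact Finset.sum_congr rfl fun i _ => by ring

theorem gE_weight (hf : ContDiff ℝ (⊤ : ℕ∞) f) (h0 : Van r f) :
    gE n s (fun p => (-(n : ℝ) / (2 * s) + ‖p.1‖ ^ 2 / (4 * s ^ 2)) * f p) t =
      gE n s (Qd s f) t := by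
  have hc : ∀ i : Fin n, ContDiff ℝ (⊤ : ℕ∞) fun p : Eu n × ℝ => p.1 i / (2 * s) * f p :=
    fun i => (coord_contDiff i s).mul hf
  have h1 : ∀ i : Fin n, gE n s (fun p => p.1 i / (2 * s) * (p.1 i / (2 * s) * f p)) t =
      gE n s (fun p => 1 / (2 * s) * f p + p.1 i / (2 * s) * Dx i f p) t := by
    intro i
    rw [← gE_Dx (hc i) h0.mul_right i]
    congr 1; ext p
    rw [Dx_mul (coord_contDiff i s) hf, Dx_coord, if_pos rfl]
  have h2 := Finset.sum_congr (rfl : (Finset.univ : Finset (Fin n)) = _) fun i _ => h1 i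
  rw [← gE_sum (r := r) (fun i _ => ((coord_contDiff i s).mul (hc i)).continuous)
    (fun i _ => h0.mul_right.mul_right), ← gE_sum (r := r) (fun i _ =>
      ((contDiff_const.mul hf).add ((coord_contDiff i s).mul (Dx_contDiff hf i))).continuous)
    (fun i _ => h0.mul_right.add (h0.Dx i).mul_right)] at h2
  have e1 : (fun p : Eu n × ℝ => ∑ i, p.1 i / (2 * s) * (p.1 i / (2 * s) * f p)) =
      fun p => ‖p.1‖ ^ 2 / (4 * s ^ 2) * f p := by
    ext p
    rw [EuclideanSpace.real_norm_sq_eq, Finset.sum_div, Finset.sum_mul]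
    exact Finset.sum_congr rfl fun i _ => by ring
  have e2 : (fun p : Eu n × ℝ => ∑ i : Fin n, (1 / (2 * s) * f p + p.1 i / (2 * s) * Dx i f p)) =
      fun p => (n : ℝ) / (2 * s) * f p + Qd s f p := by
    ext p
    rw [Finset.sum_add_distrib, Qd]
    simp
    ring
  have hQ := (Qd_contDiff (s := s) hf).continuous
  have hfc := hf.continuous
  have hw : Continuous fun p : Eu n × ℝ => ‖p.1‖ ^ 2 / (4 * s ^ 2) * f p :=
    ((continuous_fst.norm.pow 2).div_const _).mul hfc
  rw [e1, e2, gE_add (r := r) (by fun_prop) h0.mul_right hQ h0.Qd] at h2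
  have e3 : (fun p : Eu n × ℝ => (-(n : ℝ) / (2 * s) + ‖p.1‖ ^ 2 / (4 * s ^ 2)) * f p) =
      fun p => ‖p.1‖ ^ 2 / (4 * s ^ 2) * f p - (n : ℝ) / (2 * s) * f p := by ext p; ring
  rw [e3, gE_sub (r := r) hw h0.mul_right (by fun_prop) h0.mul_right, h2]
  ring

/-- Time derivative of Gaussian integrals. -/
theorem gE_hasDerivAt {a : ℝ} (hf : ContDiff ℝ (⊤ : ℕ∞) f) (h0 : Van r f) (ht : 0 < t + a) :
    HasDerivAt (fun t => gE n (t + a) f t)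
      (gE n (t + a) (fun p => Dt f p + Qd (t + a) f p) t) t := by
  have hfc := hf.continuous
  have hDc := (Dt_contDiff hf).continuous
  have hw : Continuous fun p : Eu n × ℝ =>
      (-(n : ℝ) / (2 * (t + a)) + ‖p.1‖ ^ 2 / (4 * (t + a) ^ 2)) * f p :=
    (continuous_const.add ((continuous_fst.norm.pow 2).div_const _)).mul hfc
  have hgk : ContinuousOn (fun p : ℝ × Eu n => gk n (p.1 + a) p.2) (Ioi (-a) ×ˢ univ) := by
    refine (gk_continuousOn n).comp (f := fun p : ℝ × Eu n => (p.1 + a, p.2)) (by fun_prop) ?_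
    rintro p ⟨hp, -⟩
    exact ⟨by have : -a < p.1 := hp; show 0 < p.1 + a; linarith, trivial⟩
  refine (hasDerivAt_integral_of_compact (k := fun t x => f (x, t) * gk n (t + a) x)
    (k' := fun r x => Dt f (x, r) * gk n (r + a) x + f (x, r) *
      ((-(n : ℝ) / (2 * (r + a)) + ‖x‖ ^ 2 / (4 * (r + a) ^ 2)) * gk n (r + a) x))
    (isCompact_closedBall (0 : Eu n) r) isOpen_Ioi (show -a < t by linarith) (fun q _ =>
      (by fun_prop : Continuous fun x : Eu n => f (x, q)).mul gk_continuous) (fun q hq x => ?_) ?_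
      (fun q _ x hx => by simp [h0 (x, q) hx])).congr_deriv ?_
  · have hq' : 0 < q + a := by have : -a < q := hq; linarith
    exact (Dt_line hf x q).mul ((gk_hasDerivAt_time hq' x).comp_add_const q a)
  · have h1 : ContinuousOn (fun p : ℝ × Eu n =>
        -(n : ℝ) / (2 * (p.1 + a)) + ‖p.2‖ ^ 2 / (4 * (p.1 + a) ^ 2)) (Ioi (-a) ×ˢ univ) := by
      rintro p ⟨hp, -⟩
      have h : p.1 + a ≠ 0 := by have : -a < p.1 := hp; linarith
      have h2 : 2 * (p.1 + a) ≠ 0 := by positivity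
      have h4 : 4 * (p.1 + a) ^ 2 ≠ 0 := by positivity
      exact ContinuousAt.continuousWithinAt (by fun_prop (disch := assumption))
    refine ContinuousOn.add (ContinuousOn.mul (Continuous.continuousOn (by fun_prop)) hgk)
      (ContinuousOn.mul (Continuous.continuousOn (by fun_prop)) (h1.mul hgk))
  · rw [gE_add (r := r) hDc h0.Dt (Qd_contDiff hf).continuous h0.Qd, ← gE_weight hf h0,
      ← gE_add (r := r) hDc h0.Dt hw h0.mul_right, gE]
    congr 1; ext x; ring

end energy

/-- Squared length of the spatial gradient. -/
noncomputable def gsq {n : ℕ} (w : Eu n × ℝ → ℝ) (p : Eu n × ℝ) : ℝ := ∑ i, Dx i w p ^ 2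

section identities
variable {n : ℕ} {w : Eu n × ℝ → ℝ} {r a s t : ℝ}

theorem gsq_contDiff (hw : ContDiff ℝ (⊤ : ℕ∞) w) : ContDiff ℝ (⊤ : ℕ∞) (gsq w) :=
  ContDiff.sum fun i _ => (Dx_contDiff hw i).pow 2

theorem Van.gsq (h0 : Van r w) : Van r (gsq w) :=
  Van.sum fun i _ p hp => by simp [(h0.Dx i) p hp]

theorem gE_gsq (hw : ContDiff ℝ (⊤ : ℕ∞) w) (h0 : Van r w) :
    gE n s (gsq w) t = -gE n s (fun p => w p * OU s w p) t := by
  rw [← gE_green hw h0 hw, ← gE_sum (r := r)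
    (fun i _ => ((Dx_contDiff hw i).mul (Dx_contDiff hw i)).continuous)
    (fun i _ => (h0.Dx i).mul_left)]
  congr 1; ext p
  exact Finset.sum_congr rfl fun i _ => sq _

theorem Dt_add_Qd (p : Eu n × ℝ) : Dt w p + Qd s w p = Lh w p - OU s w p := by
  simp only [Lh, OU]; ring

theorem height_hasDerivAt (hw : ContDiff ℝ (⊤ : ℕ∞) w) (h0 : Van r w) (ht : 0 < t + a) :
    HasDerivAt (fun t => gE n (t + a) (fun p => w p ^ 2) t)
      (2 * gE n (t + a) (gsq w) t + 2 * gE n (t + a) (fun p => w p * Lh w p) t) t := by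
  simp only [sq]
  refine (gE_hasDerivAt (hw.mul hw) h0.mul_left ht).congr_deriv ?_
  have e : (fun p => Dt (fun p => w p * w p) p + Qd (t + a) (fun p => w p * w p) p) =
      fun p => 2 * (w p * Lh w p) - 2 * (w p * OU (t + a) w p) := by
    ext p
    rw [Dt_mul hw hw, Qd_mul hw hw]
    linear_combination (2 * w p) * Dt_add_Qd (w := w) (s := t + a) p
  have hL := Lh_continuous hw
  have hO := (OU_contDiff (s := t + a) hw).continuous
  have hc := hw.continuous
  rw [e, gE_sub (r := r) (by fun_prop) h0.mul_left.mul_right (by fun_prop) h0.mul_left.mul_right,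
    gE_const_mul, gE_const_mul, gE_gsq hw h0]
  ring

theorem energy_hasDerivAt (hw : ContDiff ℝ (⊤ : ℕ∞) w) (h0 : Van r w) (ht : 0 < t + a) :
    HasDerivAt (fun t => gE n (t + a) (gsq w) t)
      (2 * gE n (t + a) (fun p => (OU (t + a) w p - Lh w p / 2) ^ 2) t -
        gE n (t + a) (fun p => Lh w p ^ 2) t / 2 - gE n (t + a) (gsq w) t / (t + a)) t := by
  refine (gE_hasDerivAt (gsq_contDiff hw) h0.gsq ht).congr_deriv ?_
  set s := t + a with hs
  let G : Eu n × ℝ → ℝ := fun p => Dt w p + Qd s w p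
  have hG : ContDiff ℝ (⊤ : ℕ∞) G := (Dt_contDiff hw).add (Qd_contDiff hw)
  have hG0 : Van r G := h0.Dt.add h0.Qd
  have hD : ∀ i, ContDiff ℝ (⊤ : ℕ∞) (Dx i w) := Dx_contDiff hw
  have hgs : gsq w = fun p => ∑ i, Dx i w p * Dx i w p := by
    ext p; exact Finset.sum_congr rfl fun i _ => sq _
  have e : (fun p => Dt (gsq w) p + Qd s (gsq w) p) =
      fun p => 2 * (∑ i, Dx i G p * Dx i w p) - 1 / s * gsq w p := by
    ext p
    have h1 : Dt (gsq w) p = ∑ i, 2 * (Dx i w p * Dt (Dx i w) p) := by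
      rw [hgs, Dt_sum fun i _ => (hD i).mul (hD i)]
      exact Finset.sum_congr rfl fun i _ => by rw [Dt_mul (hD i) (hD i)]; ring
    have h2 : Qd s (gsq w) p = ∑ i, 2 * (Dx i w p * Qd s (Dx i w) p) := by
      rw [hgs]
      have : ∀ j, Dx j (fun p => ∑ i, Dx i w p * Dx i w p) p =
          ∑ i, 2 * (Dx i w p * Dx j (Dx i w) p) := fun j => by
        rw [Dx_sum fun i _ => (hD i).mul (hD i)]
        exact Finset.sum_congr rfl fun i _ => by rw [Dx_mul (hD i) (hD i)]; ring
      simp only [Qd, this, Finset.mul_sum]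
      rw [Finset.sum_comm]
      exact Finset.sum_congr rfl fun i _ => Finset.sum_congr rfl fun j _ => by ring
    have h3 : ∀ i, Dx i G p = Dt (Dx i w) p + (1 / (2 * s) * Dx i w p + Qd s (Dx i w) p) :=
      fun i => by rw [Dx_add (Dt_contDiff hw) (Qd_contDiff hw), Dx_Qd hw, Dt_Dx_comm hw]
    rw [h1, h2, ← Finset.sum_add_distrib, gsq, Finset.mul_sum, Finset.mul_sum,
      ← Finset.sum_sub_distrib]
    refine Finset.sum_congr rfl fun i _ => ?_
    rw [h3]
    have : s ≠ 0 := ht.ne'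
    field_simp
    ring
  have hcG : ∀ i ∈ Finset.univ, Continuous fun p => Dx i G p * Dx i w p :=
    fun i _ => ((Dx_contDiff hG i).mul (hD i)).continuous
  have hvG : ∀ i ∈ Finset.univ, Van r fun p => Dx i G p * Dx i w p :=
    fun i _ => (h0.Dx i).mul_right
  have hL := Lh_continuous hw
  have hO := (OU_contDiff (s := s) hw).continuous
  have hLv := h0.Lh
  have hOv := h0.OU (s := s)
  rw [e, gE_sub (r := r) ((continuous_finsetSum _ hcG).const_mul 2) (Van.sum hvG).mul_right
    ((gsq_contDiff hw).continuous.const_mul (1 / s)) h0.gsq.mul_right, gE_const_mul, gE_const_mul,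
    gE_sum hcG hvG, gE_green hG hG0 hw]
  have e2 : (fun p => (OU s w p - Lh w p / 2) ^ 2) =
      fun p => 1 / 4 * Lh w p ^ 2 - G p * OU s w p := by
    ext p
    simp only [G, Dt_add_Qd]
    ring
  have hGc := hG.continuous
  rw [e2, gE_sub (r := r) (by fun_prop) ?_ (by fun_prop) hG0.mul_left, gE_const_mul]
  · ring
  · intro p hp
    simp [hLv p hp]

theorem energy_add_sq_le (hw : ContDiff ℝ (⊤ : ℕ∞) w) (h0 : Van r w) :
    (gE n s (gsq w) t + 1 / 2 * gE n s (fun p => w p * Lh w p) t) ^ 2 ≤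
      gE n s (fun p => w p ^ 2) t * gE n s (fun p => (OU s w p - Lh w p / 2) ^ 2) t := by
  have hL := Lh_continuous hw
  have hO := (OU_contDiff (s := s) hw).continuous
  have hc := hw.continuous
  have hv : Van r fun p => OU s w p - Lh w p / 2 := fun p hp => by
    simp [h0.Lh p hp, h0.OU (s := s) p hp]
  refine le_trans (le_of_eq ?_) (gE_cauchy_schwarz hc h0 (by fun_prop) hv)
  have e : (fun p => w p * (OU s w p - Lh w p / 2)) =
      fun p => w p * OU s w p - 1 / 2 * (w p * Lh w p) := by ext p; ring
  rw [e, gE_sub (r := r) (by fun_prop) h0.mul_left (by fun_prop) h0.mul_left.mul_right,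
    gE_const_mul, gE_gsq hw h0]
  ring

end identities

section frequency

/-- The differential inequalities satisfied by the height `H` and the energy `D` of a solution. -/
structure FreqSystem (R a : ℝ) (H D b X P : ℝ → ℝ) : Prop where
  R0 : 0 < R
  a0 : 0 < a
  aT : a ≤ 1 / R ^ 2
  H0 : ∀ t ∈ Icc 0 (3 / (4 * R ^ 2)), 0 < H t
  D0 : ∀ t ∈ Icc 0 (3 / (4 * R ^ 2)), 0 ≤ D t
  dH : ∀ t ∈ Icc 0 (3 / (4 * R ^ 2)), HasDerivAt H (2 * D t + 4 * b t) t
  dD : ∀ t ∈ Icc 0 (3 / (4 * R ^ 2)), HasDerivAt D (2 * (X t - P t / 4) - D t / (t + a)) t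
  sqA : ∀ t ∈ Icc 0 (3 / (4 * R ^ 2)), (D t + b t) ^ 2 ≤ H t * X t
  sqb : ∀ t ∈ Icc 0 (3 / (4 * R ^ 2)), b t ^ 2 ≤ H t * P t / 4
  leP : ∀ t ∈ Icc 0 (3 / (4 * R ^ 2)), P t ≤ 4 * (R ^ 4 * H t + R ^ 2 * D t)

variable {R a : ℝ} {H D b X P : ℝ → ℝ}

theorem FreqSystem.abs_b_le (hs : FreqSystem R a H D b X P) {t : ℝ}
    (ht : t ∈ Icc 0 (3 / (4 * R ^ 2))) : 4 * |b t| ≤ D t + 5 * R ^ 2 * H t := by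
  have hH := hs.H0 t ht
  have hD := hs.D0 t ht
  have hR := hs.R0
  have h1 : b t ^ 2 ≤ H t * (R ^ 4 * H t + R ^ 2 * D t) := by
    have := mul_le_mul_of_nonneg_left (hs.leP t ht) hH.le
    have := hs.sqb t ht
    linarith
  have h2 : (4 * |b t|) ^ 2 ≤ (D t + 5 * R ^ 2 * H t) ^ 2 := by
    rw [mul_pow, sq_abs]
    nlinarith [sq_nonneg (D t - 3 * R ^ 2 * H t)]
  exact (abs_le_of_sq_le_sq' h2 (by positivity)).2

/-- The frequency function does not drop too fast. -/
theorem FreqSystem.frequency_hasDerivAt (hs : FreqSystem R a H D b X P) {t : ℝ}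
    (ht : t ∈ Icc 0 (3 / (4 * R ^ 2))) : ∃ q, HasDerivAt (fun t => (t + a) * D t / H t) q t ∧
      -(4 * R ^ 2 * (1 + (t + a) * D t / H t)) ≤ q := by
  have hH := hs.H0 t ht
  have hD := hs.D0 t ht
  have hR := hs.R0
  have hσ : 0 < t + a := add_pos_of_nonneg_of_pos ht.1 hs.a0
  have hσR : R ^ 2 * (t + a) ≤ 2 := by
    have h1 := ht.2
    have h2 := hs.aT
    have h3 : 3 / (4 * R ^ 2) = 3 / 4 * (1 / R ^ 2) := by field_simp
    have h4 : R ^ 2 * (1 / R ^ 2) = 1 := by field_simp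
    have : t + a ≤ 2 * (1 / R ^ 2) := by rw [h3] at h1; have : 0 < 1 / R ^ 2 := by positivity
                                         linarith
    calc _ ≤ R ^ 2 * (2 * (1 / R ^ 2)) := by gcongr
      _ = 2 := by linear_combination 2 * h4
  refine ⟨_, ((((hasDerivAt_id t).add_const a).mul (hs.dD t ht)).div (hs.dH t ht) hH.ne'), ?_⟩
  simp only [id, Pi.mul_apply]
  have e : ((1 * D t + (t + a) * (2 * (X t - P t / 4) - D t / (t + a))) * H t -
      (t + a) * D t * (2 * D t + 4 * b t)) / H t ^ 2 =
      2 * (t + a) / H t ^ 2 * (H t * X t - (D t + b t) ^ 2 + b t ^ 2) - (t + a) * P t / (2 * H t) := by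
    field_simp
    ring
  rw [e]
  have h1 : 0 ≤ 2 * (t + a) / H t ^ 2 * (H t * X t - (D t + b t) ^ 2 + b t ^ 2) := by
    have := hs.sqA t ht
    have : 0 ≤ H t * X t - (D t + b t) ^ 2 + b t ^ 2 := by nlinarith [sq_nonneg (b t)]
    positivity
  have h2 : (t + a) * P t / (2 * H t) ≤ (t + a) * (4 * (R ^ 4 * H t + R ^ 2 * D t)) / (2 * H t) := by
    gcongr
    exact hs.leP t ht
  have h3 : (t + a) * (4 * (R ^ 4 * H t + R ^ 2 * D t)) / (2 * H t) =
      2 * R ^ 2 * (R ^ 2 * (t + a) + (t + a) * D t / H t) := by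
    field_simp
    ring
  have h4 : 2 * R ^ 2 * (R ^ 2 * (t + a) + (t + a) * D t / H t) ≤
      2 * R ^ 2 * (2 + (t + a) * D t / H t) := by gcongr
  have h5 : 0 ≤ R ^ 2 * ((t + a) * D t / H t) := by positivity
  linarith

theorem FreqSystem.height_decay (hs : FreqSystem R a H D b X P) :
    Real.exp (-2) * H 0 ≤ H (1 / (4 * R ^ 2)) := by
  have hR := hs.R0
  have hR2 : 0 < 1 / (4 * R ^ 2) := by positivity
  have hsub : Icc 0 (1 / (4 * R ^ 2)) ⊆ Icc 0 (3 / (4 * R ^ 2)) := by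
    refine Icc_subset_Icc_right ?_
    gcongr
    norm_num
  have hd : ∀ t ∈ Icc 0 (1 / (4 * R ^ 2)), HasDerivAt (fun t => Real.exp (5 * R ^ 2 * t) * H t)
      (Real.exp (5 * R ^ 2 * t) * (5 * R ^ 2) * H t +
        Real.exp (5 * R ^ 2 * t) * (2 * D t + 4 * b t)) t := fun t ht => by
    have h1 : HasDerivAt (fun t => 5 * R ^ 2 * t) (5 * R ^ 2) t := by
      simpa using (hasDerivAt_id t).const_mul (5 * R ^ 2)
    exact h1.exp.mul (hs.dH t (hsub ht))
  have hmono : MonotoneOn (fun t => Real.exp (5 * R ^ 2 * t) * H t) (Icc 0 (1 / (4 * R ^ 2))) := by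
    refine monotoneOn_of_deriv_nonneg (convex_Icc _ _) (fun t ht => (hd t ht).continuousAt.continuousWithinAt)
      (fun t ht => (hd t (interior_subset ht)).differentiableAt.differentiableWithinAt) fun t ht => ?_
    have ht' := interior_subset ht
    rw [(hd t ht').deriv]
    have h1 := hs.abs_b_le (hsub ht')
    have h2 := neg_abs_le (b t)
    have h3 := hs.D0 t (hsub ht')
    have : 0 ≤ Real.exp (5 * R ^ 2 * t) * (5 * R ^ 2 * H t + 2 * D t + 4 * b t) :=
      mul_nonneg (Real.exp_pos _).le (by linarith)
    linarith
  have := hmono (left_mem_Icc.2 hR2.le) (right_mem_Icc.2 hR2.le) hR2.le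
  simp only [mul_zero, Real.exp_zero, one_mul] at this
  have e : 5 * R ^ 2 * (1 / (4 * R ^ 2)) = 5 / 4 := by field_simp
  rw [e] at this
  have hH := hs.H0 _ (hsub (right_mem_Icc.2 hR2.le))
  calc _ ≤ Real.exp (-2) * (Real.exp (5 / 4) * H (1 / (4 * R ^ 2))) := by gcongr
    _ = Real.exp (-2 + 5 / 4) * H (1 / (4 * R ^ 2)) := by rw [Real.exp_add]; ring
    _ ≤ 1 * H (1 / (4 * R ^ 2)) := by gcongr; rw [Real.exp_le_one_iff]; norm_num
    _ = _ := one_mul _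

/-- Doubling-type lower bound for the height at the initial time. -/
theorem FreqSystem.log_height_ge (hs : FreqSystem R a H D b X P) :
    0 ≤ 4 * Real.log (H (3 / (4 * R ^ 2)) / H (1 / (4 * R ^ 2))) + 11 ∧
    Real.log (H (1 / (4 * R ^ 2))) - 2 - 3 * (Real.exp 4 *
      (4 * Real.log (H (3 / (4 * R ^ 2)) / H (1 / (4 * R ^ 2))) + 11)) * Real.log (2 / (a * R ^ 2)) ≤
      Real.log (H 0) := by
  have hR := hs.R0
  have ha := hs.a0
  set q := 1 / (4 * R ^ 2) with hq
  have hq0 : 0 < q := by positivity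
  have h3q : 3 / (4 * R ^ 2) = 3 * q := by rw [hq]; field_simp
  have hRq : R ^ 2 * q = 1 / 4 := by rw [hq]; field_simp
  have haq : a ≤ 4 * q := by
    have := hs.aT
    have e : 1 / R ^ 2 = 4 * q := by rw [hq]; field_simp
    linarith
  rw [h3q]
  set L := Real.log (H (3 * q) / H q) with hL
  have hm : ∀ t, 0 ≤ t → t ≤ 3 * q → t ∈ Icc 0 (3 / (4 * R ^ 2)) := fun t h1 h2 => ⟨h1, h3q ▸ h2⟩
  -- derivative of the logarithm of the height
  have hlog : ∀ t, 0 ≤ t → t ≤ 3 * q → HasDerivAt (fun t => Real.log (H t))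
      ((2 * D t + 4 * b t) / H t) t := fun t h1 h2 =>
    (hs.dH t (hm t h1 h2)).log (hs.H0 t (hm t h1 h2)).ne'
  obtain ⟨c, hc, hce⟩ := exists_hasDerivAt_eq_slope (fun t => Real.log (H t))
    (fun t => (2 * D t + 4 * b t) / H t) (show q < 3 * q by linarith)
    (fun t ht => (hlog t (hq0.le.trans ht.1) ht.2).continuousAt.continuousWithinAt)
    (fun t ht => hlog t (hq0.le.trans ht.1.le) ht.2.le)
  have hHc := hs.H0 c (hm c (hq0.le.trans hc.1.le) hc.2.le)
  have hDc := hs.D0 c (hm c (hq0.le.trans hc.1.le) hc.2.le)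
  have hLe : (2 * D c + 4 * b c) / H c = L / (2 * q) := by
    rw [hce, hL, Real.log_div (hs.H0 _ (hm _ (by linarith) le_rfl)).ne'
      (hs.H0 _ (hm _ hq0.le (by linarith))).ne']
    ring
  have hNc : (c + a) * D c / H c ≤ 4 * L + 10 := by
    have h1 := hs.abs_b_le (hm c (hq0.le.trans hc.1.le) hc.2.le)
    have h2 := neg_abs_le (b c)
    have h3 : D c / H c - 5 * R ^ 2 ≤ L / (2 * q) := by
      rw [← hLe, le_div_iff₀ hHc, sub_mul, div_mul_cancel₀ _ hHc.ne']
      linarith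
    have h4 : 0 ≤ D c / H c := by positivity
    have h5 : c + a ≤ 8 * q := by linarith [hc.2]
    calc (c + a) * D c / H c = (c + a) * (D c / H c) := by ring
      _ ≤ 8 * q * (D c / H c) := by gcongr
      _ ≤ 8 * q * (L / (2 * q) + 5 * R ^ 2) := by gcongr; linarith
      _ = 4 * L + 10 := by
        have : 8 * q * (L / (2 * q)) = 4 * L := by field_simp; ring
        linear_combination this + 40 * hRq
  have hN0 : 0 ≤ (c + a) * D c / H c :=
    div_nonneg (mul_nonneg (by linarith [hc.1]) hDc) hHc.le
  refine ⟨by linarith, ?_⟩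
  -- monotonicity of the modified frequency
  set N : ℝ → ℝ := fun t => (t + a) * D t / H t with hN
  have hNb : ∀ t, 0 ≤ t → t ≤ q → N t ≤ Real.exp 4 * (4 * L + 11) := by
    intro t ht0 htq
    have hd : ∀ s ∈ Icc t c, ∃ y, HasDerivAt (fun s => Real.exp (4 * R ^ 2 * s) * (1 + N s)) y s ∧
        0 ≤ y := by
      intro s hsI
      obtain ⟨y, hy, hle⟩ := hs.frequency_hasDerivAt
        (hm s (ht0.trans hsI.1) (hsI.2.trans hc.2.le))
      have h1 : HasDerivAt (fun t => 4 * R ^ 2 * t) (4 * R ^ 2) s := by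
        simpa using (hasDerivAt_id s).const_mul (4 * R ^ 2)
      refine ⟨_, h1.exp.mul (hy.const_add 1), ?_⟩
      have : 0 ≤ Real.exp (4 * R ^ 2 * s) * (4 * R ^ 2 * (1 + N s) + y) :=
        mul_nonneg (Real.exp_pos _).le (by simp only [hN]; linarith)
      linarith
    have hmono : MonotoneOn (fun s => Real.exp (4 * R ^ 2 * s) * (1 + N s)) (Icc t c) := by
      refine monotoneOn_of_deriv_nonneg (convex_Icc _ _) (fun s hsI => ?_) (fun s hsI => ?_)
        fun s hsI => ?_
      · obtain ⟨y, hy, -⟩ := hd s hsI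
        exact hy.continuousAt.continuousWithinAt
      · obtain ⟨y, hy, -⟩ := hd s (interior_subset hsI)
        exact hy.differentiableAt.differentiableWithinAt
      · obtain ⟨y, hy, h0⟩ := hd s (interior_subset hsI)
        rwa [hy.deriv]
    have htc : t ≤ c := htq.trans hc.1.le
    have h1 := hmono (left_mem_Icc.2 htc) (right_mem_Icc.2 htc) htc
    have hHt := hs.H0 t (hm t ht0 (by linarith))
    have hDt := hs.D0 t (hm t ht0 (by linarith))
    have hNt : 0 ≤ N t := div_nonneg (mul_nonneg (by linarith) hDt) hHt.le
    have h2 : 1 + N t ≤ Real.exp (4 * R ^ 2 * t) * (1 + N t) :=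
      le_mul_of_one_le_left (by linarith) (Real.one_le_exp (by positivity))
    have h3 : Real.exp (4 * R ^ 2 * c) ≤ Real.exp 4 := by
      refine Real.exp_le_exp.2 ?_
      have : R ^ 2 * c ≤ R ^ 2 * (3 * q) := by have := hc.2.le; gcongr
      linarith
    have h4 : 0 ≤ N c := hN0
    have h5 : N c ≤ 4 * L + 10 := hNc
    calc N t ≤ Real.exp (4 * R ^ 2 * c) * (1 + N c) := by linarith
      _ ≤ Real.exp 4 * (1 + (4 * L + 10)) := by gcongr
      _ = _ := by ring
  set K := Real.exp 4 * (4 * L + 11) with hK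
  have hK0 : 0 ≤ K := mul_nonneg (Real.exp_pos _).le (by linarith)
  have hd : ∀ t ∈ Icc 0 q, HasDerivAt
      (fun t => Real.log (H t) - 3 * K * Real.log (t + a) - 5 * R ^ 2 * t)
      ((2 * D t + 4 * b t) / H t - 3 * K * (1 / (t + a)) - 5 * R ^ 2) t := by
    intro t ht
    have h1 : HasDerivAt (fun t => 5 * R ^ 2 * t) (5 * R ^ 2) t := by
      simpa using (hasDerivAt_id t).const_mul (5 * R ^ 2)
    have h2 := (((hasDerivAt_id t).add_const a).log (show id t + a ≠ 0 from
      (add_pos_of_nonneg_of_pos ht.1 ha).ne')).const_mul (3 * K)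
    exact ((hlog t ht.1 (by linarith [ht.2])).sub h2).sub h1
  have hanti : AntitoneOn (fun t => Real.log (H t) - 3 * K * Real.log (t + a) - 5 * R ^ 2 * t)
      (Icc 0 q) := by
    refine antitoneOn_of_deriv_nonpos (convex_Icc _ _)
      (fun t ht => (hd t ht).continuousAt.continuousWithinAt)
      (fun t ht => (hd t (interior_subset ht)).differentiableAt.differentiableWithinAt) fun t ht => ?_
    have ht' := interior_subset ht
    rw [(hd t ht').deriv]
    have hmt := hm t ht'.1 (by linarith [ht'.2])
    have hH := hs.H0 t hmt
    have hσ : 0 < t + a := add_pos_of_nonneg_of_pos ht'.1 ha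
    have h1 := hs.abs_b_le hmt
    have h2 := le_abs_self (b t)
    have h3 : (2 * D t + 4 * b t) / H t ≤ 3 * (D t / H t) + 5 * R ^ 2 := by
      rw [div_le_iff₀ hH, add_mul, mul_assoc, div_mul_cancel₀ _ hH.ne']
      linarith
    have h4 : D t / H t ≤ K * (1 / (t + a)) := by
      rw [mul_one_div, le_div_iff₀ hσ]
      calc D t / H t * (t + a) = N t := by simp only [hN]; ring
        _ ≤ K := hNb t ht'.1 ht'.2
    linarith
  have h1 := hanti (left_mem_Icc.2 hq0.le) (right_mem_Icc.2 hq0.le) hq0.le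
  simp only [zero_add, mul_zero, sub_zero] at h1
  have h2 : Real.log (q + a) - Real.log a ≤ Real.log (2 / (a * R ^ 2)) := by
    rw [← Real.log_div (by positivity) ha.ne']
    refine Real.log_le_log (by positivity) ?_
    rw [div_le_div_iff₀ ha (by positivity)]
    have : R ^ 2 * (q + a) ≤ 2 := by
      calc _ ≤ R ^ 2 * (q + 4 * q) := by gcongr
        _ ≤ 2 := by linarith
    nlinarith
  have h3 : 3 * K * (Real.log (q + a) - Real.log a) ≤ 3 * K * Real.log (2 / (a * R ^ 2)) := by
    gcongr
  linarith

end frequency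

/-- The constant in front of the height correction. -/
noncomputable def hcst (n : ℕ) (C : ℝ) : ℝ :=
  2 * (C ^ 2 + 1) * Real.exp ((n : ℝ) / 2 * Real.log 2) * gc n

/-- The height correction absorbing the cutoff error, at scale `s`. -/
noncomputable def hcor (n : ℕ) (C R s : ℝ) : ℝ :=
  hcst n C * Real.exp (-(R ^ 2 / 16)) * Real.exp (R ^ 2 / 16 * Real.log (s * R ^ 2 / 2))

section correction
variable {n : ℕ} {C R s : ℝ}

theorem hcst_pos : 0 < hcst n C := by
  have := gc_pos n
  unfold hcst; positivity

theorem hcor_pos : 0 < hcor n C R s := by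
  have := hcst_pos (n := n) (C := C)
  unfold hcor; positivity

theorem hcor_hasDerivAt (hs : 0 < s) (hR : 0 < R) :
    HasDerivAt (hcor n C R) (R ^ 2 / 16 / s * hcor n C R s) s := by
  unfold hcor
  have h1 : HasDerivAt (fun s => s * R ^ 2 / 2) (R ^ 2 / 2) s := by
    simpa using ((hasDerivAt_id s).mul_const (R ^ 2)).div_const 2
  have h2 : s * R ^ 2 / 2 ≠ 0 := by positivity
  refine ((((h1.log h2).const_mul (R ^ 2 / 16)).exp).const_mul
    (hcst n C * Real.exp (-(R ^ 2 / 16)))).congr_deriv ?_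
  field_simp

theorem hcor_mono {s' : ℝ} (hs : 0 < s) (hss : s ≤ s') (hR : 0 < R) :
    hcor n C R s ≤ hcor n C R s' := by
  have := hcst_pos (n := n) (C := C)
  unfold hcor
  gcongr

theorem hcor_ge (hs : 0 < s) (hR : 0 < R) :
    hcst n C * Real.exp (-(1 / (8 * s))) ≤ hcor n C R s := by
  have := hcst_pos (n := n) (C := C)
  rw [hcor, mul_assoc, ← Real.exp_add]
  gcongr
  have h := Real.one_sub_inv_le_log_of_pos (show 0 < s * R ^ 2 / 2 by positivity)
  have h2 : R ^ 2 / 16 * (1 - (s * R ^ 2 / 2)⁻¹) ≤ R ^ 2 / 16 * Real.log (s * R ^ 2 / 2) := by gcongr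
  have h3 : R ^ 2 / 16 * (1 - (s * R ^ 2 / 2)⁻¹) = R ^ 2 / 16 - 1 / (8 * s) := by
    field_simp
    ring
  linarith

theorem hcor_le (hs : 0 < s) (hsR : s * R ^ 2 ≤ 2) (hR : 0 < R) :
    hcor n C R s ≤ hcst n C * Real.exp (-(R ^ 2 / 16)) := by
  have := hcst_pos (n := n) (C := C)
  unfold hcor
  refine mul_le_of_le_one_right (by positivity) (Real.exp_le_one_iff.2 ?_)
  exact mul_nonpos_of_nonneg_of_nonpos (by positivity)
    (Real.log_nonpos (by positivity) (by linarith))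

/-- Gaussian mass of the cutoff error. -/
theorem cutoff_integral_le {ζ : Eu n → ℝ} (hs : 0 < s) (hR : 0 < R) (hζ : ∀ x, ζ x ∈ Icc 0 C)
    (h0 : ∀ x, ‖x‖ < 2 → ζ x = 0) : ∫ x, ζ x ^ 2 * gk n s x ≤ hcor n C R s / 2 := by
  have hgc := gc_pos n
  set c := C ^ 2 * (Real.exp ((n : ℝ) / 2 * Real.log 2) * Real.exp (-(1 / (8 * s)))) with hc
  have h1 : ∫ x, ζ x ^ 2 * gk n s x ≤ ∫ x, c * gk n (2 * s) x := by
    refine integral_mono_of_nonneg (Filter.Eventually.of_forall fun x =>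
      mul_nonneg (sq_nonneg _) (gk_pos _ _ _).le)
      ((gk_integrable (by positivity)).const_mul _) (Filter.Eventually.of_forall fun x => ?_)
    have hg := gk_pos n (2 * s) x
    rcases lt_or_ge ‖x‖ 2 with hx | hx
    · simp only [h0 x hx]
      have : 0 ≤ c := by positivity
      simp only [ne_eq, OfNat.ofNat_ne_zero, not_false_eq_true, zero_pow, zero_mul]
      positivity
    · simp only [hc]
      rw [gk_two hs, mul_assoc (C ^ 2)]
      have h2 := (hζ x).1
      have h3 := (hζ x).2
      have h4 : 1 ≤ ‖x‖ ^ 2 := by nlinarith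
      gcongr
  rw [integral_const_mul, gk_integral (by positivity)] at h1
  refine h1.trans ?_
  have h2 := hcor_ge (n := n) (C := C) hs hR
  rw [hcst] at h2
  have h3 : 0 ≤ Real.exp ((n : ℝ) / 2 * Real.log 2) * gc n * Real.exp (-(1 / (8 * s))) := by positivity
  rw [hc]
  linarith

end correction

theorem integral_four {α : Type*} [MeasurableSpace α] {μ : Measure α} {f g h k : α → ℝ} {a b c d : ℝ}
    (hf : Integrable f μ) (hg : Integrable g μ) (hh : Integrable h μ) (hk : Integrable k μ) :
    ∫ x, (a * f x + b * g x + c * h x + d * k x) ∂μ =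
      a * ∫ x, f x ∂μ + b * ∫ x, g x ∂μ + c * ∫ x, h x ∂μ + d * ∫ x, k x ∂μ := by
  have hab : Integrable (fun x => a * f x + b * g x) μ := (hf.const_mul a).add (hg.const_mul b)
  have habc : Integrable (fun x => a * f x + b * g x + c * h x) μ := hab.add (hh.const_mul c)
  rw [integral_add habc (hk.const_mul d), integral_add hab (hh.const_mul c),
    integral_add (hf.const_mul a) (hg.const_mul b)]
  simp only [integral_const_mul]

/-- A cut-off solution is approximated by smooth functions to which the frequency method applies. -/
theorem IsSol.exists_freqSystem {n : ℕ} {L R C a e : ℝ} {ζ : Eu n → ℝ} {v : Eu n → ℝ → ℝ}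
    {v1 v2 : Fin n → Eu n → ℝ → ℝ} {vt : Eu n → ℝ → ℝ}
    (hs : IsSol n (1 / R ^ 2) L R C ζ v v1 v2 vt) (hR : 1 ≤ R) (hz : ∀ x, ‖x‖ < 2 → ζ x = 0)
    (ha : 0 < a) (haT : a ≤ 1 / R ^ 2) (he : 0 < e) :
    ∃ (w : Eu n × ℝ → ℝ) (H D b X P : ℝ → ℝ), Continuous w ∧ Van 4 w ∧
      (∀ t ∈ Icc 0 (3 / (4 * R ^ 2)), ∀ x, |w (x, t)| ≤ 1 ∧ |w (x, t) - v x t| ≤ e) ∧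
      FreqSystem R a H D b X P ∧
      ∀ t, H t = gE n (t + a) (fun p => w p ^ 2) t + hcor n C R (t + a) := by
  have hR0 : 0 < R := by linarith
  have hgc := gc_pos n
  have hc0 : 0 < hcor n C R a := hcor_pos
  set e' := min e (min 1 (hcor n C R a / (2 * gc n))) with he'
  have he'0 : 0 < e' := by positivity
  have hT : 3 / (4 * R ^ 2) < 1 / R ^ 2 := by
    rw [div_lt_div_iff₀ (by positivity) (by positivity)]
    nlinarith [sq_nonneg R, pow_pos hR0 2]
  obtain ⟨w, hw, h0, hwv⟩ := hs.approx (T'' := 3 / (4 * R ^ 2)) (by positivity) hT he'0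
  have hwc := hw.continuous
  have hL := Lh_continuous hw
  have hpos : ∀ t ∈ Icc 0 (3 / (4 * R ^ 2)), 0 < t + a :=
    fun t ht => add_pos_of_nonneg_of_pos ht.1 ha
  have hg0 : ∀ s t, 0 ≤ gE n s (gsq w) t :=
    fun s t => gE_nonneg fun x => Finset.sum_nonneg fun i _ => sq_nonneg _
  have hgw : ∀ s t, 0 ≤ gE n s (fun p => w p ^ 2) t := fun s t => gE_nonneg fun x => sq_nonneg _
  have hcd : ∀ t ∈ Icc 0 (3 / (4 * R ^ 2)), HasDerivAt (fun t => hcor n C R (t + a))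
      (R ^ 2 / 16 / (t + a) * hcor n C R (t + a)) t := fun t ht =>
    (hcor_hasDerivAt (hpos t ht) hR0).comp_add_const t a
  have hP : ∀ t ∈ Icc 0 (3 / (4 * R ^ 2)), gE n (t + a) (fun p => Lh w p ^ 2) t ≤
      4 * (R ^ 4 * (gE n (t + a) (fun p => w p ^ 2) t + hcor n C R (t + a)) +
        R ^ 2 * gE n (t + a) (gsq w) t) := by
    intro t ht
    have hσ := hpos t ht
    have hiζ : Integrable fun x => ζ x ^ 2 * gk n (t + a) x := by
      refine Continuous.integrable_of_hasCompactSupport ((hs.zcont.pow 2).mul gk_continuous)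
        (HasCompactSupport.intro (isCompact_closedBall (0 : Eu n) 3) fun y hy => ?_)
      simp [hs.zsupp y hy]
    have hiw : Integrable fun x => w (x, t) ^ 2 * gk n (t + a) x :=
      gE_integrable (f := fun p => w p ^ 2) (by fun_prop) (r := 4) fun p hp => by simp [h0 p hp]
    have hig : Integrable fun x => gsq w (x, t) * gk n (t + a) x :=
      gE_integrable (gsq_contDiff hw).continuous h0.gsq
    have hik := gk_integrable (n := n) hσ
    have h1 : gE n (t + a) (fun p => Lh w p ^ 2) t ≤ ∫ x, (4 * R ^ 4 * (w (x, t) ^ 2 * gk n (t + a) x) +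
        4 * R ^ 2 * (gsq w (x, t) * gk n (t + a) x) + 4 * R ^ 2 * (ζ x ^ 2 * gk n (t + a) x) +
        4 * e' ^ 2 * gk n (t + a) x) := by
      refine integral_mono (gE_integrable (f := fun p => Lh w p ^ 2) (by fun_prop) (r := 4)
        fun p hp => by simp [h0.Lh p hp]) ((((hiw.const_mul _).add (hig.const_mul _)).add
          (hiζ.const_mul _)).add (hik.const_mul _)) fun x => ?_
      have h2 := (hwv t ht x).2.2
      set y := ‖WithLp.toLp 2 fun i => Dx i w (x, t)‖ with hy
      have h3 : y ^ 2 = gsq w (x, t) := by rw [hy, EuclideanSpace.real_norm_sq_eq]; rfl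
      have h4 : Lh w (x, t) ^ 2 ≤ (R ^ 2 * |w (x, t)| + R * y + R * ζ x + e') ^ 2 :=
        sq_le_sq' (by linarith [neg_abs_le (Lh w (x, t))]) ((le_abs_self _).trans h2)
      have h5 : (R ^ 2 * |w (x, t)| + R * y + R * ζ x + e') ^ 2 ≤
          4 * R ^ 4 * |w (x, t)| ^ 2 + 4 * R ^ 2 * y ^ 2 + 4 * R ^ 2 * ζ x ^ 2 + 4 * e' ^ 2 := by
        nlinarith [sq_nonneg (R ^ 2 * |w (x, t)| - R * y), sq_nonneg (R ^ 2 * |w (x, t)| - R * ζ x),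
          sq_nonneg (R ^ 2 * |w (x, t)| - e'), sq_nonneg (R * y - R * ζ x), sq_nonneg (R * y - e'),
          sq_nonneg (R * ζ x - e')]
      rw [sq_abs, h3] at h5
      have := mul_le_mul_of_nonneg_right (h4.trans h5) (gk_pos n (t + a) x).le
      simp only
      linarith
    rw [integral_four hiw hig hiζ hik, gk_integral hσ] at h1
    have h2 := cutoff_integral_le (R := R) hσ hR0 hs.zbdd hz
    have h3 : e' ^ 2 * gc n ≤ hcor n C R (t + a) / 2 := by
      have h4 : e' ≤ 1 := (min_le_right _ _).trans (min_le_left _ _)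
      have h5 : e' ≤ hcor n C R a / (2 * gc n) := (min_le_right _ _).trans (min_le_right _ _)
      calc e' ^ 2 * gc n ≤ e' * gc n := by gcongr; nlinarith
        _ ≤ hcor n C R a / (2 * gc n) * gc n := by gcongr
        _ = hcor n C R a / 2 := by field_simp
        _ ≤ _ := by have := hcor_mono (n := n) (C := C) ha (show a ≤ t + a by linarith [ht.1]) hR0
                    linarith
    have h6 : R ^ 2 ≤ R ^ 4 := pow_le_pow_right₀ hR (by norm_num)
    have h7 : 1 ≤ R ^ 4 := one_le_pow₀ hR
    have h8 : 0 < hcor n C R (t + a) := hcor_pos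
    have h9 : R ^ 2 * ∫ x, ζ x ^ 2 * gk n (t + a) x ≤ R ^ 4 * (hcor n C R (t + a) / 2) := by
      refine mul_le_mul h6 h2 (integral_nonneg fun x => mul_nonneg (sq_nonneg _) (gk_pos _ _ _).le)
        (by positivity)
    have h10 : hcor n C R (t + a) / 2 ≤ R ^ 4 * (hcor n C R (t + a) / 2) :=
      le_mul_of_one_le_left (by positivity) h7
    simp only [gE] at h1 ⊢
    linarith
  refine ⟨w, fun t => gE n (t + a) (fun p => w p ^ 2) t + hcor n C R (t + a),
    fun t => gE n (t + a) (gsq w) t + R ^ 2 / 16 / (2 * (t + a)) * hcor n C R (t + a),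
    fun t => 1 / 2 * gE n (t + a) (fun p => w p * Lh w p) t,
    fun t => gE n (t + a) (fun p => (OU (t + a) w p - Lh w p / 2) ^ 2) t +
      (R ^ 2 / 16 / (2 * (t + a))) ^ 2 * hcor n C R (t + a),
    fun t => gE n (t + a) (fun p => Lh w p ^ 2) t, hwc, h0, fun t ht x => ⟨(hwv t ht x).1,
      (hwv t ht x).2.1.trans (min_le_left _ _)⟩, ⟨hR0, ha, haT, ?_, ?_, ?_, ?_, ?_, ?_, ?_⟩,
    fun t => rfl⟩
  · intro t ht
    exact add_pos_of_nonneg_of_pos (hgw _ _) hcor_pos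
  · intro t ht
    have := hpos t ht
    have h8 : 0 < hcor n C R (t + a) := hcor_pos
    have := hg0 (t + a) t
    positivity
  · intro t ht
    have hσ := hpos t ht
    refine ((height_hasDerivAt hw h0 hσ).add (hcd t ht)).congr_deriv ?_
    field_simp
    ring
  · intro t ht
    have hσ := hpos t ht
    have h1 : HasDerivAt (fun t => R ^ 2 / 16 / (2 * (t + a))) (-(R ^ 2 / 16 / (2 * (t + a) ^ 2))) t := by
      have h2 : HasDerivAt (fun t => 2 * (t + a)) 2 t := by
        simpa using ((hasDerivAt_id t).add_const a).const_mul 2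
      refine ((h2.inv (by positivity)).const_mul (R ^ 2 / 16)).congr_deriv ?_
      field_simp
    refine ((energy_hasDerivAt hw h0 hσ).add (h1.mul (hcd t ht))).congr_deriv ?_
    field_simp
    ring
  · intro t ht
    have h1 := energy_add_sq_le (s := t + a) (t := t) hw h0
    have h2 : 0 < hcor n C R (t + a) := hcor_pos
    have h3 : 0 ≤ gE n (t + a) (fun p => (OU (t + a) w p - Lh w p / 2) ^ 2) t :=
      gE_nonneg fun x => sq_nonneg _
    have h4 := hgw (t + a) t
    set A := gE n (t + a) (gsq w) t + 1 / 2 * gE n (t + a) (fun p => w p * Lh w p) t with hA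
    set m := R ^ 2 / 16 / (2 * (t + a))
    set c := hcor n C R (t + a)
    set H := gE n (t + a) (fun p => w p ^ 2) t
    set X := gE n (t + a) (fun p => (OU (t + a) w p - Lh w p / 2) ^ 2) t
    have h5 : 2 * A * m ≤ H * m ^ 2 + X := by
      rcases h4.eq_or_lt with h | h
      · have : A = 0 := by
          rw [← h, zero_mul] at h1
          exact pow_eq_zero_iff two_ne_zero |>.1 (le_antisymm h1 (sq_nonneg _))
        rw [this]; nlinarith [sq_nonneg m]
      · have : H * (2 * A * m) ≤ H * (H * m ^ 2 + X) := by nlinarith [sq_nonneg (H * m - A)]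
        exact le_of_mul_le_mul_left this h
    have h6 := mul_le_mul_of_nonneg_left h5 h2.le
    have e : gE n (t + a) (gsq w) t + m * c + 1 / 2 * gE n (t + a) (fun p => w p * Lh w p) t =
      A + m * c := by rw [hA]; ring
    rw [e]
    nlinarith
  · intro t ht
    have h1 := gE_cauchy_schwarz (n := n) (s := t + a) (t := t) hwc h0 hL h0.Lh
    have h2 : 0 < hcor n C R (t + a) := hcor_pos
    have h3 : 0 ≤ gE n (t + a) (fun p => Lh w p ^ 2) t := gE_nonneg fun x => sq_nonneg _
    have := mul_nonneg h2.le h3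
    rw [mul_pow]
    linarith
  · intro t ht
    have := hpos t ht
    have h8 : 0 < hcor n C R (t + a) := hcor_pos
    have h9 : 0 ≤ R ^ 2 * (R ^ 2 / 16 / (2 * (t + a)) * hcor n C R (t + a)) := by positivity
    have := hP t ht
    linarith

/-- Gaussian height of a function at scale `s`. -/
noncomputable def gh (n : ℕ) (v : Eu n → ℝ → ℝ) (s t : ℝ) : ℝ := ∫ x, v x t ^ 2 * gk n s x

section limit
variable {n : ℕ} {T L R C a : ℝ} {ζ : Eu n → ℝ} {v : Eu n → ℝ → ℝ}
    {v1 v2 : Fin n → Eu n → ℝ → ℝ} {vt : Eu n → ℝ → ℝ}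

theorem IsSol.slice_continuous (hs : IsSol n T L R C ζ v v1 v2 vt) {t : ℝ} (ht : t ∈ Icc 0 T) :
    Continuous fun x => v x t := by
  refine (LipschitzWith.of_dist_le_mul (K := ⟨L, hs.L0⟩) fun x y => ?_).continuous
  rw [Real.dist_eq, dist_eq_norm]
  exact hs.lip t ht x y

theorem IsSol.gh_integrable (hs : IsSol n T L R C ζ v v1 v2 vt) {t : ℝ} (ht : t ∈ Icc 0 T) (s : ℝ) :
    Integrable fun x => v x t ^ 2 * gk n s x := by
  refine Continuous.integrable_of_hasCompactSupport (((hs.slice_continuous ht).pow 2).mul gk_continuous)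
    (HasCompactSupport.intro (isCompact_closedBall (0 : Eu n) 3) fun y hy => ?_)
  simp [hs.supp t ht y hy]

theorem gh_nonneg {s t : ℝ} : 0 ≤ gh n v s t :=
  integral_nonneg fun _ => mul_nonneg (sq_nonneg _) (gk_pos _ _ _).le

theorem IsSol.gh_le (hs : IsSol n T L R C ζ v v1 v2 vt) {s t : ℝ} (ht : t ∈ Icc 0 T) (h0 : 0 < s) :
    gh n v s t ≤ gc n := by
  rw [← gk_integral (n := n) h0]
  refine integral_mono (hs.gh_integrable ht s) (gk_integrable h0) fun x => ?_
  have h1 := hs.bdd t ht x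
  have h2 : v x t ^ 2 ≤ 1 := by rw [← sq_abs]; exact pow_le_one₀ (abs_nonneg _) h1
  exact mul_le_of_le_one_left (gk_pos _ _ _).le h2

theorem IsSol.abs_gE_sub_gh_le (hs : IsSol n T L R C ζ v v1 v2 vt) {s t e : ℝ} (ht : t ∈ Icc 0 T)
    (h0 : 0 < s) {w : Eu n × ℝ → ℝ} (hw : Continuous w) (hv : Van 4 w)
    (h : ∀ x, |w (x, t)| ≤ 1 ∧ |w (x, t) - v x t| ≤ e) :
    |gE n s (fun p => w p ^ 2) t - gh n v s t| ≤ 2 * e * gc n := by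
  rw [gE, gh, ← integral_sub (gE_integrable (f := fun p => w p ^ 2) (r := 4) (by fun_prop)
    fun p hp => by simp [hv p hp]) (hs.gh_integrable ht s), ← Real.norm_eq_abs,
    ← gk_integral (n := n) h0, ← integral_const_mul]
  refine norm_integral_le_of_norm_le ((gk_integrable h0).const_mul _)
    (Filter.Eventually.of_forall fun x => ?_)
  have hg := gk_pos n s x
  rw [← sub_mul, norm_mul, Real.norm_eq_abs, Real.norm_eq_abs, abs_of_pos hg]
  gcongr
  obtain ⟨h1, h2⟩ := h x
  have h3 := hs.bdd t ht x
  rw [sq_sub_sq, abs_mul]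
  calc _ ≤ (1 + 1) * e := by
        gcongr
        exact (abs_add_le _ _).trans (add_le_add h1 h3)
    _ = 2 * e := by ring

/-- Height bounds for cut-off solutions. -/
theorem IsSol.height_bounds (hs : IsSol n (1 / R ^ 2) L R C ζ v v1 v2 vt) (hR : 1 ≤ R)
    (hz : ∀ x, ‖x‖ < 2 → ζ x = 0) (ha : 0 < a) (haT : a ≤ 1 / R ^ 2) {H : ℝ → ℝ}
    (hH : H = fun t => gh n v (t + a) t + hcor n C R (t + a)) :
    Real.exp (-2) * H 0 ≤ H (1 / (4 * R ^ 2)) ∧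
    0 ≤ 4 * Real.log (H (3 / (4 * R ^ 2)) / H (1 / (4 * R ^ 2))) + 11 ∧
    Real.log (H (1 / (4 * R ^ 2))) - 2 - 3 * (Real.exp 4 *
      (4 * Real.log (H (3 / (4 * R ^ 2)) / H (1 / (4 * R ^ 2))) + 11)) * Real.log (2 / (a * R ^ 2)) ≤
      Real.log (H 0) := by
  have hR0 : 0 < R := by linarith
  have hex : ∀ k : ℕ, ∃ K : ℝ → ℝ, (∀ t ∈ Icc 0 (3 / (4 * R ^ 2)),
      |K t - H t| ≤ 2 * gc n * (1 / ((k : ℝ) + 1))) ∧ (Real.exp (-2) * K 0 ≤ K (1 / (4 * R ^ 2)) ∧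
    0 ≤ 4 * Real.log (K (3 / (4 * R ^ 2)) / K (1 / (4 * R ^ 2))) + 11 ∧
    Real.log (K (1 / (4 * R ^ 2))) - 2 - 3 * (Real.exp 4 *
      (4 * Real.log (K (3 / (4 * R ^ 2)) / K (1 / (4 * R ^ 2))) + 11)) * Real.log (2 / (a * R ^ 2)) ≤
      Real.log (K 0)) := by
    intro k
    obtain ⟨w, K, D, b, X, P, hwc, hwv, hw, hf, hK⟩ :=
      hs.exists_freqSystem hR hz ha haT (show 0 < 1 / ((k : ℝ) + 1) by positivity)
    refine ⟨K, fun t ht => ?_, hf.height_decay, hf.log_height_ge⟩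
    have ht' : t ∈ Icc 0 (1 / R ^ 2) := by
      refine ⟨ht.1, ht.2.trans ?_⟩
      rw [div_le_div_iff₀ (by positivity) (by positivity)]
      nlinarith [pow_pos hR0 2]
    have := hs.abs_gE_sub_gh_le ht' (add_pos_of_nonneg_of_pos ht.1 ha) hwc hwv (hw t ht)
    rw [hK, hH]
    simp only [add_sub_add_right_eq_sub]
    linarith
  choose K hKd hKb using hex
  have hlim : ∀ t ∈ Icc 0 (3 / (4 * R ^ 2)),
      Filter.Tendsto (fun k => K k t) Filter.atTop (nhds (H t)) := fun t ht => by
    rw [tendsto_iff_dist_tendsto_zero]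
    refine squeeze_zero (fun _ => dist_nonneg) (fun k => hKd k t ht) ?_
    simpa using (tendsto_one_div_add_atTop_nhds_zero_nat (𝕜 := ℝ)).const_mul (2 * gc n)
  have hpos : ∀ t, H t ≠ 0 := fun t => by
    rw [hH]
    exact (add_pos_of_nonneg_of_pos gh_nonneg hcor_pos).ne'
  have l0 := hlim 0 ⟨le_rfl, by positivity⟩
  have l1 := hlim (1 / (4 * R ^ 2)) ⟨by positivity, by gcongr; norm_num⟩
  have l3 := hlim (3 / (4 * R ^ 2)) ⟨by positivity, le_rfl⟩
  have ll : Filter.Tendsto (fun k => 4 * Real.log (K k (3 / (4 * R ^ 2)) / K k (1 / (4 * R ^ 2))) + 11)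
      Filter.atTop (nhds (4 * Real.log (H (3 / (4 * R ^ 2)) / H (1 / (4 * R ^ 2))) + 11)) :=
    (((l3.div l1 (hpos _)).log (div_ne_zero (hpos _) (hpos _))).const_mul 4).add_const 11
  refine ⟨le_of_tendsto_of_tendsto' (l0.const_mul _) l1 fun k => (hKb k).1,
    ge_of_tendsto' ll fun k => (hKb k).2.1,
    le_of_tendsto_of_tendsto' (((l1.log (hpos _)).sub_const 2).sub
      (((ll.const_mul (Real.exp 4)).const_mul 3).mul_const _)) (l0.log (hpos _))
      fun k => (hKb k).2.2⟩

end limit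

theorem eventually_le_mul_sq (c : ℝ) {α : ℝ} (hα : 0 < α) :
    ∀ᶠ R : ℝ in Filter.atTop, c ≤ α * R ^ 2 :=
  ((Filter.tendsto_pow_atTop two_ne_zero).const_mul_atTop hα).eventually_ge_atTop c

section lower
variable {n : ℕ} {L R C a : ℝ} {ζ : Eu n → ℝ} {v : Eu n → ℝ → ℝ}
    {v1 v2 : Fin n → Eu n → ℝ → ℝ} {vt : Eu n → ℝ → ℝ}

theorem gk_le_of_le {s s' β : ℝ} (hs : 0 < s) (hss : s ≤ s') {x : Eu n}
    (hx : ‖x‖ ^ 2 / (4 * s) ≤ β) : gk n s' x ≤ Real.exp β * gk n s x := by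
  rw [gk, gk, ← Real.exp_add]
  refine Real.exp_le_exp.2 ?_
  have h1 := Real.log_le_log hs hss
  have h2 : (n : ℝ) / 2 * Real.log s ≤ (n : ℝ) / 2 * Real.log s' := by gcongr
  have h3 : 0 ≤ ‖x‖ ^ 2 / (4 * s') := by have := hs.trans_le hss; positivity
  linarith

/-- Comparing heights at different scales. -/
theorem IsSol.gh_scale_le {T s s' δ t : ℝ} (hv : IsSol n T L R C ζ v v1 v2 vt) (ht : t ∈ Icc 0 T)
    (hs : 0 < s) (hss : s ≤ s') :
    gh n v s' t ≤ Real.exp (δ / (4 * s)) * gh n v s t +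
      Real.exp ((n : ℝ) / 2 * Real.log 2) * gc n * Real.exp (-(δ / (8 * s'))) := by
  have hs' := hs.trans_le hss
  have h1 : gh n v s' t ≤ ∫ x, (Real.exp (δ / (4 * s)) * (v x t ^ 2 * gk n s x) +
      Real.exp ((n : ℝ) / 2 * Real.log 2) * Real.exp (-(δ / (8 * s'))) * gk n (2 * s') x) := by
    refine integral_mono (hv.gh_integrable ht s') (((hv.gh_integrable ht s).const_mul _).add
      ((gk_integrable (by positivity)).const_mul _)) fun x => ?_
    have hg := gk_pos n (2 * s') x
    have hg' := gk_pos n s x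
    have h2 : v x t ^ 2 ≤ 1 := by
      rw [← sq_abs]; exact pow_le_one₀ (abs_nonneg _) (hv.bdd t ht x)
    rcases le_total (‖x‖ ^ 2) δ with hx | hx
    · have h3 : gk n s' x ≤ Real.exp (δ / (4 * s)) * gk n s x :=
        gk_le_of_le hs hss (by gcongr)
      have h4 : v x t ^ 2 * gk n s' x ≤ v x t ^ 2 * (Real.exp (δ / (4 * s)) * gk n s x) := by gcongr
      have : 0 ≤ Real.exp ((n : ℝ) / 2 * Real.log 2) * Real.exp (-(δ / (8 * s'))) *
        gk n (2 * s') x := by positivity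
      simp only
      linarith
    · have h3 : v x t ^ 2 * gk n s' x ≤ gk n s' x :=
        mul_le_of_le_one_left (gk_pos n s' x).le h2
      have h4 : gk n s' x ≤ Real.exp ((n : ℝ) / 2 * Real.log 2) * Real.exp (-(δ / (8 * s'))) *
          gk n (2 * s') x := by rw [gk_two hs']; gcongr
      have : 0 ≤ Real.exp (δ / (4 * s)) * (v x t ^ 2 * gk n s x) := by positivity
      simp only
      linarith
  rw [integral_add ((hv.gh_integrable ht s).const_mul _)
    ((gk_integrable (by positivity)).const_mul _), integral_const_mul, integral_const_mul,
    gk_integral (by positivity)] at h1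
  rw [gh, gh]
  rw [gh] at h1
  linarith

/-- Initial height at the natural scale. -/
theorem IsSol.initial_height_ge {T θ ρ : ℝ} (hv : IsSol n T L R C ζ v v1 v2 vt) (hT : 0 ≤ T)
    (hR : 0 < R)
    (h : θ ^ 2 * R ^ (-(n : ℝ)) ≤ ∫ x in ball (0 : Eu n) ρ, v x 0 ^ 2) :
    θ ^ 2 * Real.exp (-(ρ ^ 2 * R ^ 2 / 4)) ≤ gh n v (1 / R ^ 2) 0 := by
  have ht : (0 : ℝ) ∈ Icc 0 T := ⟨le_rfl, hT⟩
  have hi := hv.gh_integrable ht (1 / R ^ 2)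
  have h1 : ∫ x in ball (0 : Eu n) ρ, v x 0 ^ 2 * (R ^ (n : ℝ) * Real.exp (-(ρ ^ 2 * R ^ 2 / 4))) ≤
      ∫ x in ball (0 : Eu n) ρ, v x 0 ^ 2 * gk n (1 / R ^ 2) x := by
    have hi2 : Integrable fun x => v x 0 ^ 2 :=
      Continuous.integrable_of_hasCompactSupport ((hv.slice_continuous ht).pow 2)
        (HasCompactSupport.intro (isCompact_closedBall (0 : Eu n) 3) fun y hy => by
          simp [hv.supp 0 ht y hy])
    refine setIntegral_mono_on (hi2.mul_const _).integrableOn hi.integrableOn measurableSet_ball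
      fun x hx => ?_
    refine mul_le_mul_of_nonneg_left ?_ (sq_nonneg _)
    rw [gk, Real.rpow_def_of_pos hR, ← Real.exp_add, Real.exp_le_exp, one_div, Real.log_inv,
      Real.log_pow]
    have h2 : ‖x‖ < ρ := by simpa using hx
    have h3 : ‖x‖ ^ 2 / (4 * (R ^ 2)⁻¹) = ‖x‖ ^ 2 * R ^ 2 / 4 := by field_simp
    rw [h3]
    have h4 : ‖x‖ ^ 2 * R ^ 2 / 4 ≤ ρ ^ 2 * R ^ 2 / 4 := by gcongr
    push_cast
    linarith
  have h2 : ∫ x in ball (0 : Eu n) ρ, v x 0 ^ 2 * gk n (1 / R ^ 2) x ≤ gh n v (1 / R ^ 2) 0 :=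
    setIntegral_le_integral hi (Filter.Eventually.of_forall fun x =>
      mul_nonneg (sq_nonneg _) (gk_pos _ _ _).le)
  refine le_trans ?_ (h1.trans h2)
  rw [integral_mul_const]
  have h3 : R ^ (-(n : ℝ)) * R ^ (n : ℝ) = 1 := by rw [← Real.rpow_add hR]; simp
  calc θ ^ 2 * Real.exp (-(ρ ^ 2 * R ^ 2 / 4)) =
      θ ^ 2 * R ^ (-(n : ℝ)) * (R ^ (n : ℝ) * Real.exp (-(ρ ^ 2 * R ^ 2 / 4))) := by
        linear_combination (-(θ ^ 2 * Real.exp (-(ρ ^ 2 * R ^ 2 / 4)))) * h3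
    _ ≤ _ := by gcongr

end lower

set_option maxHeartbeats 1000000 in
/-- Quantitative lower bound of the height at small scales. -/
theorem exists_height_ge (n : ℕ) {θ : ℝ} (hθ : 0 < θ) (C : ℝ) : ∃ N ≥ (1 : ℝ), ∀ R ≥ N,
    ∀ (L : ℝ) (ζ : Eu n → ℝ) (v : Eu n → ℝ → ℝ) (v1 v2 : Fin n → Eu n → ℝ → ℝ) (vt : Eu n → ℝ → ℝ),
    IsSol n (1 / R ^ 2) L R C ζ v v1 v2 vt → (∀ x, ‖x‖ < 2 → ζ x = 0) →
    θ ^ 2 * R ^ (-(n : ℝ)) ≤ ∫ x in ball (0 : Eu n) (1 / 1000), v x 0 ^ 2 →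
    ∀ a, 0 < a → a ≤ 1 / R ^ 2 →
    Real.exp (-(R ^ 2 * (1 + Real.log (2 / (a * R ^ 2))))) ≤ gh n v a 0 := by
  have hgc := gc_pos n
  have hh := hcst_pos (n := n) (C := C)
  set E := Real.exp ((n : ℝ) / 2 * Real.log 2) * gc n with hE
  have hE0 : 0 < E := by positivity
  set c1 := gc n + hcst n C with hc1
  set c3 := Real.exp (-2) * θ ^ 2 / 2 with hc3
  have hc30 : 0 < c3 := by positivity
  have hc10 : 0 < c1 := by positivity
  have hev := ((((eventually_le_mul_sq (Real.log ((E + hcst n C) / c3))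
    (show (0 : ℝ) < 1 / 2000000 by norm_num)).and
    (eventually_le_mul_sq (3 * 81 * (4 * |Real.log (c1 / c3)| + 11))
      (show (0 : ℝ) < 1 / 32 by norm_num))).and
    (eventually_le_mul_sq (Real.log (hcst n C / (Real.exp (-2) * c3 / 2)))
      (show (0 : ℝ) < 1 / 32 by norm_num))).and
    (eventually_le_mul_sq (-Real.log (Real.exp (-2) * c3 / 2))
      (show (0 : ℝ) < 1 / 2 by norm_num))).and (Filter.eventually_ge_atTop (1 : ℝ))
  obtain ⟨N, hN⟩ := Filter.eventually_atTop.1 hev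
  refine ⟨max 1 N, le_max_left _ _, fun R hRN L ζ v v1 v2 vt hs hz hv a ha haT => ?_⟩
  obtain ⟨⟨⟨⟨e1, e2⟩, e3⟩, e4⟩, hR⟩ := hN R ((le_max_right _ _).trans hRN)
  have hR0 : 0 < R := by linarith
  set q := 1 / (4 * R ^ 2) with hq
  have hq0 : 0 < q := by positivity
  have h3q : 3 / (4 * R ^ 2) = 3 * q := by rw [hq]; field_simp
  have h4q : 1 / R ^ 2 = 4 * q := by rw [hq]; field_simp
  have hRq : R ^ 2 * q = 1 / 4 := by rw [hq]; field_simp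
  have haR : a * R ^ 2 ≤ 1 := by
    calc a * R ^ 2 ≤ 1 / R ^ 2 * R ^ 2 := by gcongr
      _ = 1 := by field_simp
  -- the height at time `q`, uniformly in the scale
  obtain ⟨hb, -⟩ := hs.height_bounds hR hz (by positivity) (le_refl (1 / R ^ 2)) rfl
  have hi := hs.initial_height_ge (by positivity) hR0 hv
  simp only [zero_add, ← hq] at hb
  rw [h4q] at hb hi
  have hmq : q ∈ Icc 0 (1 / R ^ 2) := ⟨hq0.le, by linarith⟩
  have hm3q : 3 * q ∈ Icc 0 (1 / R ^ 2) := ⟨by linarith, by linarith⟩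
  have hsc := hs.gh_scale_le (δ := 1 / 100000) hmq (show 0 < q + a by linarith)
    (show q + a ≤ q + 4 * q by linarith)
  have hexp1 : Real.exp (1 / 100000 / (4 * (q + a))) ≤ Real.exp (R ^ 2 / 100000) := by
    refine Real.exp_le_exp.2 ?_
    rw [div_le_iff₀ (by positivity)]
    have : 0 ≤ R ^ 2 * a := by positivity
    linarith
  have hexp2 : Real.exp (-(1 / 100000 / (8 * (q + 4 * q)))) = Real.exp (-(R ^ 2 / 1000000)) := by
    congr 2
    rw [hq]; field_simp; norm_num
  have hcq : hcor n C R (q + 4 * q) ≤ hcst n C * Real.exp (-(R ^ 2 / 16)) :=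
    hcor_le (by positivity) (by linarith) hR0
  have hG : c3 * Real.exp (-(R ^ 2 / 50000)) ≤ gh n v (q + a) q := by
    have hg0 : 0 ≤ gh n v (q + a) q := gh_nonneg
    have hcp : 0 < hcor n C R (4 * q) := hcor_pos
    have h1 : Real.exp (-2) * gh n v (4 * q) 0 ≤ gh n v (q + 4 * q) q + hcor n C R (q + 4 * q) :=
      le_trans (by have := Real.exp_pos (-2); gcongr; linarith) hb
    have h2 : 2 * c3 * Real.exp (-(R ^ 2 / 2000000)) ≤ Real.exp (-2) * gh n v (4 * q) 0 := by
      calc 2 * c3 * Real.exp (-(R ^ 2 / 2000000)) ≤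
          2 * c3 * Real.exp (-((1 / 1000) ^ 2 * R ^ 2 / 4)) := by
            refine mul_le_mul_of_nonneg_left (Real.exp_le_exp.2 ?_) (by positivity)
            have := sq_nonneg R
            linarith
        _ = Real.exp (-2) * (θ ^ 2 * Real.exp (-((1 / 1000) ^ 2 * R ^ 2 / 4))) := by rw [hc3]; ring
        _ ≤ _ := by gcongr
    have h3 : Real.exp (1 / 100000 / (4 * (q + a))) * gh n v (q + a) q ≤
        Real.exp (R ^ 2 / 100000) * gh n v (q + a) q := by gcongr
    have h4 : hcst n C * Real.exp (-(R ^ 2 / 16)) ≤ hcst n C * Real.exp (-(R ^ 2 / 1000000)) := by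
      refine mul_le_mul_of_nonneg_left (Real.exp_le_exp.2 ?_) hh.le
      have := sq_nonneg R
      linarith
    have h5 : (E + hcst n C) * Real.exp (-(R ^ 2 / 1000000)) ≤
        c3 * Real.exp (-(R ^ 2 / 2000000)) := by
      rw [Real.log_le_iff_le_exp (by positivity), div_le_iff₀ hc30] at e1
      calc _ ≤ Real.exp (1 / 2000000 * R ^ 2) * c3 * Real.exp (-(R ^ 2 / 1000000)) := by gcongr
        _ = c3 * (Real.exp (1 / 2000000 * R ^ 2) * Real.exp (-(R ^ 2 / 1000000))) := by ring
        _ = _ := by rw [← Real.exp_add]; congr 2; ring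
    rw [hexp2] at hsc
    have h6 : c3 * Real.exp (-(R ^ 2 / 2000000)) ≤ Real.exp (R ^ 2 / 100000) * gh n v (q + a) q := by
      linarith
    calc c3 * Real.exp (-(R ^ 2 / 50000)) ≤
        c3 * (Real.exp (-(R ^ 2 / 100000)) * Real.exp (-(R ^ 2 / 2000000))) := by
          rw [← Real.exp_add]
          refine mul_le_mul_of_nonneg_left (Real.exp_le_exp.2 ?_) hc30.le
          have := sq_nonneg R
          linarith
      _ = Real.exp (-(R ^ 2 / 100000)) * (c3 * Real.exp (-(R ^ 2 / 2000000))) := by ring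
      _ ≤ Real.exp (-(R ^ 2 / 100000)) * (Real.exp (R ^ 2 / 100000) * gh n v (q + a) q) := by gcongr
      _ = gh n v (q + a) q := by rw [← mul_assoc, ← Real.exp_add]; simp
  obtain ⟨-, hK0, hlow⟩ := hs.height_bounds hR hz ha haT rfl
  simp only [zero_add, ← hq, h3q] at hK0 hlow
  set Hq := gh n v (q + a) q + hcor n C R (q + a) with hHq
  set H3 := gh n v (3 * q + a) (3 * q) + hcor n C R (3 * q + a) with hH3
  have hHq1 : c3 * Real.exp (-(R ^ 2 / 50000)) ≤ Hq := by
    have : 0 < hcor n C R (q + a) := hcor_pos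
    linarith
  have hHq0 : 0 < Hq := lt_of_lt_of_le (by positivity) hHq1
  have hH31 : H3 ≤ c1 := by
    have h1 := hs.gh_le hm3q (show 0 < 3 * q + a by linarith)
    have h2 := hcor_le (n := n) (C := C) (show 0 < 3 * q + a by linarith)
      (show (3 * q + a) * R ^ 2 ≤ 2 by linarith) hR0
    have h3 : hcst n C * Real.exp (-(R ^ 2 / 16)) ≤ hcst n C :=
      mul_le_of_le_one_right hh.le (Real.exp_le_one_iff.2 (by have := sq_nonneg R; linarith))
    linarith
  have hH30 : 0 < H3 := add_pos_of_nonneg_of_pos gh_nonneg hcor_pos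
  have hlogq : Real.log c3 - R ^ 2 / 50000 ≤ Real.log Hq := by
    have := Real.log_le_log (by positivity) hHq1
    rw [Real.log_mul hc30.ne' (Real.exp_pos _).ne', Real.log_exp] at this
    linarith
  have hΛ : Real.log (H3 / Hq) ≤ |Real.log (c1 / c3)| + R ^ 2 / 50000 := by
    rw [Real.log_div hH30.ne' hHq0.ne']
    have h1 := Real.log_le_log hH30 hH31
    have h2 := le_abs_self (Real.log (c1 / c3))
    rw [Real.log_div hc10.ne' hc30.ne'] at h2 ⊢
    linarith
  have hexp4 : Real.exp 4 ≤ 81 := by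
    have : Real.exp 4 = Real.exp 1 ^ 4 := by rw [← Real.exp_nat_mul]; norm_num
    rw [this]
    calc Real.exp 1 ^ 4 ≤ 3 ^ 4 := by
          gcongr
          exact Real.exp_one_lt_d9.le.trans (by norm_num)
      _ = 81 := by norm_num
  have hK : 3 * (Real.exp 4 * (4 * Real.log (H3 / Hq) + 11)) ≤ R ^ 2 / 16 := by
    have h1 : Real.exp 4 * (4 * Real.log (H3 / Hq) + 11) ≤
        81 * (4 * (|Real.log (c1 / c3)| + R ^ 2 / 50000) + 11) := by
      gcongr
    have := sq_nonneg R
    linarith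
  set l := Real.log (2 / (a * R ^ 2)) with hl
  have hl0 : 0 ≤ l := Real.log_nonneg (by rw [le_div_iff₀ (by positivity)]; linarith)
  have hKl := mul_le_mul_of_nonneg_right hK hl0
  set H0 := gh n v a 0 + hcor n C R a with hH0
  have hH00 : 0 < H0 := add_pos_of_nonneg_of_pos gh_nonneg hcor_pos
  have hH0l : Real.exp (-2) * c3 * Real.exp (-(R ^ 2 / 50000)) * Real.exp (-(R ^ 2 / 16 * l)) ≤ H0 := by
    rw [← Real.log_le_log_iff (by positivity) hH00, Real.log_mul (by positivity) (by positivity),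
      Real.log_mul (by positivity) (by positivity), Real.log_mul (by positivity) (by positivity),
      Real.log_exp, Real.log_exp, Real.log_exp]
    linarith
  have hcora : hcor n C R a = hcst n C * Real.exp (-(R ^ 2 / 16)) * Real.exp (-(R ^ 2 / 16 * l)) := by
    rw [hcor, hl, Real.log_div (by positivity) (by positivity),
      Real.log_div (by positivity) (by positivity)]
    congr 2; ring
  have hc4 : hcst n C * Real.exp (-(R ^ 2 / 16)) ≤
      Real.exp (-2) * c3 / 2 * Real.exp (-(R ^ 2 / 50000)) := by
    rw [Real.log_le_iff_le_exp (by positivity), div_le_iff₀ (by positivity)] at e3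
    calc _ ≤ Real.exp (1 / 32 * R ^ 2) * (Real.exp (-2) * c3 / 2) * Real.exp (-(R ^ 2 / 16)) := by
          gcongr
      _ = Real.exp (-2) * c3 / 2 * Real.exp (1 / 32 * R ^ 2 + -(R ^ 2 / 16)) := by
          rw [Real.exp_add]; ring
      _ ≤ _ := by
          refine mul_le_mul_of_nonneg_left (Real.exp_le_exp.2 ?_) (by positivity)
          have := sq_nonneg R
          linarith
  have hfin : Real.exp (-2) * c3 / 2 * Real.exp (-(R ^ 2 / 50000)) * Real.exp (-(R ^ 2 / 16 * l)) ≤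
      gh n v a 0 := by
    have := mul_le_mul_of_nonneg_right hc4 (Real.exp_pos (-(R ^ 2 / 16 * l))).le
    rw [← hcora] at this
    linarith
  refine le_trans ?_ hfin
  have h7 : Real.exp (-(1 / 2 * R ^ 2)) ≤ Real.exp (-2) * c3 / 2 := by
    rw [← Real.le_log_iff_exp_le (by positivity)]
    linarith
  calc Real.exp (-(R ^ 2 * (1 + l))) ≤
      Real.exp (-(1 / 2 * R ^ 2) + -(R ^ 2 / 50000) + -(R ^ 2 / 16 * l)) := by
        refine Real.exp_le_exp.2 ?_
        have := sq_nonneg R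
        have : 0 ≤ R ^ 2 * l := by positivity
        linarith
    _ = Real.exp (-(1 / 2 * R ^ 2)) * Real.exp (-(R ^ 2 / 50000)) * Real.exp (-(R ^ 2 / 16 * l)) := by
        rw [Real.exp_add, Real.exp_add]
    _ ≤ _ := by gcongr

/-- A smooth cutoff function, equal to `1` on `B₂` and to `0` off `B₃`. -/
structure IsCutoff {n : ℕ} (χ : Eu n → ℝ) : Prop where
  smooth : ContDiff ℝ 2 χ
  mem : ∀ x, χ x ∈ Icc (0 : ℝ) 1
  one : ∀ x, ‖x‖ < 2 → χ x = 1
  zero : ∀ x ∉ closedBall (0 : Eu n) 3, χ x = 0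

theorem exists_isCutoff (n : ℕ) : ∃ χ : Eu n → ℝ, IsCutoff χ := by
  let f : ContDiffBump (0 : Eu n) := ⟨2, 3, by norm_num, by norm_num⟩
  refine ⟨f, f.contDiff, fun x => ⟨f.nonneg, f.le_one⟩, fun x hx => ?_, fun x hx => ?_⟩
  · exact f.one_of_mem_closedBall (by simpa [f] using hx.le)
  · refine f.zero_of_le_dist ?_
    rw [mem_closedBall, not_le] at hx
    exact hx.le

/-- The size of the error terms created by a cutoff function. -/
noncomputable def cutErr {n : ℕ} (χ : Eu n → ℝ) (x : Eu n) : ℝ :=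
  3 * ‖gradient χ x‖ + |slap χ x|

theorem norm_gradient {n : ℕ} (f : Eu n → ℝ) (x : Eu n) : ‖gradient f x‖ = ‖fderiv ℝ f x‖ := by
  rw [gradient, LinearIsometryEquiv.norm_map]

theorem gradient_eq_toLp {n : ℕ} (f : Eu n → ℝ) (x : Eu n) :
    gradient f x = WithLp.toLp 2 fun i => fderiv ℝ f x (ev i) := by
  ext i
  have h : inner ℝ (gradient f x) (ev i) = fderiv ℝ f x (ev i) := by
    rw [gradient, InnerProductSpace.toDual_symm_apply]
  change gradient f x i = fderiv ℝ f x (ev i)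
  rw [← h, EuclideanSpace.inner_single_right]
  simp only [one_mul, conj_trivial]

/-- Product rule for a function differentiable on `B₄` times one vanishing off `B₃`. -/
theorem hasFDerivAt_mul_of_zero {n : ℕ} {g f : Eu n → ℝ} (hg : Differentiable ℝ g)
    (h0 : ∀ x ∉ closedBall (0 : Eu n) 3, g x = 0)
    (hf : ∀ x ∈ ball (0 : Eu n) 4, DifferentiableAt ℝ f x) (x : Eu n) :
    HasFDerivAt (fun y => g y * f y) (g x • fderiv ℝ f x + f x • fderiv ℝ g x) x := by
  by_cases hx : x ∈ closedBall (0 : Eu n) 3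
  · exact (hg x).hasFDerivAt.mul (hf x (closedBall_subset_ball (by norm_num) hx)).hasFDerivAt
  · have hev : g =ᶠ[nhds x] fun _ => 0 := by
      filter_upwards [isClosed_closedBall.isOpen_compl.mem_nhds hx] with y hy using h0 y hy
    have h1 : fderiv ℝ g x = 0 := by rw [hev.fderiv_eq]; simp
    rw [h0 x hx, h1, zero_smul, smul_zero, add_zero]
    refine (hasFDerivAt_const (0 : ℝ) x).congr_of_eventuallyEq ?_
    filter_upwards [hev] with y hy
    simp [hy]

namespace IsCutoff
variable {n : ℕ} {χ : Eu n → ℝ}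

theorem fderiv_zero (hχ : IsCutoff χ) (x : Eu n) (hx : x ∉ closedBall (0 : Eu n) 3) :
    fderiv ℝ χ x = 0 := by
  have hev : χ =ᶠ[nhds x] fun _ => 0 := by
    filter_upwards [isClosed_closedBall.isOpen_compl.mem_nhds hx] with y hy using hχ.zero y hy
  rw [hev.fderiv_eq]; simp

theorem pd_contDiff (hχ : IsCutoff χ) (i : Fin n) :
    ContDiff ℝ 1 fun x => fderiv ℝ χ x (ev i) :=
  (hχ.smooth.fderiv_right (m := 1) (by norm_num)).clm_apply contDiff_const

theorem cutErr_continuous (hχ : IsCutoff χ) : Continuous (cutErr χ) := by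
  unfold cutErr slap
  simp_rw [norm_gradient]
  have h1 : Continuous (fderiv ℝ χ) := hχ.smooth.continuous_fderiv (by norm_num)
  have h2 : ∀ i : Fin n, Continuous (fderiv ℝ fun y => fderiv ℝ χ y (ev i)) := fun i =>
    (hχ.pd_contDiff i).continuous_fderiv (by norm_num)
  have h3 : Continuous fun x => ∑ i : Fin n, fderiv ℝ (fun y => fderiv ℝ χ y (ev i)) x (ev i) :=
    continuous_finsetSum _ fun i _ => (h2 i).clm_apply continuous_const
  exact (h1.norm.const_mul 3).add h3.abs

theorem cutErr_eq_zero {χ : Eu n → ℝ} {x : Eu n} {c : ℝ} (h : χ =ᶠ[nhds x] fun _ => c) :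
    cutErr χ x = 0 := by
  have h1 : fderiv ℝ χ x = 0 := by rw [h.fderiv_eq]; simp
  have h2 : ∀ i : Fin n, fderiv ℝ (fun y => fderiv ℝ χ y (ev i)) x = 0 := fun i => by
    have : (fun y => fderiv ℝ χ y (ev i)) =ᶠ[nhds x] fun _ => 0 := by
      filter_upwards [h.fderiv (𝕜 := ℝ)] with y hy
      simp [hy]
    rw [this.fderiv_eq]; simp
  simp [cutErr, slap, norm_gradient, h1, h2]

theorem cutErr_zero_of_lt (hχ : IsCutoff χ) (x : Eu n) (hx : ‖x‖ < 2) : cutErr χ x = 0 := by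
  refine cutErr_eq_zero (c := 1) ?_
  filter_upwards [isOpen_ball.mem_nhds (show x ∈ ball (0 : Eu n) 2 by simpa using hx)] with y hy
  exact hχ.one y (by simpa using hy)

theorem cutErr_zero (hχ : IsCutoff χ) (x : Eu n) (hx : x ∉ closedBall (0 : Eu n) 3) :
    cutErr χ x = 0 := by
  refine cutErr_eq_zero (c := 0) ?_
  filter_upwards [isClosed_closedBall.isOpen_compl.mem_nhds hx] with y hy using hχ.zero y hy

theorem cutErr_nonneg (x : Eu n) : 0 ≤ cutErr χ x := by unfold cutErr; positivity

theorem exists_cutErr_le (hχ : IsCutoff χ) : ∃ C, ∀ x, cutErr χ x ≤ C := by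
  obtain ⟨C, hC⟩ := hχ.cutErr_continuous.bounded_above_of_compact_support
    (HasCompactSupport.intro (isCompact_closedBall (0 : Eu n) 3) hχ.cutErr_zero)
  exact ⟨C, fun x => (le_abs_self _).trans (hC x)⟩

/-- Cutting off a solution on `B₄` gives a compactly supported almost solution. -/
theorem isSol (hχ : IsCutoff χ) {C R T : ℝ} (hC : ∀ x, cutErr χ x ≤ C) (hR : 1 ≤ R)
    {u : Eu n → ℝ → ℝ}
    (hu : ∀ t ∈ Icc (0 : ℝ) T, ContDiffOn ℝ 2 (fun x => u x t) (ball (0 : Eu n) 4))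
    (hut : ∀ x ∈ ball (0 : Eu n) 4, ContDiffOn ℝ 1 (u x) (Icc (0 : ℝ) T))
    (heq : ∀ x ∈ ball (0 : Eu n) 4, ∀ t ∈ Icc (0 : ℝ) T,
      |slap (fun y => u y t) x + derivWithin (u x) (Icc (0 : ℝ) T) t| ≤
        R ^ 2 * |u x t| + R * ‖gradient (fun y => u y t) x‖)
    (hb : ∀ x ∈ ball (0 : Eu n) 4, ∀ t ∈ Icc (0 : ℝ) T, |u x t| ≤ 1)
    (hg : ∀ x ∈ ball (0 : Eu n) 4, ∀ t ∈ Icc (0 : ℝ) T, ‖gradient (fun y => u y t) x‖ ≤ R) :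
    ∃ v1 v2 vt, IsSol n T (R + C) R C (cutErr χ) (fun x t => χ x * u x t) v1 v2 vt := by
  have hC0 : 0 ≤ C := (cutErr_nonneg 0).trans (hC 0)
  have hsub : closedBall (0 : Eu n) 3 ⊆ ball 0 4 := closedBall_subset_ball (by norm_num)
  have hχd : Differentiable ℝ χ := hχ.smooth.differentiable (by norm_num)
  have hχi : ∀ i : Fin n, Differentiable ℝ fun x => fderiv ℝ χ x (ev i) := fun i =>
    (hχ.pd_contDiff i).differentiable (by norm_num)
  have hχi0 : ∀ i : Fin n, ∀ x ∉ closedBall (0 : Eu n) 3, fderiv ℝ χ x (ev i) = 0 :=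
    fun i x hx => by simp [hχ.fderiv_zero x hx]
  have hud : ∀ t ∈ Icc (0 : ℝ) T, ∀ x ∈ ball (0 : Eu n) 4, DifferentiableAt ℝ (fun y => u y t) x :=
    fun t ht x hx => ((hu t ht).differentiableOn (by norm_num)).differentiableAt
      (isOpen_ball.mem_nhds hx)
  have hudi : ∀ t ∈ Icc (0 : ℝ) T, ∀ i : Fin n, ∀ x ∈ ball (0 : Eu n) 4,
      DifferentiableAt ℝ (fun y => fderiv ℝ (fun z => u z t) y (ev i)) x := fun t ht i x hx =>
    ((((hu t ht).fderiv_of_isOpen isOpen_ball (m := 1) (by norm_num)).differentiableOn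
      (by norm_num)).differentiableAt (isOpen_ball.mem_nhds hx)).clm_apply
      (differentiableAt_const _)
  have hgχ : ∀ x, 3 * ‖fderiv ℝ χ x‖ ≤ C := fun x => by
    refine le_trans ?_ (hC x)
    rw [cutErr, norm_gradient]
    exact le_add_of_nonneg_right (abs_nonneg _)
  have hmul := fun t ht => hasFDerivAt_mul_of_zero hχd hχ.zero (hud t ht)
  refine ⟨fun i x t => χ x * fderiv ℝ (fun y => u y t) x (ev i) + u x t * fderiv ℝ χ x (ev i),
    fun i x t => (χ x * fderiv ℝ (fun y => fderiv ℝ (fun z => u z t) y (ev i)) x (ev i) +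
      fderiv ℝ (fun y => u y t) x (ev i) * fderiv ℝ χ x (ev i)) +
      (fderiv ℝ χ x (ev i) * fderiv ℝ (fun y => u y t) x (ev i) +
      u x t * fderiv ℝ (fun y => fderiv ℝ χ y (ev i)) x (ev i)),
    fun x t => χ x * derivWithin (u x) (Icc 0 T) t, ?_⟩
  refine
    { R0 := by linarith
      L0 := by linarith
      bdd := fun t ht x => ?_
      supp := fun t ht x hx => by simp [hχ.zero x hx]
      lip := fun t ht x y => ?_
      d1 := fun t ht x i => ?_
      d2 := fun t ht x i => ?_
      dt := fun t ht x => ?_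
      eq := fun t ht x => ?_
      zcont := hχ.cutErr_continuous
      zbdd := fun x => ⟨cutErr_nonneg x, hC x⟩
      zsupp := hχ.cutErr_zero }
  · by_cases hx : x ∈ closedBall (0 : Eu n) 3
    · rw [abs_mul, abs_of_nonneg (hχ.mem x).1]
      exact mul_le_one₀ (hχ.mem x).2 (abs_nonneg _) (hb x (hsub hx) t ht)
    · simp [hχ.zero x hx]
  · rw [← Real.norm_eq_abs]
    refine convex_univ.norm_image_sub_le_of_norm_hasFDerivWithin_le
      (fun z _ => (hmul t ht z).hasFDerivWithinAt) (fun z _ => ?_) (mem_univ y) (mem_univ x)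
    by_cases hz : z ∈ closedBall (0 : Eu n) 3
    · refine (norm_add_le _ _).trans ?_
      rw [norm_smul, norm_smul, Real.norm_eq_abs, Real.norm_eq_abs, abs_of_nonneg (hχ.mem z).1]
      have h1 := hg z (hsub hz) t ht
      rw [norm_gradient] at h1
      have h2 := mul_le_mul (hχ.mem z).2 h1 (norm_nonneg _) zero_le_one
      have h3 := mul_le_mul_of_nonneg_right (hb z (hsub hz) t ht) (norm_nonneg (fderiv ℝ χ z))
      have h4 := hgχ z
      have h5 := norm_nonneg (fderiv ℝ χ z)
      linarith
    · rw [hχ.zero z hz, hχ.fderiv_zero z hz]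
      simp only [zero_smul, smul_zero, add_zero, norm_zero]
      linarith
  · have h := (hmul t ht x).hasLineDerivAt (ev i)
    simp only [add_apply, smul_apply, smul_eq_mul] at h
    exact h
  · have h1 := hasFDerivAt_mul_of_zero hχd hχ.zero (hudi t ht i) x
    have h2 := hasFDerivAt_mul_of_zero (hχi i) (hχi0 i) (hud t ht) x
    have h3 := (h1.add h2).hasLineDerivAt (ev i)
    refine HasDerivAt.congr_of_eventuallyEq (h3.congr_deriv ?_)
      (Filter.Eventually.of_forall fun r => ?_)
    · simp
    · simp only [Pi.add_apply]; ring
  · by_cases hx : x ∈ closedBall (0 : Eu n) 3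
    · exact (((hut x (hsub hx)).differentiableOn (by norm_num)) t ht).hasDerivWithinAt.const_mul _
    · simpa [hχ.zero x hx] using hasDerivWithinAt_const t (Icc 0 T) (0 : ℝ)
  · by_cases hx : x ∈ closedBall (0 : Eu n) 3
    · have hx4 := hsub hx
      set G : Eu n := WithLp.toLp 2 fun i => fderiv ℝ (fun y => u y t) x (ev i) with hG
      set K : Eu n := WithLp.toLp 2 fun i => fderiv ℝ χ x (ev i) with hK
      have hGe : gradient (fun y => u y t) x = G := gradient_eq_toLp _ _
      have hKe : gradient χ x = K := gradient_eq_toLp _ _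
      have hV : (WithLp.toLp 2 fun i => χ x * fderiv ℝ (fun y => u y t) x (ev i) +
          u x t * fderiv ℝ χ x (ev i) : Eu n) = χ x • G + u x t • K := by
        ext i; simp [hG, hK]
      have hin : inner ℝ K G = ∑ i, fderiv ℝ χ x (ev i) * fderiv ℝ (fun y => u y t) x (ev i) := by
        simp [PiLp.inner_apply, hG, hK, mul_comm]
      have hsum : ∑ i, ((χ x * fderiv ℝ (fun y => fderiv ℝ (fun z => u z t) y (ev i)) x (ev i) +
          fderiv ℝ (fun y => u y t) x (ev i) * fderiv ℝ χ x (ev i)) +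
          (fderiv ℝ χ x (ev i) * fderiv ℝ (fun y => u y t) x (ev i) +
          u x t * fderiv ℝ (fun y => fderiv ℝ χ y (ev i)) x (ev i))) +
          χ x * derivWithin (u x) (Icc 0 T) t =
          χ x * (slap (fun y => u y t) x + derivWithin (u x) (Icc 0 T) t) + 2 * inner ℝ K G +
            u x t * slap χ x := by
        have hs : ∀ a b c d : Fin n → ℝ, ∑ i, ((χ x * a i + b i * c i) + (c i * b i + u x t * d i)) =
            χ x * ∑ i, a i + 2 * ∑ i, c i * b i + u x t * ∑ i, d i := fun a b c d => by
          rw [Finset.mul_sum, Finset.mul_sum, Finset.mul_sum, ← Finset.sum_add_distrib,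
            ← Finset.sum_add_distrib]
          exact Finset.sum_congr rfl fun i _ => by ring
        rw [hs, hin, slap, slap]
        ring
      have hc := hχ.mem x
      have hb' := hb x hx4 t ht
      have he := heq x hx4 t ht
      have hg' := hg x hx4 t ht
      rw [hGe] at he hg'
      rw [hV, hsum, cutErr, hKe, abs_mul, abs_of_nonneg hc.1]
      have h1 : χ x * ‖G‖ ≤ ‖χ x • G + u x t • K‖ + ‖K‖ := by
        have ha := norm_sub_le (χ x • G + u x t • K) (u x t • K)
        rw [add_sub_cancel_right, norm_smul, norm_smul, Real.norm_eq_abs, Real.norm_eq_abs,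
          abs_of_nonneg hc.1] at ha
        have hk := mul_le_mul_of_nonneg_right hb' (norm_nonneg K)
        linarith
      have h2 : |χ x * (slap (fun y => u y t) x + derivWithin (u x) (Icc 0 T) t) +
          2 * inner ℝ K G + u x t * slap χ x| ≤
          χ x * (R ^ 2 * |u x t| + R * ‖G‖) + 2 * (‖K‖ * R) + R * |slap χ x| := by
        refine (abs_add_le _ _).trans (add_le_add ((abs_add_le _ _).trans (add_le_add ?_ ?_)) ?_)
        · rw [abs_mul, abs_of_nonneg hc.1]
          exact mul_le_mul_of_nonneg_left he hc.1
        · rw [abs_mul, abs_two]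
          refine mul_le_mul_of_nonneg_left ((abs_real_inner_le_norm _ _).trans ?_) zero_le_two
          exact mul_le_mul_of_nonneg_left hg' (norm_nonneg _)
        · rw [abs_mul]
          exact mul_le_mul_of_nonneg_right (hb'.trans hR) (abs_nonneg _)
      have h3 := mul_le_mul_of_nonneg_left h1 (zero_le_one.trans hR)
      nlinarith
    · have h1 : ∀ i : Fin n, fderiv ℝ (fun y => fderiv ℝ χ y (ev i)) x = 0 := fun i => by
        have hev : (fun y => fderiv ℝ χ y (ev i)) =ᶠ[nhds x] fun _ => 0 := by
          filter_upwards [isClosed_closedBall.isOpen_compl.mem_nhds hx] with y hy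
            using hχi0 i y hy
        rw [hev.fderiv_eq]; simp
      have h2 := cutErr_nonneg (χ := χ) x
      simp only [hχ.zero x hx, hχ.fderiv_zero x hx, h1, zero_mul, mul_zero, add_zero, abs_zero,
        zero_apply, Finset.sum_const_zero]
      have hR0 : 0 ≤ R := by linarith
      positivity

end IsCutoff

/-- The Gaussian weight in the main theorem compared with the heat kernel at scale `ε / (8R²)`. -/
theorem exp_le_weight_integral {n : ℕ} {R ε H I : ℝ} (hR : 1 ≤ R) (hε : 0 < ε)
    (hlog : 1 ≤ Real.log (1 / ε))
    (hH : Real.exp (-(R ^ 2 * (1 + Real.log (2 / (ε / (8 * R ^ 2) * R ^ 2))))) ≤ H)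
    (hI : Real.exp ((n : ℝ) / 2 * Real.log (ε / (8 * R ^ 2))) * H ≤ I) :
    Real.exp (-(5 * (n + 1) * R ^ 2 * Real.log (1 / ε))) ≤ I := by
  have hR0 : 0 < R := by linarith
  have hR2 : 1 ≤ R ^ 2 := one_le_pow₀ hR
  refine le_trans ?_ ((mul_le_mul_of_nonneg_left hH (Real.exp_pos _).le).trans hI)
  rw [← Real.exp_add, Real.exp_le_exp]
  have e1 : 2 / (ε / (8 * R ^ 2) * R ^ 2) = 16 * (1 / ε) := by field_simp; norm_num
  have e2 : ε / (8 * R ^ 2) = (8 * R ^ 2 * (1 / ε))⁻¹ := by field_simp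
  have l2 : Real.log 2 ≤ 0.7 := Real.log_two_lt_d9.le.trans (by norm_num)
  have l16 : Real.log 16 = 4 * Real.log 2 := by
    rw [show (16 : ℝ) = 2 ^ 4 by norm_num, Real.log_pow]; norm_num
  have l8 : Real.log 8 = 3 * Real.log 2 := by
    rw [show (8 : ℝ) = 2 ^ 3 by norm_num, Real.log_pow]; norm_num
  have lR : Real.log (R ^ 2) ≤ R ^ 2 - 1 := Real.log_le_sub_one_of_pos (by positivity)
  have hε' : 0 < 1 / ε := by positivity
  rw [e1, e2, Real.log_inv, Real.log_mul (by positivity) hε'.ne',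
    Real.log_mul (by positivity) (by positivity), Real.log_mul (by positivity) (by positivity),
    l8, l16]
  set l := Real.log (1 / ε)
  have h1 : R ^ 2 * (1 + (4 * Real.log 2 + l)) ≤ R ^ 2 * (5 * l) :=
    mul_le_mul_of_nonneg_left (by linarith) (by positivity)
  have h2 : 3 * Real.log 2 + Real.log (R ^ 2) + l ≤ R ^ 2 * (5 * l) := by
    have : 3 * Real.log 2 ≤ R ^ 2 * 2.1 := by nlinarith
    nlinarith
  have h3 : (n : ℝ) / 2 * (3 * Real.log 2 + Real.log (R ^ 2) + l) ≤ n * (R ^ 2 * (5 * l)) := by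
    have h0 : 0 ≤ R ^ 2 * (5 * l) := by positivity
    have h4 := mul_le_mul_of_nonneg_left h2 (show (0 : ℝ) ≤ (n : ℝ) / 2 by positivity)
    have h5 : (n : ℝ) / 2 * (R ^ 2 * (5 * l)) ≤ n * (R ^ 2 * (5 * l)) :=
      mul_le_mul_of_nonneg_right (by linarith [n.cast_nonneg (α := ℝ)]) h0
    linarith
  linarith

/-- The weighted norm on `B₄` dominates the Gaussian height of the cut-off function. -/
theorem IsCutoff.gh_le_weight_integral {n : ℕ} {χ : Eu n → ℝ} (hχ : IsCutoff χ) {R ε : ℝ}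
    (hR : 0 < R) (hε : 0 < ε) {u : Eu n → ℝ → ℝ}
    (hc : ContinuousOn (fun x => u x 0) (ball (0 : Eu n) 4))
    (hb : ∀ x ∈ ball (0 : Eu n) 4, |u x 0| ≤ 1) :
    Real.exp ((n : ℝ) / 2 * Real.log (ε / (8 * R ^ 2))) *
      gh n (fun x t => χ x * u x t) (ε / (8 * R ^ 2)) 0 ≤
      ∫ x in ball (0 : Eu n) 4, (u x 0 * Real.exp (-(R ^ 2 * ‖x‖ ^ 2) / ε)) ^ 2 := by
  have hsub : closedBall (0 : Eu n) 3 ⊆ ball 0 4 := closedBall_subset_ball (by norm_num)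
  have hle1 : ∀ x ∈ ball (0 : Eu n) 4, (u x 0 * Real.exp (-(R ^ 2 * ‖x‖ ^ 2) / ε)) ^ 2 ≤ 1 := by
    intro x hx
    rw [← sq_abs, abs_mul, Real.abs_exp]
    refine pow_le_one₀ (by positivity) (mul_le_one₀ (hb x hx) (Real.exp_pos _).le ?_)
    rw [Real.exp_le_one_iff, neg_div]
    exact neg_nonpos.2 (by positivity)
  have hcont : ContinuousOn (fun x => (u x 0 * Real.exp (-(R ^ 2 * ‖x‖ ^ 2) / ε)) ^ 2)
      (ball (0 : Eu n) 4) := (hc.mul (by fun_prop)).pow 2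
  have hintg : IntegrableOn (fun x => (u x 0 * Real.exp (-(R ^ 2 * ‖x‖ ^ 2) / ε)) ^ 2)
      (ball (0 : Eu n) 4) := by
    have : IsFiniteMeasure (volume.restrict (ball (0 : Eu n) 4)) :=
      ⟨by simpa using measure_ball_lt_top⟩
    refine Integrable.of_bound (hcont.aestronglyMeasurable measurableSet_ball) 1 ?_
    filter_upwards [ae_restrict_mem measurableSet_ball] with x hx
    rw [Real.norm_eq_abs, abs_of_nonneg (sq_nonneg _)]
    exact hle1 x hx
  rw [gh, ← integral_const_mul, ← integral_indicator measurableSet_ball]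
  refine integral_mono_of_nonneg (Filter.Eventually.of_forall fun x => ?_)
    (hintg.integrable_indicator measurableSet_ball) (Filter.Eventually.of_forall fun x => ?_)
  · have := gk_pos n (ε / (8 * R ^ 2)) x
    positivity
  · by_cases hx : x ∈ closedBall (0 : Eu n) 3
    · rw [indicator_of_mem (hsub hx)]
      have e : Real.exp ((n : ℝ) / 2 * Real.log (ε / (8 * R ^ 2))) * gk n (ε / (8 * R ^ 2)) x =
          Real.exp (-(R ^ 2 * ‖x‖ ^ 2) / ε) ^ 2 := by
        rw [gk, ← Real.exp_add, ← Real.exp_nat_mul]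
        congr 1
        field_simp
        push_cast
        ring
      have h1 : (χ x * u x 0) ^ 2 ≤ u x 0 ^ 2 := by
        rw [mul_pow]
        exact mul_le_of_le_one_left (sq_nonneg _) (pow_le_one₀ (hχ.mem x).1 (hχ.mem x).2)
      calc _ = (χ x * u x 0) ^ 2 * (Real.exp ((n : ℝ) / 2 * Real.log (ε / (8 * R ^ 2))) *
            gk n (ε / (8 * R ^ 2)) x) := by ring
        _ ≤ _ := by
          rw [e, mul_pow (u x 0)]
          exact mul_le_mul_of_nonneg_right h1 (sq_nonneg _)
    · simp only [hχ.zero x hx, zero_mul, ne_eq, OfNat.ofNat_ne_zero, not_false_eq_true, zero_pow,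
        mul_zero]
      exact indicator_nonneg (fun y _ => sq_nonneg _) x

/-- given `θ ∈ (0,1]` there are `N = N(n,θ) ≥ 1` and `ρ = ρ(n,θ) ∈ (0,1]`
such that if `u` is `C^{2,1}` on `B₄ × [0,1/R²]` with `|Δu + ∂ₜu| ≤ R²|u| + R|∇u|`,
`‖u‖_∞ ≤ 1`, `‖∇u‖_∞ ≤ R` and `‖u(·,0)‖_{L²(B_ρ)} ≥ θ R^{-n/2}`, then
`‖u(·,0) e^{-R²|x|²/ε}‖_{L²(B₄)} ≥ e^{-N R² log(1/ε)}` for `0 < ε ≤ 1/(3N)`, `R ≥ N`. -/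
theorem stmt_13 (n : ℕ) : ∀ θ : ℝ, θ ∈ Ioc (0 : ℝ) 1 →
    ∃ N ≥ (1 : ℝ), ∃ ρ ∈ Ioc (0 : ℝ) 1, ∀ R : ℝ, 0 < R →
    ∀ u : EuclideanSpace ℝ (Fin n) → ℝ → ℝ,
    (∀ t ∈ Icc (0 : ℝ) (1 / R ^ 2),
      ContDiffOn ℝ 2 (fun x => u x t) (ball (0 : EuclideanSpace ℝ (Fin n)) 4)) →
    (∀ x ∈ ball (0 : EuclideanSpace ℝ (Fin n)) 4,
      ContDiffOn ℝ 1 (u x) (Icc (0 : ℝ) (1 / R ^ 2))) →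
    (∀ x ∈ ball (0 : EuclideanSpace ℝ (Fin n)) 4, ∀ t ∈ Icc (0 : ℝ) (1 / R ^ 2),
      |slap (fun y => u y t) x + derivWithin (u x) (Icc (0 : ℝ) (1 / R ^ 2)) t| ≤
        R ^ 2 * |u x t| + R * ‖gradient (fun y => u y t) x‖) →
    (∀ x ∈ ball (0 : EuclideanSpace ℝ (Fin n)) 4, ∀ t ∈ Icc (0 : ℝ) (1 / R ^ 2),
      |u x t| ≤ 1) →
    (∀ x ∈ ball (0 : EuclideanSpace ℝ (Fin n)) 4, ∀ t ∈ Icc (0 : ℝ) (1 / R ^ 2),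
      ‖gradient (fun y => u y t) x‖ ≤ R) →
    Real.sqrt (∫ x in ball (0 : EuclideanSpace ℝ (Fin n)) ρ, u x 0 ^ 2) ≥
      θ * R ^ (-(n : ℝ) / 2) →
    ∀ ε : ℝ, 0 < ε → ε ≤ 1 / (3 * N) → R ≥ N →
      Real.sqrt (∫ x in ball (0 : EuclideanSpace ℝ (Fin n)) 4,
          (u x 0 * Real.exp (-(R ^ 2 * ‖x‖ ^ 2) / ε)) ^ 2) ≥
        Real.exp (-(N * R ^ 2 * Real.log (1 / ε))) := by
  rintro θ ⟨hθ, -⟩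
  obtain ⟨χ, hχ⟩ := exists_isCutoff n
  obtain ⟨C, hC⟩ := hχ.exists_cutErr_le
  obtain ⟨N, hN1, hN⟩ := exists_height_ge n hθ C
  have hM1 : 1 ≤ max N (5 * ((n : ℝ) + 1)) := hN1.trans (le_max_left _ _)
  refine ⟨max N (5 * (n + 1)), hM1, 1 / 1000, by norm_num, ?_⟩
  intro R hR0 u hu hut heq hb hg hL2 ε hε hεM hRM
  have hR : 1 ≤ R := hM1.trans hRM
  have h0 : (0 : ℝ) ∈ Icc (0 : ℝ) (1 / R ^ 2) := ⟨le_rfl, by positivity⟩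
  obtain ⟨v1, v2, vt, hsol⟩ := hχ.isSol hC hR hu hut heq hb hg
  have hε1 : ε ≤ 1 / 3 := hεM.trans (one_div_le_one_div_of_le (by norm_num) (by linarith))
  have hlog : 1 ≤ Real.log (1 / ε) := by
    rw [Real.le_log_iff_exp_le (by positivity), le_div_iff₀ hε]
    nlinarith [Real.exp_one_lt_d9, Real.exp_pos 1]
  have hmass : θ ^ 2 * R ^ (-(n : ℝ)) ≤ ∫ x in ball (0 : Eu n) (1 / 1000), (χ x * u x 0) ^ 2 := by
    have e1 : ∫ x in ball (0 : Eu n) (1 / 1000), (χ x * u x 0) ^ 2 =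
        ∫ x in ball (0 : Eu n) (1 / 1000), u x 0 ^ 2 := by
      refine setIntegral_congr_fun measurableSet_ball fun x hx => ?_
      have hx' : ‖x‖ < 1 / 1000 := by simpa using hx
      simp only [hχ.one x (by linarith), one_mul]
    have e2 : θ ^ 2 * R ^ (-(n : ℝ)) = (θ * R ^ (-(n : ℝ) / 2)) ^ 2 := by
      rw [mul_pow, ← Real.rpow_mul_natCast hR0.le]
      congr 2
      push_cast
      ring
    rw [e1, e2]
    exact (Real.le_sqrt' (by positivity)).1 hL2
  have hH := hN R ((le_max_left _ _).trans hRM) _ _ _ _ _ _ hsol hχ.cutErr_zero_of_lt hmass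
    (ε / (8 * R ^ 2)) (by positivity) (by gcongr <;> nlinarith)
  have hI := exp_le_weight_integral hR hε hlog hH (hχ.gh_le_weight_integral hR0 hε
    (hu 0 h0).continuousOn fun x hx => hb x hx 0 h0)
  refine Real.le_sqrt_of_sq_le (le_trans ?_ hI)
  have hp : 0 ≤ R ^ 2 * Real.log (1 / ε) := by positivity
  rw [← Real.exp_nat_mul, Real.exp_le_exp]
  have := mul_le_mul_of_nonneg_right (le_max_right N (5 * ((n : ℝ) + 1))) hp
  have := mul_nonneg (zero_le_one.trans hM1) hp
  push_cast
  linarith
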